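/- Let m ≥ 2 and let x_0, x_1 ∈ ℝ^m. If {Λ_t}_{t∈[0,1]} is a non-negative Legendrian isotopy in ℝ^m × S^{m-1} ≅ ST*ℝ^m with Λ_0 = {x_0} × S^{m-1} and Λ_1 = {x_1} × S^{m-1} (two fibres of ST*ℝ^m), then x_0 = x_1 and the isotopy is constant: Λ_t = {x_0} × S^{m-1} for every t ∈ [0,1]. -/

import Mathlib

/-!
STATEMENT 8: If a non-negative Legendrian isotopy in `ST*ℝ^m ≅ ℝ^m × S^{m-1}` connects
the fibre `{x₀} × S^{m-1}` to the fibre `{x₁} × S^{m-1}`, then `x₀ = x₁` and the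
isotopy is constant: `Λ_t = {x₀} × S^{m-1}` for all `t ∈ [0,1]`
(Corollary 6.1 of the paper).

We identify `ST*ℝ^m` with `ℝ^m × S^{m-1}`, a point `(x,q)` corresponding to the
covector `⟨q,·⟩` at `x`; a submanifold is Legendrian when its tangent vectors `(v,w)`
at `(x,q)` satisfy `⟨v,q⟩ = 0`.  An isotopy starting at the fibre over `x₀`
(parameterised by the sphere, `F₀ : q ↦ (x₀,q)` the inclusion) is recorded by a map
`F : S^{m-1} × [0,1] → ℝ^m × S^{m-1}`, `F(s,t) = (x(s,t), q(s,t))`; smoothness of `F`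
(a map defined on the submanifold `S^{m-1} × [0,1]`) is expressed, equivalently, by
smoothness of an ambient extension `F : ℝ^m × ℝ → ℝ^m × ℝ^m` (only the values on
`S^{m-1} × [0,1]` are constrained; tangency conditions use only vectors `v` tangent to
the sphere, so they depend only on the restriction).  Each `F_t` is an embedding
(injective immersion of the compact sphere) onto a Legendrian submanifold `Λ_t`.
Non-negativity: `⟨∂x/∂t, q⟩ ≥ 0`.
-/

noncomputable section

open Set Metric
open scoped RealInnerProductSpace

/-- The unit sphere `S^{m-1} ⊂ ℝ^m`. -/
def sph (m : ℕ) : Set (EuclideanSpace ℝ (Fin m)) := Metric.sphere (0 : EuclideanSpace ℝ (Fin m)) 1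

/-- Ambient model `ℝ^m × ℝ^m` of `ST*ℝ^m ≅ ℝ^m × S^{m-1}`. -/
abbrev STSp (m : ℕ) := EuclideanSpace ℝ (Fin m) × EuclideanSpace ℝ (Fin m)

/-- `F : ℝ^m × ℝ → ℝ^m × ℝ^m` represents a Legendrian isotopy `{Λ_t}_{t∈[0,1]}` in
`ST*ℝ^m ≅ ℝ^m × S^{m-1}` parameterised by the sphere: it is smooth, maps
`S^{m-1} × [0,1]` into `ℝ^m × S^{m-1}`, each `F_t|_{S^{m-1}}` is an injective immersion
(hence an embedding of the compact sphere) onto `Λ_t`, and each `Λ_t` is Legendrian: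
every tangent vector `(v,w)` of `Λ_t` at `(x,q)` satisfies `⟨v,q⟩ = 0`. -/
structure IsLegIsotopyST (m : ℕ) (F : EuclideanSpace ℝ (Fin m) × ℝ → STSp m) : Prop where
  smooth : ContDiff ℝ (⊤ : ℕ∞) F
  mem_sphere : ∀ s ∈ sph m, ∀ t ∈ Icc (0:ℝ) 1, (F (s, t)).2 ∈ sph m
  inj : ∀ t ∈ Icc (0:ℝ) 1, InjOn (fun s => F (s, t)) (sph m)
  imm : ∀ t ∈ Icc (0:ℝ) 1, ∀ s ∈ sph m, ∀ v : EuclideanSpace ℝ (Fin m),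
    ⟪v, s⟫ = 0 → v ≠ 0 → fderiv ℝ (fun s' => F (s', t)) s v ≠ 0
  leg : ∀ t ∈ Icc (0:ℝ) 1, ∀ s ∈ sph m, ∀ v : EuclideanSpace ℝ (Fin m), ⟪v, s⟫ = 0 →
    ⟪(fderiv ℝ (fun s' => F (s', t)) s v).1, (F (s, t)).2⟫ = 0

/-- Non-negativity of the Legendrian isotopy: `⟨∂x/∂t, q⟩ ≥ 0`. -/
def NonnegST (m : ℕ) (F : EuclideanSpace ℝ (Fin m) × ℝ → STSp m) : Prop :=
  ∀ s ∈ sph m, ∀ t ∈ Icc (0:ℝ) 1,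
    0 ≤ ⟪deriv (fun t' => (F (s, t')).1) t, (F (s, t)).2⟫

/-- The slice `Λ_t = F_t(S^{m-1})` of the isotopy. -/
def stSlice (m : ℕ) (F : EuclideanSpace ℝ (Fin m) × ℝ → STSp m) (t : ℝ) : Set (STSp m) :=
  (fun s => F (s, t)) '' sph m

/-- The fibre `{x} × S^{m-1}` of `ST*ℝ^m` over `x`. -/
def fib (m : ℕ) (x : EuclideanSpace ℝ (Fin m)) : Set (STSp m) :=
  {x} ×ˢ sph m

section Brouwer

open MeasureTheory

/-- The value at `1` of the polynomial `t ↦ det (1 + t A)` is given by Lagrange interpolation. -/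
theorem det_one_add_eq_sum_lagrange {W : Type*} [NormedAddCommGroup W] [NormedSpace ℝ W]
    [FiniteDimensional ℝ W] (s : Finset ℕ) (hs : Module.finrank ℝ W < s.card) (v : ℕ → ℝ)
    (hv : Set.InjOn v s) (A : W →L[ℝ] W) :
    (1 + A).det = ∑ j ∈ s, (1 + v j • A).det * (Lagrange.basis s v j).eval 1 := by
  classical
  let b := Module.finBasis ℝ W
  let M := LinearMap.toMatrix b b (A : W →ₗ[ℝ] W)
  let p : Polynomial ℝ := Matrix.det ((Polynomial.X : Polynomial ℝ) • M.map Polynomial.C +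
    (1 : Matrix _ _ ℝ).map Polynomial.C)
  have hp : ∀ t : ℝ, p.eval t = (1 + t • A).det := by
    intro t
    have h1 : (1 + t • A).det = (1 + t • M).det := by
      rw [ContinuousLinearMap.det, ← LinearMap.det_toMatrix b]
      congr 1
      simp [M, LinearMap.toMatrix_one]
    rw [h1, ← Polynomial.coe_evalRingHom, RingHom.map_det]
    congr 1
    ext i j
    have h2 : ((1 : Matrix (Fin (Module.finrank ℝ W)) (Fin (Module.finrank ℝ W)) ℝ) i j) =
        if i = j then 1 else 0 := Matrix.one_apply
    simp only [RingHom.mapMatrix_apply, Matrix.map_apply, Matrix.add_apply, Matrix.smul_apply,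
      smul_eq_mul, Polynomial.coe_evalRingHom, Polynomial.eval_add, Polynomial.eval_mul,
      Polynomial.eval_X, Polynomial.eval_C]
    ring
  have hdeg : p.degree < s.card := by
    refine lt_of_le_of_lt Polynomial.degree_le_natDegree ?_
    have := Polynomial.natDegree_det_X_add_C_le M (1 : Matrix _ _ ℝ)
    rw [Fintype.card_fin] at this
    exact_mod_cast lt_of_le_of_lt this hs
  have h := Lagrange.eq_interpolate hv hdeg
  have h1 := hp 1
  rw [one_smul] at h1
  rw [← h1, h, Lagrange.interpolate_apply, Polynomial.eval_finsetSum]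
  refine Finset.sum_congr rfl fun j _ => ?_
  rw [Polynomial.eval_mul, Polynomial.eval_C, hp]

/-- A Lipschitz perturbation of the identity supported in a ball has total Jacobian equal to the
volume of the ball. -/
theorem integral_det_one_add_fderiv {W : Type*} [NormedAddCommGroup W] [NormedSpace ℝ W]
    [FiniteDimensional ℝ W] [MeasurableSpace W] [BorelSpace W] (μ : Measure W)
    [μ.IsAddHaarMeasure] (h : W → W) (K : NNReal) (hK : LipschitzWith K h) (R : ℝ)
    (h0 : ∀ x, x ∉ ball (0 : W) R → h x = 0)
    (hd : ∀ x ∈ ball (0 : W) R, DifferentiableAt ℝ h x) :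
    ∫ x in ball (0 : W) R, (1 + fderiv ℝ h x).det ∂μ = μ.real (ball (0 : W) R) := by
  have hcd : Continuous fun A : W →L[ℝ] W => A.det := ContinuousLinearMap.continuous_det
  have hbd : ∀ x, ‖fderiv ℝ h x‖ ≤ K := fun x => norm_fderiv_le_of_lipschitz ℝ hK
  have hInt : ∀ t : ℝ, IntegrableOn (fun x => (1 + t • fderiv ℝ h x).det) (ball 0 R) μ := by
    intro t
    have hc : Continuous fun A : W →L[ℝ] W => (1 + t • A).det :=
      hcd.comp (by fun_prop)
    obtain ⟨C, hC⟩ := (isCompact_closedBall (0 : W →L[ℝ] W) K).exists_bound_of_continuousOn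
      hc.continuousOn
    refine Measure.integrableOn_of_bounded (M := C) measure_ball_lt_top.ne ?_ ?_
    · exact (hc.measurable.comp (measurable_fderiv ℝ h)).aestronglyMeasurable
    · exact Filter.Eventually.of_forall fun x => hC _ (by simpa using hbd x)
  obtain ⟨ε, hε, hpos⟩ : ∃ ε > 0, ∀ A : W →L[ℝ] W, ‖A‖ < ε → 0 < (1 + A).det := by
    have hc : Continuous fun A : W →L[ℝ] W => (1 + A).det := hcd.comp (by fun_prop)
    have h1 : (0 : ℝ) < (1 + (0 : W →L[ℝ] W)).det := by
      simp [ContinuousLinearMap.det]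
    have := (hc.tendsto 0).eventually (lt_mem_nhds h1)
    rw [Metric.eventually_nhds_iff] at this
    obtain ⟨ε, hε, h⟩ := this
    exact ⟨ε, hε, fun A hA => h (by simpa using hA)⟩
  have hsmall : ∀ t : ℝ, 0 < t → t * K < ε → t * K < 1 →
      ∫ x in ball (0 : W) R, (1 + t • fderiv ℝ h x).det ∂μ = μ.real (ball (0 : W) R) := by
    intro t ht htε ht1
    have hlip : ∀ x y, ‖t • h x - t • h y‖ ≤ (t * K) * ‖x - y‖ := by
      intro x y
      rw [← smul_sub, norm_smul, Real.norm_of_nonneg ht.le, mul_assoc]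
      gcongr
      simpa [dist_eq_norm] using hK.dist_le_mul x y
    have hinj : Function.Injective fun x => x + t • h x := by
      intro x y hxy
      have h1 : x - y = -(t • h x - t • h y) := by
        have : x + t • h x = y + t • h y := hxy
        rw [neg_sub, sub_eq_sub_iff_add_eq_add, this, add_comm]
      have h2 := hlip x y
      rw [← norm_neg, ← h1] at h2
      have h3 : ‖x - y‖ = 0 := by nlinarith [norm_nonneg (x - y)]
      exact sub_eq_zero.1 (norm_eq_zero.1 h3)
    have hsurj : Function.Surjective fun x => x + t • h x := by
      intro y
      have hcon : ContractingWith ⟨t * K, by positivity⟩ fun x => y - t • h x := by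
        refine ⟨by exact_mod_cast ht1, LipschitzWith.of_dist_le_mul fun a b => ?_⟩
        rw [dist_eq_norm, dist_eq_norm]
        have : y - t • h a - (y - t • h b) = -(t • h a - t • h b) := by abel
        rw [this, norm_neg]
        exact hlip a b
      refine ⟨hcon.fixedPoint, ?_⟩
      have := hcon.fixedPoint_isFixedPt
      have h2 : y - t • h hcon.fixedPoint = hcon.fixedPoint := this
      change hcon.fixedPoint + t • h hcon.fixedPoint = y
      rw [eq_comm, ← sub_eq_iff_eq_add, h2]
    have himg : (fun x => x + t • h x) '' ball 0 R = ball (0 : W) R := by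
      have hcompl : (fun x => x + t • h x) '' (ball (0 : W) R)ᶜ = (ball (0 : W) R)ᶜ := by
        have : EqOn (fun x => x + t • h x) id (ball (0 : W) R)ᶜ := by
          intro x hx
          simp [h0 x hx]
        rw [this.image_eq, image_id]
      rw [image_compl_eq ⟨hinj, hsurj⟩] at hcompl
      exact compl_injective hcompl
    have key := integral_image_eq_integral_abs_det_fderiv_smul μ
      (measurableSet_ball (x := (0 : W)) (ε := R))
      (f := fun x => x + t • h x) (f' := fun x => 1 + t • fderiv ℝ h x)
      (fun x hx => ((hasFDerivAt_id x).add ((hd x hx).hasFDerivAt.const_smul t)).hasFDerivWithinAt)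
      hinj.injOn (fun _ => (1 : ℝ))
    rw [himg] at key
    simp only [smul_eq_mul, mul_one, integral_const, MeasurableSet.univ,
      measureReal_restrict_apply, univ_inter] at key
    rw [key]
    refine integral_congr_ae (Filter.Eventually.of_forall fun x => ?_)
    refine (abs_of_pos (hpos _ ?_)).symm
    rw [norm_smul, Real.norm_of_nonneg ht.le]
    exact lt_of_le_of_lt (by gcongr; exact hbd x) htε
  obtain ⟨t0, ht0, ht0ε, ht01⟩ : ∃ t0 : ℝ, 0 < t0 ∧ t0 * K < ε ∧ t0 * K < 1 := by
    have hK1 : (0 : ℝ) < K + 1 := by positivity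
    refine ⟨min ε 1 / (K + 1), by positivity, ?_, ?_⟩
    · rw [div_mul_eq_mul_div, div_lt_iff₀ hK1]
      nlinarith [min_le_left ε 1, K.coe_nonneg, lt_min hε one_pos]
    · rw [div_mul_eq_mul_div, div_lt_iff₀ hK1]
      nlinarith [min_le_right ε 1, K.coe_nonneg, lt_min hε one_pos]
  let s := Finset.range (Module.finrank ℝ W + 1)
  let v : ℕ → ℝ := fun j => t0 / (j + 1)
  have hvpos : ∀ j, 0 < v j := fun j => by positivity
  have hvle : ∀ j, v j ≤ t0 := fun j => div_le_self ht0.le (by simp)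
  have hv : Set.InjOn v s := by
    intro i _ j _ hij
    have : t0 / ((i : ℝ) + 1) = t0 / ((j : ℝ) + 1) := hij
    field_simp at this
    have h2 : (j : ℝ) = i := by linarith
    exact_mod_cast h2.symm
  have hs : Module.finrank ℝ W < s.card := by simp [s]
  calc ∫ x in ball (0 : W) R, (1 + fderiv ℝ h x).det ∂μ
      = ∫ x in ball (0 : W) R,
          ∑ j ∈ s, (1 + v j • fderiv ℝ h x).det * (Lagrange.basis s v j).eval 1 ∂μ := by
        simp_rw [← det_one_add_eq_sum_lagrange s hs v hv]
    _ = ∑ j ∈ s, μ.real (ball (0 : W) R) * (Lagrange.basis s v j).eval 1 := by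
        rw [integral_finsetSum _ fun j _ => (hInt (v j)).mul_const _]
        refine Finset.sum_congr rfl fun j _ => ?_
        rw [integral_mul_const, hsmall (v j) (hvpos j)]
        · exact lt_of_le_of_lt (by gcongr; exact hvle j) ht0ε
        · exact lt_of_le_of_lt (by gcongr; exact hvle j) ht01
    _ = μ.real (ball (0 : W) R) := by
        rw [← Finset.mul_sum, ← Polynomial.eval_finsetSum,
          Lagrange.sum_basis hv ⟨0, by simp [s]⟩, Polynomial.eval_one, mul_one]

/-- **Brouwer's theorem**: a bounded continuous perturbation of the identity has a zero. -/
theorem exists_add_eq_zero_of_bounded {W : Type*} [NormedAddCommGroup W] [InnerProductSpace ℝ W]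
    [FiniteDimensional ℝ W] (h : W → W) (hc : Continuous h) (C : ℝ) (hC : ∀ x, ‖h x‖ ≤ C) :
    ∃ x, x + h x = 0 := by
  by_contra! hne
  have hC0 : 0 ≤ C := (norm_nonneg _).trans (hC 0)
  obtain ⟨R, hRC⟩ : ∃ R : ℝ, R = 8 * (C + 1) := ⟨_, rfl⟩
  have hR : 0 < R := by rw [hRC]; positivity
  let χ : ContDiffBump (0 : W) := ⟨R / 4, R / 2, by positivity, by linarith⟩
  have hχc : Continuous fun x => χ x • h x := χ.continuous.smul hc
  have hχb : ∀ x, ‖χ x • h x‖ ≤ C := by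
    intro x
    rw [norm_smul, Real.norm_of_nonneg χ.nonneg]
    exact (mul_le_of_le_one_left (norm_nonneg _) χ.le_one).trans (hC x)
  have hχne : ∀ x, x + χ x • h x ≠ 0 := by
    intro x
    by_cases hx : x ∈ closedBall (0 : W) (R / 4)
    · rw [χ.one_of_mem_closedBall hx, one_smul]
      exact hne x
    · intro h0
      have h1 : ‖x‖ ≤ C := by
        rw [eq_neg_of_add_eq_zero_left h0, norm_neg]
        exact hχb x
      rw [mem_closedBall_zero_iff, not_le] at hx
      linarith
  obtain ⟨δ, hδ, hδx⟩ : ∃ δ > 0, ∀ x ∈ closedBall (0 : W) R, 2 * δ ≤ ‖x + χ x • h x‖ := by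
    obtain ⟨x0, -, hx0⟩ := (isCompact_closedBall (0 : W) R).exists_isMinOn
      ⟨0, by simp [hR.le]⟩ (f := fun x => ‖x + χ x • h x‖)
      ((continuous_id.add hχc).norm).continuousOn
    refine ⟨‖x0 + χ x0 • h x0‖ / 2, half_pos (norm_pos_iff.2 (hχne x0)), fun x hx => ?_⟩
    rw [mul_div_cancel₀ _ two_ne_zero]
    exact hx0 hx
  obtain ⟨k, hk, hkd, hks⟩ := hχc.exists_contDiff_approx 1 (ε := fun _ => min δ 1)
    continuous_const (fun _ => lt_min hδ one_pos)
  have hk0 : ∀ x, R / 2 ≤ ‖x‖ → k x = 0 := by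
    intro x hx
    by_contra hkx
    have h1 : χ x • h x ≠ 0 := hks hkx
    have h2 : χ x ≠ 0 := left_ne_zero_of_smul h1
    have h3 : x ∈ Function.support χ := h2
    rw [χ.support_eq, mem_ball_zero_iff] at h3
    exact absurd h3 (not_lt.2 hx)
  have hkb : ∀ x, ‖k x‖ ≤ R / 8 := by
    intro x
    have h1 := (hkd x).trans_le (min_le_right _ _)
    rw [dist_eq_norm] at h1
    have h2 := norm_le_norm_add_norm_sub' (k x) (χ x • h x)
    have h3 := hχb x
    linarith
  let g : W → W := fun x => x + k x
  have hgd : ContDiff ℝ 1 g := contDiff_id.add hk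
  have hglow : ∀ x ∈ closedBall (0 : W) R, δ ≤ ‖g x‖ := by
    intro x hx
    have h1 := (hkd x).trans_le (min_le_left _ _)
    rw [dist_eq_norm] at h1
    have h2 := hδx x hx
    have h3 : x + χ x • h x = g x - (k x - χ x • h x) := by simp only [g]; abel
    have h4 := norm_sub_le (g x) (k x - χ x • h x)
    rw [← h3] at h4
    linarith
  have hglt : ∀ x, ‖x‖ < R → ‖g x‖ < R := by
    intro x hx
    by_cases hx2 : R / 2 ≤ ‖x‖
    · simpa [g, hk0 x hx2] using hx
    · have := norm_add_le x (k x)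
      have := hkb x
      simp only [g]
      linarith
  have hkcs : HasCompactSupport k := by
    refine HasCompactSupport.intro (isCompact_closedBall (0 : W) R) fun x hx => hk0 x ?_
    rw [mem_closedBall_zero_iff, not_le] at hx
    linarith
  obtain ⟨K, hK⟩ := hk.lipschitzWith_of_hasCompactSupport hkcs one_ne_zero
  have hKn : ∀ x y, ‖k x - k y‖ ≤ K * ‖x - y‖ := fun x y => by
    simpa [dist_eq_norm] using hK.dist_le_mul x y
  have hgn : ∀ x y, ‖g x - g y‖ ≤ (1 + K) * ‖x - y‖ := by
    intro x y
    have h1 : g x - g y = (x - y) + (k x - k y) := by simp only [g]; abel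
    rw [h1, add_mul, one_mul]
    exact (norm_add_le _ _).trans (by linarith [hKn x y])
  let ν : W → W := fun u => (max ‖u‖ δ)⁻¹ • u
  have hν1 : ∀ u, ‖ν u‖ ≤ 1 := by
    intro u
    have : 0 < max ‖u‖ δ := lt_max_of_lt_right hδ
    rw [norm_smul, norm_inv, Real.norm_of_nonneg this.le, inv_mul_le_iff₀ this, mul_one]
    exact le_max_left _ _
  have hνl : ∀ u v, ‖ν u - ν v‖ ≤ 2 / δ * ‖u - v‖ := by
    intro u v
    have hu : 0 < max ‖u‖ δ := lt_max_of_lt_right hδ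
    have hv : 0 < max ‖v‖ δ := lt_max_of_lt_right hδ
    have h1 : ν u - ν v = (max ‖u‖ δ)⁻¹ • ((u - v) + (max ‖v‖ δ - max ‖u‖ δ) • ν v) := by
      have hcoef : (max ‖u‖ δ)⁻¹ * ((max ‖v‖ δ - max ‖u‖ δ) * (max ‖v‖ δ)⁻¹) =
          (max ‖u‖ δ)⁻¹ - (max ‖v‖ δ)⁻¹ := by field_simp
      simp only [ν, smul_add, smul_smul, hcoef]
      module
    have h2 : |max ‖v‖ δ - max ‖u‖ δ| ≤ ‖u - v‖ := by
      refine (abs_max_sub_max_le_abs _ _ _).trans ?_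
      rw [norm_sub_rev]
      exact abs_norm_sub_norm_le v u
    have h3 : ‖(u - v) + (max ‖v‖ δ - max ‖u‖ δ) • ν v‖ ≤ 2 * ‖u - v‖ := by
      refine (norm_add_le _ _).trans ?_
      rw [norm_smul, Real.norm_eq_abs]
      have := mul_le_mul h2 (hν1 v) (norm_nonneg _) (norm_nonneg _)
      linarith
    rw [h1, norm_smul, norm_inv, Real.norm_of_nonneg hu.le, div_mul_eq_mul_div, inv_mul_le_iff₀ hu]
    refine h3.trans ?_
    rw [mul_div_assoc', le_div_iff₀ hδ, mul_comm]
    gcongr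
    exact le_max_right _ _
  let H : W → W := fun x => k x + max (R - ‖g x‖) 0 • ν (g x)
  have hHl : ∀ x y, ‖H x - H y‖ ≤ (K + ((1 + K) + R * (2 / δ * (1 + K)))) * ‖x - y‖ := by
    intro x y
    have h1 : H x - H y = (k x - k y) + ((max (R - ‖g x‖) 0 - max (R - ‖g y‖) 0) • ν (g x)
        + max (R - ‖g y‖) 0 • (ν (g x) - ν (g y))) := by
      simp only [H, smul_sub, sub_smul]; abel
    have h2 : ‖(max (R - ‖g x‖) 0 - max (R - ‖g y‖) 0) • ν (g x)‖ ≤ (1 + K) * ‖x - y‖ := by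
      rw [norm_smul, Real.norm_eq_abs]
      refine (mul_le_of_le_one_right (abs_nonneg _) (hν1 _)).trans ?_
      refine (abs_max_sub_max_le_abs _ _ _).trans ?_
      refine le_trans ?_ (hgn x y)
      rw [sub_sub_sub_cancel_left, norm_sub_rev (g x)]
      exact abs_norm_sub_norm_le _ _
    have h3 : ‖max (R - ‖g y‖) 0 • (ν (g x) - ν (g y))‖ ≤ R * (2 / δ * (1 + K)) * ‖x - y‖ := by
      rw [norm_smul, Real.norm_of_nonneg (le_max_right _ _), mul_assoc, mul_assoc]
      refine mul_le_mul (max_le (by linarith [norm_nonneg (g y)]) hR.le) ?_ (norm_nonneg _) hR.le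
      exact (hνl _ _).trans (by gcongr; exact hgn x y)
    rw [h1]
    refine (norm_add_le _ _).trans ?_
    have := norm_add_le ((max (R - ‖g x‖) 0 - max (R - ‖g y‖) 0) • ν (g x))
      (max (R - ‖g y‖) 0 • (ν (g x) - ν (g y)))
    have := hKn x y
    linarith
  have hHlip : LipschitzWith (Real.toNNReal (K + ((1 + K) + R * (2 / δ * (1 + K))))) H := by
    refine LipschitzWith.of_dist_le_mul fun x y => ?_
    rw [dist_eq_norm, dist_eq_norm, Real.coe_toNNReal _ (by positivity)]
    exact hHl x y
  have hH0 : ∀ x, x ∉ ball (0 : W) R → H x = 0 := by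
    intro x hx
    rw [mem_ball_zero_iff, not_lt] at hx
    have h1 : k x = 0 := hk0 x (by linarith)
    have h2 : g x = x := by simp [g, h1]
    simp only [H, h1, h2, max_eq_right (sub_nonpos.2 hx), zero_smul, add_zero]
  have hHeq : ∀ x ∈ ball (0 : W) R, x + H x = (R / ‖g x‖) • g x := by
    intro x hx
    have hx' := mem_ball_zero_iff.1 hx
    have hlow := hglow x (ball_subset_closedBall hx)
    have hgp : 0 < ‖g x‖ := hδ.trans_le hlow
    simp only [H, ν, max_eq_left hlow, max_eq_left (sub_nonneg.2 (hglt x hx').le), smul_smul]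
    rw [← add_assoc]
    change g x + _ = _
    rw [← one_smul ℝ (g x), smul_smul, smul_smul, mul_one, ← add_smul]
    congr 1
    simp only [one_smul]
    field_simp
    ring
  have hev : ∀ x ∈ ball (0 : W) R, (fun x => x + H x) =ᶠ[nhds x] fun x => (R / ‖g x‖) • g x :=
    fun x hx => Filter.eventually_of_mem (isOpen_ball.mem_nhds hx) hHeq
  have hdiff : ∀ x ∈ ball (0 : W) R, DifferentiableAt ℝ (fun x => x + H x) x := by
    intro x hx
    have hgp : g x ≠ 0 := norm_pos_iff.1 (hδ.trans_le (hglow x (ball_subset_closedBall hx)))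
    have hg1 : DifferentiableAt ℝ g x := (hgd.differentiable one_ne_zero) x
    refine DifferentiableAt.congr_of_eventuallyEq ?_ (hev x hx)
    exact (((hg1.norm ℝ hgp).inv (norm_ne_zero_iff.2 hgp)).const_mul R).smul hg1
  have hHd : ∀ x ∈ ball (0 : W) R, DifferentiableAt ℝ H x := by
    intro x hx
    have := (hdiff x hx).sub differentiableAt_id
    simpa [Pi.sub_def] using this
  let _ : MeasurableSpace W := borel W
  have : BorelSpace W := ⟨rfl⟩
  have key := integral_det_one_add_fderiv (Measure.addHaar : Measure W) H _ hHlip R hH0 hHd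
  have hzero : ∀ x ∈ ball (0 : W) R, (1 + fderiv ℝ H x).det = 0 := by
    intro x hx
    by_contra hdet
    have hgp : g x ≠ 0 := norm_pos_iff.1 (hδ.trans_le (hglow x (ball_subset_closedBall hx)))
    have hf : HasFDerivAt (fun x => x + H x) (1 + fderiv ℝ H x) x :=
      (hasFDerivAt_id x).add (hHd x hx).hasFDerivAt
    have hconst : (fun y => ‖y + H y‖ ^ 2) =ᶠ[nhds x] fun _ => R ^ 2 := by
      filter_upwards [isOpen_ball.mem_nhds hx] with y hy
      have hgy : ‖g y‖ ≠ 0 := (hδ.trans_le (hglow y (ball_subset_closedBall hy))).ne'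
      rw [hHeq y hy, norm_smul, norm_div, norm_norm, div_mul_cancel₀ _ hgy,
        Real.norm_of_nonneg hR.le]
    have h1 := hf.norm_sq
    have h2 := (hasFDerivAt_const (𝕜 := ℝ) (R ^ 2) x).congr_of_eventuallyEq hconst
    have h3 := h1.unique h2
    have hsurj : Function.Surjective (fun v : W => (1 + fderiv ℝ H x : W →L[ℝ] W) v) := by
      let e := LinearMap.equivOfDetNeZero ((1 + fderiv ℝ H x : W →L[ℝ] W) : W →ₗ[ℝ] W) hdet
      exact e.surjective
    obtain ⟨v, hv⟩ := hsurj (x + H x)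
    have h4 := congrArg (fun L : W →L[ℝ] ℝ => L v) h3
    simp only [smul_apply, ContinuousLinearMap.comp_apply, hv,
      zero_apply, innerSL_apply_apply, real_inner_self_eq_norm_sq] at h4
    have h5 := hconst.self_of_nhds
    simp only at h5
    rw [h5] at h4
    have : 0 < R ^ 2 := by positivity
    simp at h4
    exact hR.ne' h4
  rw [setIntegral_congr_fun measurableSet_ball (g := fun _ => (0 : ℝ)) hzero] at key
  simp only [integral_zero] at key
  have hpos : 0 < (Measure.addHaar : Measure W).real (ball (0 : W) R) :=
    ENNReal.toReal_pos (measure_ball_pos _ _ hR).ne' measure_ball_lt_top.ne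
  exact hpos.ne key

end Brouwer

/-- Differentiable functions whose derivative is bounded and Lipschitz, both with constant `A`. -/
structure C11 {E F : Type*} [NormedAddCommGroup E] [NormedSpace ℝ E] [NormedAddCommGroup F]
    [NormedSpace ℝ F] (f : E → F) (A : ℝ) : Prop where
  diff : Differentiable ℝ f
  bdd : ∀ x, ‖fderiv ℝ f x‖ ≤ A
  lip : ∀ x y, ‖fderiv ℝ f x - fderiv ℝ f y‖ ≤ A * ‖x - y‖

namespace C11

variable {E F H : Type*} [NormedAddCommGroup E] [NormedSpace ℝ E] [NormedAddCommGroup F]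
    [NormedSpace ℝ F] [NormedAddCommGroup H] [NormedSpace ℝ H] {f g : E → F} {A B : ℝ}

theorem nonneg (hf : C11 f A) : 0 ≤ A := (norm_nonneg _).trans (hf.bdd 0)

theorem mono (hf : C11 f A) (h : A ≤ B) : C11 f B :=
  ⟨hf.diff, fun x => (hf.bdd x).trans h,
    fun x y => (hf.lip x y).trans (mul_le_mul_of_nonneg_right h (norm_nonneg _))⟩

theorem norm_sub_le (hf : C11 f A) (x y : E) : ‖f x - f y‖ ≤ A * ‖x - y‖ :=
  Convex.norm_image_sub_le_of_norm_fderiv_le (fun z _ => hf.diff z) (fun z _ => hf.bdd z)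
    convex_univ (mem_univ y) (mem_univ x)

theorem taylor (hf : C11 f A) (x y : E) :
    ‖f y - f x - fderiv ℝ f x (y - x)‖ ≤ A * ‖y - x‖ ^ 2 := by
  have h := Convex.norm_image_sub_le_of_norm_hasFDerivWithin_le' (f := f) (f' := fderiv ℝ f)
    (φ := fderiv ℝ f x) (C := A * ‖y - x‖) (s := segment ℝ x y) (x := x) (y := y)
    (fun z _ => (hf.diff z).hasFDerivAt.hasFDerivWithinAt)
    (fun z hz => (hf.lip z x).trans (mul_le_mul_of_nonneg_left ?_ hf.nonneg))
    (convex_segment x y) (left_mem_segment ℝ x y) (right_mem_segment ℝ x y)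
  · rwa [mul_assoc, ← sq] at h
  · obtain ⟨a, b, ha, hb, hab, rfl⟩ := hz
    have : a • x + b • y - x = b • (y - x) := by
      rw [← sub_eq_zero]
      obtain rfl : a = 1 - b := by linarith
      module
    rw [this, norm_smul, Real.norm_of_nonneg hb]
    exact mul_le_of_le_one_left (norm_nonneg _) (by linarith)

theorem continuous_fderiv (hf : C11 f A) : Continuous (fderiv ℝ f) := by
  have : LipschitzWith A.toNNReal (fderiv ℝ f) := by
    refine LipschitzWith.of_dist_le_mul fun x y => ?_
    rw [dist_eq_norm, dist_eq_norm, Real.coe_toNNReal _ hf.nonneg]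
    exact hf.lip x y
  exact this.continuous

theorem of_hasFDerivAt {f' : E → E →L[ℝ] F} (h : ∀ x, HasFDerivAt f (f' x) x)
    (hb : ∀ x, ‖f' x‖ ≤ A) (hl : ∀ x y, ‖f' x - f' y‖ ≤ A * ‖x - y‖) : C11 f A :=
  ⟨fun x => (h x).differentiableAt, fun x => by rw [(h x).fderiv]; exact hb x,
    fun x y => by rw [(h x).fderiv, (h y).fderiv]; exact hl x y⟩

theorem add (hf : C11 f A) (hg : C11 g B) : C11 (fun x => f x + g x) (A + B) := by
  refine of_hasFDerivAt (fun x => (hf.diff x).hasFDerivAt.add (hg.diff x).hasFDerivAt)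
    (fun x => (norm_add_le _ _).trans (add_le_add (hf.bdd x) (hg.bdd x))) fun x y => ?_
  rw [add_sub_add_comm, add_mul]
  exact (norm_add_le _ _).trans (add_le_add (hf.lip x y) (hg.lip x y))

theorem const (c : F) : C11 (fun _ : E => c) 0 :=
  of_hasFDerivAt (f' := fun _ => 0) (fun x => hasFDerivAt_const c x) (by simp) (by simp)

theorem of_continuousLinearMap (T : E →L[ℝ] F) : C11 (fun x => T x) ‖T‖ :=
  of_hasFDerivAt (f' := fun _ => T) (fun _ => T.hasFDerivAt) (fun _ => le_rfl)
    (fun x y => by simp only [sub_self, norm_zero]; positivity)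

theorem finset_sum {ι : Type*} (s : Finset ι) {f : ι → E → F} (h : ∀ i ∈ s, C11 (f i) A) :
    C11 (fun x => ∑ i ∈ s, f i x) (s.card * A) := by
  classical
  induction s using Finset.induction_on with
  | empty => simpa using const (E := E) (0 : F)
  | insert i s hi ih =>
    have h1 := (h i (Finset.mem_insert_self i s)).add
      (ih fun j hj => h j (Finset.mem_insert_of_mem hj))
    simp only [Finset.sum_insert hi, Finset.card_insert_of_notMem hi]
    refine h1.mono (le_of_eq ?_)
    push_cast
    ring

/-- Composition, where the outer function only needs to be controlled on the range. -/
theorem comp_of_range {φ : F → H} {S : Set F} (hf : C11 f A) (hS : ∀ x, f x ∈ S)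
    (hd : ∀ y ∈ S, DifferentiableAt ℝ φ y) (hb : ∀ y ∈ S, ‖fderiv ℝ φ y‖ ≤ B)
    (hl : ∀ y ∈ S, ∀ z ∈ S, ‖fderiv ℝ φ y - fderiv ℝ φ z‖ ≤ B * ‖y - z‖) :
    C11 (fun x => φ (f x)) (B * A * (1 + A)) := by
  have hB : 0 ≤ B := (norm_nonneg _).trans (hb (f 0) (hS 0))
  have hA := hf.nonneg
  refine of_hasFDerivAt
    (fun x => ((hd _ (hS x)).hasFDerivAt.comp x (hf.diff x).hasFDerivAt)) (fun x => ?_)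
    fun x y => ?_
  · calc _ ≤ ‖fderiv ℝ φ (f x)‖ * ‖fderiv ℝ f x‖ := ContinuousLinearMap.opNorm_comp_le _ _
      _ ≤ B * A := mul_le_mul (hb _ (hS x)) (hf.bdd x) (norm_nonneg _) hB
      _ ≤ B * A * (1 + A) := le_mul_of_one_le_right (mul_nonneg hB hA) (by linarith)
  · have key : (fderiv ℝ φ (f x)).comp (fderiv ℝ f x) - (fderiv ℝ φ (f y)).comp (fderiv ℝ f y)
        = (fderiv ℝ φ (f x)).comp (fderiv ℝ f x - fderiv ℝ f y)
          + (fderiv ℝ φ (f x) - fderiv ℝ φ (f y)).comp (fderiv ℝ f y) := by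
      ext v; simp
    rw [key]
    have h1 := ContinuousLinearMap.opNorm_comp_le (fderiv ℝ φ (f x))
      (fderiv ℝ f x - fderiv ℝ f y)
    have h2 := ContinuousLinearMap.opNorm_comp_le (fderiv ℝ φ (f x) - fderiv ℝ φ (f y))
      (fderiv ℝ f y)
    have h3 := mul_le_mul (hb _ (hS x)) (hf.lip x y) (norm_nonneg _) hB
    have h4 := mul_le_mul ((hl _ (hS x) _ (hS y)).trans
      (mul_le_mul_of_nonneg_left (hf.norm_sub_le x y) hB)) (hf.bdd y) (norm_nonneg _)
      (by positivity)
    refine (norm_add_le _ _).trans ((add_le_add (h1.trans h3) (h2.trans h4)).trans (le_of_eq ?_))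
    ring

theorem comp {φ : F → H} (hφ : C11 φ B) (hf : C11 f A) :
    C11 (fun x => φ (f x)) (B * A * (1 + A)) :=
  hf.comp_of_range (S := univ) (fun _ => mem_univ _) (fun y _ => hφ.diff y)
    (fun y _ => hφ.bdd y) (fun y _ z _ => hφ.lip y z)

end C11

section quadraticForm

variable {E : Type*} [NormedAddCommGroup E] [InnerProductSpace ℝ E]

/-- The quadratic-plus-bounded functional `½⟪Jξ, ξ⟫ + g ξ`. -/
def qform (J : E →L[ℝ] E) (g : E → ℝ) (ξ : E) : ℝ := ⟪J ξ, ξ⟫ / 2 + g ξ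

/-- The gradient of `qform J g`. -/
def qgrad [CompleteSpace E] (J : E →L[ℝ] E) (g : E → ℝ) (ξ : E) : E :=
  J ξ + (InnerProductSpace.toDual ℝ E).symm (fderiv ℝ g ξ)

theorem inner_qgrad [CompleteSpace E] (J : E →L[ℝ] E) (g : E → ℝ) (ξ η : E) :
    ⟪qgrad J g ξ, η⟫ = ⟪J ξ, η⟫ + fderiv ℝ g ξ η := by
  rw [qgrad, inner_add_left, InnerProductSpace.toDual_symm_apply]

section minmax

variable {J : E →L[ℝ] E} {g : E → ℝ} {A : ℝ}

theorem norm_involution (hJ : ∀ x, J (J x) = x) (hs : ∀ x y, ⟪J x, y⟫ = ⟪x, J y⟫) (x : E) :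
    ‖J x‖ = ‖x‖ := by
  have : ‖J x‖ ^ 2 = ‖x‖ ^ 2 := by
    rw [← real_inner_self_eq_norm_sq, hs, hJ, real_inner_self_eq_norm_sq]
  exact (pow_left_inj₀ (norm_nonneg _) (norm_nonneg _) two_ne_zero).1 this

theorem continuous_qgrad [CompleteSpace E] (hg : C11 g A) : Continuous (qgrad J g) :=
  J.continuous.add ((InnerProductSpace.toDual ℝ E).symm.continuous.comp hg.continuous_fderiv)

theorem continuous_qform (hg : C11 g A) : Continuous (qform J g) :=
  ((J.continuous.inner continuous_id).div_const 2).add hg.diff.continuous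

theorem norm_le_norm_qgrad [CompleteSpace E] (hJ : ∀ x, J (J x) = x) (hs : ∀ x y, ⟪J x, y⟫ = ⟪x, J y⟫)
    (hg : C11 g A) (ξ : E) : ‖ξ‖ - A ≤ ‖qgrad J g ξ‖ := by
  have h1 : ‖(InnerProductSpace.toDual ℝ E).symm (fderiv ℝ g ξ)‖ ≤ A := by
    rw [LinearIsometryEquiv.norm_map]; exact hg.bdd ξ
  have h2 := norm_sub_norm_le (J ξ) (-(InnerProductSpace.toDual ℝ E).symm (fderiv ℝ g ξ))
  rw [norm_neg, norm_involution hJ hs, sub_neg_eq_add] at h2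
  rw [qgrad]
  linarith

theorem exists_lower_bound_qgrad [FiniteDimensional ℝ E] (hJ : ∀ x, J (J x) = x) (hs : ∀ x y, ⟪J x, y⟫ = ⟪x, J y⟫)
    (hg : C11 g A) {K : Set E} (hK : IsClosed K) (h0 : ∀ ξ ∈ K, qgrad J g ξ ≠ 0) :
    ∃ ν > 0, ∀ ξ ∈ K, ν ≤ ‖qgrad J g ξ‖ ^ 2 := by
  have hc : IsCompact (closedBall (0 : E) (A + 1) ∩ K) :=
    (isCompact_closedBall _ _).inter_right hK
  have hcont : Continuous fun ξ => ‖qgrad J g ξ‖ ^ 2 := (continuous_qgrad hg).norm.pow 2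
  have hout : ∀ ξ, ξ ∉ closedBall (0 : E) (A + 1) → 1 ≤ ‖qgrad J g ξ‖ ^ 2 := by
    intro ξ hξ
    rw [mem_closedBall_zero_iff, not_le] at hξ
    have := norm_le_norm_qgrad hJ hs hg ξ
    exact one_le_pow₀ (by linarith)
  rcases (closedBall (0 : E) (A + 1) ∩ K).eq_empty_or_nonempty with he | hne
  · refine ⟨1, one_pos, fun ξ hξ => hout ξ fun h => ?_⟩
    have : ξ ∈ closedBall (0 : E) (A + 1) ∩ K := ⟨h, hξ⟩
    rw [he] at this
    exact this
  · obtain ⟨z, hz, hmin⟩ := hc.exists_isMinOn hne hcont.continuousOn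
    have hzpos : 0 < ‖qgrad J g z‖ ^ 2 := pow_pos (norm_pos_iff.2 (h0 z hz.2)) 2
    refine ⟨min 1 (‖qgrad J g z‖ ^ 2), lt_min one_pos hzpos, fun ξ hξ => ?_⟩
    by_cases h : ξ ∈ closedBall (0 : E) (A + 1)
    · exact (min_le_right _ _).trans (hmin ⟨h, hξ⟩)
    · exact (min_le_left _ _).trans (hout ξ h)

theorem qform_step [CompleteSpace E] (hJ : ∀ x, J (J x) = x) (hs : ∀ x y, ⟪J x, y⟫ = ⟪x, J y⟫)
    (hg : C11 g A) (ξ : E) :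
    qform J g (ξ - (1 / (2 * (1 + A))) • qgrad J g ξ)
      ≤ qform J g ξ - 1 / (4 * (1 + A)) * ‖qgrad J g ξ‖ ^ 2 := by
  have hA := hg.nonneg
  obtain ⟨h, hh⟩ : ∃ h, h = -(1 / (2 * (1 + A))) • qgrad J g ξ := ⟨_, rfl⟩
  have e1 : ξ - (1 / (2 * (1 + A))) • qgrad J g ξ = ξ + h := by rw [hh]; module
  have h1 := (abs_le.1 (hg.taylor ξ (ξ + h))).2
  rw [add_sub_cancel_left] at h1
  have h2 : ⟪J h, h⟫ ≤ ‖h‖ ^ 2 := by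
    refine (real_inner_le_norm _ _).trans ?_
    rw [norm_involution hJ hs, sq]
  have h3 := inner_qgrad J g ξ h
  have h4 : ⟪qgrad J g ξ, h⟫ = -(1 / (2 * (1 + A))) * ‖qgrad J g ξ‖ ^ 2 := by
    rw [hh, inner_smul_right, real_inner_self_eq_norm_sq]
  have h5 : ‖h‖ ^ 2 = (1 / (2 * (1 + A))) ^ 2 * ‖qgrad J g ξ‖ ^ 2 := by
    rw [hh, norm_smul, mul_pow, norm_neg, Real.norm_eq_abs, sq_abs]
  have h6 : ⟪J ξ, h⟫ = ⟪J h, ξ⟫ := by rw [hs, real_inner_comm]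
  have h7 : qform J g (ξ + h) = qform J g ξ + ⟪J ξ, h⟫ + ⟪J h, h⟫ / 2 + (g (ξ + h) - g ξ) := by
    simp only [qform, map_add, inner_add_left, inner_add_right]
    linarith
  have h8 : qform J g (ξ + h) ≤ qform J g ξ + ⟪qgrad J g ξ, h⟫ + (1 + A) * ‖h‖ ^ 2 := by
    nlinarith [sq_nonneg ‖h‖]
  rw [e1]
  refine h8.trans (le_of_eq ?_)
  rw [h4, h5]
  field_simp
  ring

/-- Continuous families of points which are linear up to a bounded error in the negative
directions of `J`. -/
def IsSweep (J : E →L[ℝ] E) (Ψ : E → E) : Prop :=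
  Continuous Ψ ∧ ∃ c : ℝ, 0 < c ∧ ∃ K : ℝ, ∀ z, ‖(Ψ z - J (Ψ z)) - c • (z - J z)‖ ≤ K

theorem IsSweep.step [CompleteSpace E] (hJ : ∀ x, J (J x) = x) (hs : ∀ x y, ⟪J x, y⟫ = ⟪x, J y⟫)
    (hg : C11 g A) {Ψ : E → E} (hΨ : IsSweep J Ψ) {η : ℝ} (hη : 0 < η) :
    IsSweep J fun z => Ψ z - η • qgrad J g (Ψ z) := by
  obtain ⟨hc, c, hc0, K, hK⟩ := hΨ
  refine ⟨hc.sub (((continuous_qgrad hg).comp hc).const_smul η), (1 + η) * c, by positivity,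
    (1 + η) * K + η * (A + A), fun z => ?_⟩
  obtain ⟨γ, hγ⟩ : ∃ γ, γ = (InnerProductSpace.toDual ℝ E).symm (fderiv ℝ g (Ψ z)) := ⟨_, rfl⟩
  have h1 : ‖γ‖ ≤ A := by rw [hγ, LinearIsometryEquiv.norm_map]; exact hg.bdd _
  have e : (Ψ z - η • qgrad J g (Ψ z) - J (Ψ z - η • qgrad J g (Ψ z)))
      - ((1 + η) * c) • (z - J z)
      = (1 + η) • ((Ψ z - J (Ψ z)) - c • (z - J z)) - η • (γ - J γ) := by
    rw [qgrad, ← hγ]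
    simp only [map_sub, map_smul, map_add, hJ]
    module
  rw [e]
  refine (norm_sub_le _ _).trans ?_
  rw [norm_smul, norm_smul, Real.norm_of_nonneg hη.le, Real.norm_of_nonneg (by linarith)]
  have h2 : ‖γ - J γ‖ ≤ A + A := (norm_sub_le _ _).trans
    (by rw [norm_involution hJ hs]; linarith)
  gcongr
  exact hK z

theorem exists_sweep_le [FiniteDimensional ℝ E] (hJ : ∀ x, J (J x) = x) (hs : ∀ x y, ⟪J x, y⟫ = ⟪x, J y⟫)
    (hg : C11 g A) {lo hi : ℝ}
    (h0 : ∀ ξ, lo ≤ qform J g ξ → qform J g ξ ≤ hi → qgrad J g ξ ≠ 0)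
    (hΨ : ∃ Ψ, IsSweep J Ψ ∧ ∀ z, qform J g (Ψ z) ≤ hi) :
    ∃ Ψ, IsSweep J Ψ ∧ ∀ z, qform J g (Ψ z) ≤ lo := by
  have hA := hg.nonneg
  obtain ⟨ν, hν, hlow⟩ := exists_lower_bound_qgrad hJ hs hg
    (K := {ξ | lo ≤ qform J g ξ ∧ qform J g ξ ≤ hi})
    ((isClosed_le continuous_const (continuous_qform hg)).inter
      (isClosed_le (continuous_qform hg) continuous_const)) (fun ξ h => h0 ξ h.1 h.2)
  obtain ⟨σ, hσ⟩ : ∃ σ, σ = 1 / (4 * (1 + A)) * ν := ⟨_, rfl⟩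
  have hσ0 : 0 < σ := by rw [hσ]; positivity
  have key : ∀ k : ℕ, ∃ Ψ, IsSweep J Ψ ∧ ∀ z, qform J g (Ψ z) ≤ hi ∧
      qform J g (Ψ z) ≤ max lo (hi - k * σ) := by
    intro k
    induction k with
    | zero =>
      obtain ⟨Ψ, h1, h2⟩ := hΨ
      exact ⟨Ψ, h1, fun z => ⟨h2 z, le_max_of_le_right (by simpa using h2 z)⟩⟩
    | succ k ih =>
      obtain ⟨Ψ, h1, h2⟩ := ih
      refine ⟨_, h1.step hJ hs hg (η := 1 / (2 * (1 + A))) (by positivity), fun z => ?_⟩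
      have h3 := qform_step hJ hs hg (Ψ z)
      have h4 : 0 ≤ 1 / (4 * (1 + A)) * ‖qgrad J g (Ψ z)‖ ^ 2 := by positivity
      refine ⟨by linarith [(h2 z).1], ?_⟩
      by_cases h5 : lo ≤ qform J g (Ψ z)
      · have h6 := hlow (Ψ z) ⟨h5, (h2 z).1⟩
        have h7 : σ ≤ 1 / (4 * (1 + A)) * ‖qgrad J g (Ψ z)‖ ^ 2 := by
          rw [hσ]; gcongr
        push_cast
        rcases le_max_iff.1 (h2 z).2 with h | h
        · exact le_max_of_le_left (by linarith)
        · exact le_max_of_le_right (by linarith)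
      · exact le_max_of_le_left (by linarith)
  obtain ⟨k, hk⟩ := exists_nat_gt ((hi - lo) / σ)
  obtain ⟨Ψ, h1, h2⟩ := key k
  refine ⟨Ψ, h1, fun z => (h2 z).2.trans (max_le le_rfl ?_)⟩
  rw [div_lt_iff₀ hσ0] at hk
  linarith

theorem IsSweep.exists_fixed [FiniteDimensional ℝ E] (hJ : ∀ x, J (J x) = x) {Ψ : E → E} (hΨ : IsSweep J Ψ) :
    ∃ z, J (Ψ z) = Ψ z := by
  obtain ⟨hc, c, hc0, K, hK⟩ := hΨ
  obtain ⟨z, hz⟩ := exists_add_eq_zero_of_bounded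
    (fun z => (2 * c)⁻¹ • ((Ψ z - J (Ψ z)) - c • (z - J z)))
    (((hc.sub (J.continuous.comp hc)).sub
      ((continuous_id.sub J.continuous).const_smul c)).const_smul (2 * c)⁻¹) ((2 * c)⁻¹ * K)
    (fun z => by
      rw [norm_smul, Real.norm_of_nonneg (by positivity)]
      have := hK z
      gcongr)
  refine ⟨z, ?_⟩
  have h1 : Ψ z - J (Ψ z) = - (c • (z + J z)) := by
    have := congrArg (fun w => (2 * c) • w) hz
    simp only [smul_add, smul_inv_smul₀ (mul_pos two_pos hc0).ne', smul_zero, smul_sub] at this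
    rw [← sub_eq_zero, ← this]
    module
  have h2 := congrArg J h1
  rw [map_sub, hJ, map_neg, map_smul, map_add, hJ, add_comm (J z), ← h1] at h2
  have h3 : (2 : ℝ) • (J (Ψ z) - Ψ z) = 0 := by
    rw [two_smul]
    nth_rewrite 1 [h2]
    abel
  exact sub_eq_zero.1 ((smul_eq_zero.1 h3).resolve_left two_ne_zero)

theorem abs_le_of_c11 (hg : C11 g A) (x : E) : |g x| ≤ |g 0| + A * ‖x‖ := by
  have h := hg.norm_sub_le x 0
  rw [sub_zero, Real.norm_eq_abs] at h
  have := abs_sub_abs_le_abs_sub (g x) (g 0)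
  linarith

theorem minmax_le [FiniteDimensional ℝ E] {gA gB : E → ℝ} (hJ : ∀ x, J (J x) = x) (hs : ∀ x y, ⟪J x, y⟫ = ⟪x, J y⟫)
    (hA : C11 gA A) (hB : C11 gB A) (hle : ∀ x, gB x ≤ gA x) {a b : ℝ}
    (critA : ∀ ξ, (∀ η, ⟪J ξ, η⟫ + fderiv ℝ gA ξ η = 0) → qform J gA ξ ≤ a)
    (critB : ∀ ξ, (∀ η, ⟪J ξ, η⟫ + fderiv ℝ gB ξ η = 0) → b ≤ qform J gB ξ) : b ≤ a := by
  by_contra! hab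
  have hA0 := hA.nonneg
  have h1 : ∃ Ψ, IsSweep J Ψ ∧ ∀ z, qform J gA (Ψ z) ≤ |gA 0| + A ^ 2 := by
    refine ⟨fun z => z - J z, ⟨by fun_prop, 2, by norm_num, 0, fun z => ?_⟩, fun z => ?_⟩
    · beta_reduce
      have : z - J z - J (z - J z) - (2 : ℝ) • (z - J z) = 0 := by
        rw [map_sub, hJ]; module
      rw [this, norm_zero]
    · have e : J (z - J z) = - (z - J z) := by rw [map_sub, hJ]; abel
      have := (abs_le.1 (abs_le_of_c11 hA (z - J z))).2
      beta_reduce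
      rw [qform, e, inner_neg_left, real_inner_self_eq_norm_sq]
      nlinarith [sq_nonneg (‖z - J z‖ - A)]
  have h2 := exists_sweep_le hJ hs hA (lo := (a + b) / 2) (fun ξ h _ h0 => by
    have := critA ξ fun η => by rw [← inner_qgrad, h0, inner_zero_left]
    linarith) h1
  have h3 : ∃ Ψ, IsSweep J Ψ ∧ ∀ z, qform J gB (Ψ z) ≤ (a + b) / 2 := by
    obtain ⟨Ψ, h, h'⟩ := h2
    refine ⟨Ψ, h, fun z => le_trans ?_ (h' z)⟩
    rw [qform, qform]
    linarith [hle (Ψ z)]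
  obtain ⟨Ψ, hΨ, h4⟩ := exists_sweep_le hJ hs hB (lo := -(|gB 0| + A ^ 2) - 1) (fun ξ _ h h0 => by
    have := critB ξ fun η => by rw [← inner_qgrad, h0, inner_zero_left]
    linarith) h3
  obtain ⟨z, hz⟩ := hΨ.exists_fixed hJ
  have h5 := h4 z
  rw [qform, hz, real_inner_self_eq_norm_sq] at h5
  have := (abs_le.1 (abs_le_of_c11 hB (Ψ z))).1
  nlinarith [sq_nonneg (‖Ψ z‖ - A)]

end minmax

end quadraticForm

section chain

variable {V : Type*} [NormedAddCommGroup V] [InnerProductSpace ℝ V]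

/-- The discrete Hamiltonian trajectories of a chain of `N` generating functions, starting over
the base point `x₀` and ending with momentum `q₀`. -/
structure IsTraj (N : ℕ) (w : ℕ → V × V → ℝ) (x₀ q₀ : V) (x p : ℕ → V) : Prop where
  init : x 0 = x₀
  final : p N = q₀
  pos : ∀ i < N, ∀ v, ⟪x (i + 1), v⟫ = ⟪x i, v⟫ + fderiv ℝ (w i) (p (i + 1), x i) (v, 0)
  mom : ∀ i < N, ∀ v, ⟪p i, v⟫ = ⟪p (i + 1), v⟫ + fderiv ℝ (w i) (p (i + 1), x i) (0, v)

/-- The action of a trajectory. -/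
def trajValue (N : ℕ) (w : ℕ → V × V → ℝ) (q₀ : V) (x p : ℕ → V) : ℝ :=
  ∑ i ∈ Finset.range N, (⟪p (i + 1), x i - x (i + 1)⟫ + w i (p (i + 1), x i)) + ⟪q₀, x N⟫

/-- The space of discrete paths with `N` steps: momenta and displacements. -/
abbrev PathSp (V : Type*) (N : ℕ) := PiLp 2 (fun _ : Fin N ⊕ Fin N => V)

variable {N : ℕ}

/-- The coordinate projections of the path space. -/
def pathProj (k : Fin N ⊕ Fin N) : PathSp V N →L[ℝ] V := PiLp.proj 2 (fun _ => V) k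

@[simp] theorem pathProj_apply (k : Fin N ⊕ Fin N) (ξ : PathSp V N) : pathProj k ξ = ξ k := rfl

/-- The total displacement before step `i`. -/
def pathDisp (i : ℕ) : PathSp V N →L[ℝ] V :=
  ∑ j : Fin N, if (j : ℕ) < i then pathProj (Sum.inr j) else 0

theorem pathDisp_apply (i : ℕ) (ξ : PathSp V N) :
    pathDisp i ξ = ∑ j : Fin N, if (j : ℕ) < i then ξ (Sum.inr j) else 0 := by
  rw [pathDisp, sum_apply]
  refine Finset.sum_congr rfl fun j _ => ?_
  split_ifs <;> simp

theorem pathDisp_succ (k : Fin N) (ξ : PathSp V N) :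
    pathDisp ((k : ℕ) + 1) ξ = pathDisp (k : ℕ) ξ + ξ (Sum.inr k) := by
  have h : ξ (Sum.inr k) = ∑ j : Fin N, if j = k then ξ (Sum.inr j) else 0 := by simp
  rw [pathDisp_apply, pathDisp_apply, h, ← Finset.sum_add_distrib]
  refine Finset.sum_congr rfl fun j _ => ?_
  by_cases h1 : j = k
  · simp [h1]
  · have : (j : ℕ) ≠ k := fun h => h1 (Fin.ext h)
    by_cases h2 : (j : ℕ) < k
    · simp [h1, h2, Nat.lt_succ_of_lt h2]
    · have : ¬ (j : ℕ) < k + 1 := by omega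
      simp [h1, h2, this]

/-- The involution exchanging momenta and displacements. -/
def pathSwap : PathSp V N →L[ℝ] PathSp V N :=
  (PiLp.continuousLinearEquiv 2 ℝ (fun _ : Fin N ⊕ Fin N => V)).symm.toContinuousLinearMap.comp
    (ContinuousLinearMap.pi fun k => pathProj k.swap)

@[simp] theorem pathSwap_apply (ξ : PathSp V N) (k : Fin N ⊕ Fin N) :
    pathSwap ξ k = ξ k.swap := rfl

theorem pathSwap_pathSwap (ξ : PathSp V N) : pathSwap (pathSwap ξ) = ξ := by
  ext k; simp

theorem inner_pathSwap (ξ η : PathSp V N) :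
    ⟪pathSwap ξ, η⟫ = ∑ i, ⟪ξ (Sum.inr i), η (Sum.inl i)⟫ + ∑ i, ⟪ξ (Sum.inl i), η (Sum.inr i)⟫ := by
  rw [PiLp.inner_apply, Fintype.sum_sum_type]
  simp

theorem inner_pathSwap_comm (ξ η : PathSp V N) : ⟪pathSwap ξ, η⟫ = ⟪ξ, pathSwap η⟫ := by
  rw [real_inner_comm (pathSwap η) ξ, inner_pathSwap, inner_pathSwap, add_comm]
  simp only [real_inner_comm]

/-- The arguments of the `i`-th generating function. -/
def pathArg (i : Fin N) : PathSp V N →L[ℝ] V × V :=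
  (pathProj (Sum.inl i)).prod (-pathDisp (i : ℕ))

/-- The bounded part of the action functional on the path space. -/
def pathFun (w : ℕ → V × V → ℝ) (x₀ q₀ : V) (ξ : PathSp V N) : ℝ :=
  ∑ i : Fin N, w i (pathArg i ξ + (0, x₀)) + (innerSL ℝ q₀ (-pathDisp N ξ) + ⟪q₀, x₀⟫)

variable {w : ℕ → V × V → ℝ} {x₀ q₀ : V}

omit [InnerProductSpace ℝ V] in
theorem exists_forall_c11 [NormedSpace ℝ V] (hw : ∀ i < N, ∃ A, C11 (w i) A) :
    ∃ A, ∀ i < N, C11 (w i) A := by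
  induction N with
  | zero => exact ⟨0, fun i hi => absurd hi (Nat.not_lt_zero i)⟩
  | succ n ih =>
    obtain ⟨A, hA⟩ := ih fun i hi => hw i (by omega)
    obtain ⟨B, hB⟩ := hw n (by omega)
    refine ⟨max A B, fun i hi => ?_⟩
    rcases Nat.lt_succ_iff_lt_or_eq.1 hi with h | rfl
    · exact (hA i h).mono (le_max_left _ _)
    · exact hB.mono (le_max_right _ _)

theorem exists_c11_pathFun (hw : ∀ i < N, ∃ A, C11 (w i) A) :
    ∃ A, C11 (pathFun (N := N) w x₀ q₀) A := by
  obtain ⟨A, hA⟩ := exists_forall_c11 hw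
  have h1 : ∀ i : Fin N, ∃ B, C11 (fun ξ : PathSp V N => w i (pathArg i ξ + (0, x₀))) B :=
    fun i => ⟨_, (hA i i.2).comp ((C11.of_continuousLinearMap (pathArg i)).add
      (C11.const ((0 : V), x₀)))⟩
  choose B hB using h1
  have h2 := C11.finset_sum (A := ∑ i, |B i|) Finset.univ fun i _ => (hB i).mono
    ((le_abs_self _).trans (Finset.single_le_sum (f := fun i => |B i|)
      (fun i _ => abs_nonneg _) (Finset.mem_univ i)))
  exact ⟨_, h2.add ((C11.of_continuousLinearMap
    ((innerSL ℝ q₀).comp (-pathDisp N))).add (C11.const ⟪q₀, x₀⟫))⟩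

theorem fderiv_pathFun (hw : ∀ i < N, ∃ A, C11 (w i) A) (ξ η : PathSp V N) :
    fderiv ℝ (pathFun (N := N) w x₀ q₀) ξ η
      = ∑ i : Fin N, fderiv ℝ (w i) (ξ (Sum.inl i), x₀ - pathDisp i ξ)
          (η (Sum.inl i), -pathDisp i η) - ⟪q₀, pathDisp N η⟫ := by
  have h1 : HasFDerivAt (pathFun (N := N) w x₀ q₀)
      (∑ i : Fin N, (fderiv ℝ (w i) (pathArg i ξ + (0, x₀))).comp (pathArg i)
        + (innerSL ℝ q₀).comp (-pathDisp N)) ξ := by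
    refine HasFDerivAt.add (HasFDerivAt.fun_sum fun i _ => ?_)
      (((innerSL ℝ q₀).comp (-pathDisp N)).hasFDerivAt.add_const _)
    obtain ⟨A, hA⟩ := hw i i.2
    exact (hA.diff _).hasFDerivAt.comp ξ ((pathArg i).hasFDerivAt.add_const ((0 : V), x₀))
  rw [h1.fderiv]
  have e : ∀ i : Fin N, pathArg i ξ + (0, x₀) = (ξ (Sum.inl i), x₀ - pathDisp i ξ) := fun i => by
    ext1
    · simp [pathArg]
    · simp [pathArg, sub_eq_neg_add]
  simp only [e]
  simp [pathArg, sub_eq_add_neg]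

/-- The path-space vector supported in one coordinate. -/
def pathSingle (k : Fin N ⊕ Fin N) (v : V) : PathSp V N := WithLp.toLp 2 (Pi.single k v)

omit [InnerProductSpace ℝ V] in
theorem pathSingle_apply (k l : Fin N ⊕ Fin N) (v : V) :
    pathSingle k v l = if l = k then v else 0 := by
  simp [pathSingle]

theorem exists_traj_of_critical [CompleteSpace V] (hw : ∀ i < N, ∃ A, C11 (w i) A)
    (ξ : PathSp V N)
    (hξ : ∀ η, ⟪pathSwap ξ, η⟫ + fderiv ℝ (pathFun (N := N) w x₀ q₀) ξ η = 0) :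
    ∃ x p, IsTraj N w x₀ q₀ x p ∧ qform pathSwap (pathFun w x₀ q₀) ξ = trajValue N w q₀ x p := by
  have hP : ∀ (k : Fin N) (v : V),
      ⟪ξ (Sum.inr k), v⟫ + fderiv ℝ (w k) (ξ (Sum.inl k), x₀ - pathDisp k ξ) (v, 0) = 0 := by
    intro k v
    have h := hξ (pathSingle (Sum.inl k) v)
    have h0 : ∀ i, pathDisp i (pathSingle (Sum.inl k) v : PathSp V N) = 0 := fun i => by
      simp [pathDisp_apply, pathSingle_apply]
    rw [inner_pathSwap, fderiv_pathFun hw] at h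
    simp only [h0, pathSingle_apply, neg_zero, inner_zero_right, sub_zero, reduceCtorEq,
      if_false, Finset.sum_const_zero, add_zero, Sum.inl.injEq] at h
    rw [Finset.sum_eq_single k, Finset.sum_eq_single k] at h
    · simpa using h
    · intro b _ hb; rw [if_neg hb]; exact map_zero _
    · simp
    · intro b _ hb; simp [hb]
    · simp
  obtain ⟨c, hc⟩ : ∃ c : Fin N → V, ∀ j v,
      ⟪c j, v⟫ = fderiv ℝ (w j) (ξ (Sum.inl j), x₀ - pathDisp j ξ) (0, v) :=
    ⟨fun j => (InnerProductSpace.toDual ℝ V).symm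
      ((fderiv ℝ (w j) (ξ (Sum.inl j), x₀ - pathDisp j ξ)).comp (ContinuousLinearMap.inr ℝ V V)),
      fun j v => by rw [InnerProductSpace.toDual_symm_apply]; simp⟩
  obtain ⟨p, hp⟩ : ∃ p : ℕ → V, p = fun i => q₀ + ∑ j : Fin N, if i ≤ (j : ℕ) then c j else 0 :=
    ⟨_, rfl⟩
  have hpk : ∀ k : Fin N, p (k + 1) = ξ (Sum.inl k) := by
    intro k
    refine ext_inner_right ℝ fun v => ?_
    have h := hξ (pathSingle (Sum.inr k) v)
    have h0 : ∀ i, pathDisp i (pathSingle (Sum.inr k) v : PathSp V N)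
        = if (k : ℕ) < i then v else 0 := fun i => by
      rw [pathDisp_apply, Finset.sum_eq_single k]
      · simp [pathSingle_apply]
      · intro b _ hb; simp [pathSingle_apply, hb]
      · simp
    rw [inner_pathSwap, fderiv_pathFun hw] at h
    simp only [h0, pathSingle_apply, k.2, if_true] at h
    rw [Finset.sum_eq_zero (fun i _ => by simp), zero_add, Finset.sum_eq_single k] at h
    · have h2 : ∑ i : Fin N, fderiv ℝ (w i) (ξ (Sum.inl i), x₀ - pathDisp i ξ)
          ((if Sum.inl i = (Sum.inr k : Fin N ⊕ Fin N) then v else 0), -if (k : ℕ) < i then v else 0)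
          = - ∑ j : Fin N, if (k : ℕ) + 1 ≤ (j : ℕ) then ⟪c j, v⟫ else 0 := by
        rw [← Finset.sum_neg_distrib]
        refine Finset.sum_congr rfl fun j _ => ?_
        by_cases hj : (k : ℕ) < j
        · have hj' : (k : ℕ) + 1 ≤ j := hj
          have e : ((0 : V), -v) = -((0 : V), v) := by simp
          rw [if_pos hj, if_pos hj', hc, if_neg (by simp), e, map_neg]
        · have hj' : ¬ (k : ℕ) + 1 ≤ j := hj
          simp only [hj, hj', if_false, neg_zero, reduceCtorEq]
          exact map_zero _
      rw [h2] at h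
      have h3 : ⟪p (k + 1), v⟫ = ⟪q₀, v⟫ +
          ∑ j : Fin N, if (k : ℕ) + 1 ≤ (j : ℕ) then ⟪c j, v⟫ else 0 := by
        rw [hp]
        simp only [inner_add_left, sum_inner]
        congr 1
        refine Finset.sum_congr rfl fun j _ => ?_
        split_ifs <;> simp
      rw [h3]
      simp only [if_true] at h
      linarith
    · intro b _ hb; simp [hb]
    · simp
  refine ⟨fun i => x₀ - pathDisp i ξ, p, ⟨?_, ?_, ?_, ?_⟩, ?_⟩
  · simp [pathDisp_apply]
  · rw [hp]
    simp only [add_eq_left]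
    exact Finset.sum_eq_zero fun j _ => by simp [not_le.2 j.2]
  · intro i hi v
    have h1 := hP ⟨i, hi⟩ v
    have h2 := hpk ⟨i, hi⟩
    have h3 := pathDisp_succ ⟨i, hi⟩ ξ
    simp only at h1 h2 h3
    rw [h2, h3, ← sub_sub, inner_sub_left _ (ξ _)]
    linarith
  · intro i hi v
    have h2 := hpk ⟨i, hi⟩
    simp only at h2
    rw [h2, ← hc ⟨i, hi⟩, ← inner_add_left, ← h2, hp]
    congr 1
    simp only
    rw [add_assoc]
    congr 1
    have h : c ⟨i, hi⟩ = ∑ j : Fin N, if j = ⟨i, hi⟩ then c j else 0 := by simp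
    rw [h, ← Finset.sum_add_distrib]
    refine Finset.sum_congr rfl fun j _ => ?_
    by_cases h1 : j = ⟨i, hi⟩
    · simp [h1]
    · have : (j : ℕ) ≠ i := fun h => h1 (Fin.ext h)
      by_cases h2 : i + 1 ≤ (j : ℕ)
      · have : i ≤ (j : ℕ) := by omega
        simp [h1, h2, this]
      · have : ¬ i ≤ (j : ℕ) := by omega
        simp [h1, h2, this]
  · rw [qform, inner_pathSwap, trajValue, Finset.sum_range]
    have e : ∀ i : Fin N, pathArg i ξ + (0, x₀) = (ξ (Sum.inl i), x₀ - pathDisp i ξ) := fun i => by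
      ext1
      · simp [pathArg]
      · simp [pathArg, sub_eq_neg_add]
    have e2 : ∀ i : Fin N, x₀ - pathDisp (i : ℕ) ξ - (x₀ - pathDisp ((i : ℕ) + 1) ξ)
        = ξ (Sum.inr i) := fun i => by rw [pathDisp_succ]; abel
    simp only [pathFun, e, hpk, e2, innerSL_apply_apply, inner_neg_right, inner_sub_right,
      Finset.sum_add_distrib]
    have e3 : ∑ i : Fin N, ⟪ξ (Sum.inr i), ξ (Sum.inl i)⟫
      = ∑ i : Fin N, ⟪ξ (Sum.inl i), ξ (Sum.inr i)⟫ :=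
      Finset.sum_congr rfl fun i _ => real_inner_comm _ _
    rw [e3]
    ring

theorem chain_le [FiniteDimensional ℝ V] {wA wB : ℕ → V × V → ℝ}
    (hA : ∀ i < N, ∃ A, C11 (wA i) A) (hB : ∀ i < N, ∃ A, C11 (wB i) A)
    (hle : ∀ i < N, ∀ z, wB i z ≤ wA i z) {a b : ℝ}
    (ha : ∀ x p, IsTraj N wA x₀ q₀ x p → trajValue N wA q₀ x p ≤ a)
    (hb : ∀ x p, IsTraj N wB x₀ q₀ x p → b ≤ trajValue N wB q₀ x p) : b ≤ a := by
  obtain ⟨A, hA'⟩ := exists_c11_pathFun (x₀ := x₀) (q₀ := q₀) hA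
  obtain ⟨B, hB'⟩ := exists_c11_pathFun (x₀ := x₀) (q₀ := q₀) hB
  refine minmax_le (J := (pathSwap : PathSp V N →L[ℝ] PathSp V N)) pathSwap_pathSwap
    inner_pathSwap_comm (hA'.mono (le_max_left A B)) (hB'.mono (le_max_right A B))
    (fun ξ => ?_) (fun ξ h => ?_) (fun ξ h => ?_)
  · unfold pathFun
    gcongr with i
    exact hle i i.2 _
  · obtain ⟨x, p, h1, h2⟩ := exists_traj_of_critical hA ξ h
    exact h2 ▸ ha x p h1
  · obtain ⟨x, p, h1, h2⟩ := exists_traj_of_critical hB ξ h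
    exact h2 ▸ hb x p h1

end chain

section extension

variable {E : Type*} [NormedAddCommGroup E] [InnerProductSpace ℝ E] [FiniteDimensional ℝ E]

theorem exists_subgradient {C : E → ℝ} (hC : ConvexOn ℝ univ C) (x : E) :
    ∃ p : E, ∀ h, C x + ⟪p, h⟫ ≤ C (x + h) := by
  have hcont : Continuous C := continuousOn_univ.1 (hC.continuousOn isOpen_univ)
  have hopen : IsOpen {z : E × ℝ | z.1 ∈ univ ∧ C z.1 < z.2} := by
    simpa using isOpen_lt (hcont.comp continuous_fst) continuous_snd
  obtain ⟨f, hf⟩ := geometric_hahn_banach_point_open hC.convex_strict_epigraph hopen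
    (x := (x, C x)) (by simp)
  have hsplit : ∀ (z : E) (r : ℝ), f (z, r) = f (z, 0) + r * f (0, 1) := fun z r => by
    have : (z, r) = (z, (0 : ℝ)) + r • ((0 : E), (1 : ℝ)) := by simp
    rw [this, map_add, map_smul, smul_eq_mul]
  have hβ : 0 < f (0, 1) := by
    have := hf (x, C x + 1) ⟨mem_univ _, by simp⟩
    rw [hsplit x (C x), hsplit x (C x + 1)] at this
    linarith
  have hle : ∀ z, f (x, C x) ≤ f (z, C z) := fun z => by
    refine le_of_forall_pos_lt_add fun ε hε => ?_
    have := hf (z, C z + ε / f (0, 1)) ⟨mem_univ _, by simp only [lt_add_iff_pos_right]; positivity⟩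
    rw [hsplit z, add_mul, div_mul_cancel₀ _ hβ.ne'] at this
    rw [hsplit z]
    linarith
  refine ⟨(InnerProductSpace.toDual ℝ E).symm
    (-(f (0, 1))⁻¹ • f.comp (ContinuousLinearMap.inl ℝ E ℝ)), fun h => ?_⟩
  rw [InnerProductSpace.toDual_symm_apply]
  have h1 := hle (x + h)
  rw [hsplit x, hsplit (x + h)] at h1
  have h2 : f (x + h, 0) = f (x, 0) + f (h, 0) := by
    rw [← map_add]; simp
  have h3 : (-(f (0, 1))⁻¹ • f.comp (ContinuousLinearMap.inl ℝ E ℝ)) h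
      = -(f (0, 1))⁻¹ * f (h, 0) := by simp
  rw [h3]
  have h4 : (f (0, 1))⁻¹ * (-f (h, 0)) ≤ C (x + h) - C x := by
    rw [inv_mul_le_iff₀ hβ]
    linarith
  linarith

omit [FiniteDimensional ℝ E] in
theorem eq_zero_of_inner_le_sq {D : ℝ} (hD : 0 < D) {e : E} (h : ∀ k, ⟪e, k⟫ ≤ D * ‖k‖ ^ 2) :
    e = 0 := by
  have h1 := h ((1 / (2 * D)) • e)
  rw [inner_smul_right, real_inner_self_eq_norm_sq, norm_smul, mul_pow, Real.norm_eq_abs,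
    sq_abs] at h1
  have h2 : D * ((1 / (2 * D)) ^ 2 * ‖e‖ ^ 2) = 1 / (4 * D) * ‖e‖ ^ 2 := by field_simp; ring
  have h3 : 1 / (2 * D) = 2 * (1 / (4 * D)) := by field_simp; ring
  have h4 : 0 < 1 / (4 * D) := by positivity
  have h5 : ‖e‖ ^ 2 ≤ 0 := by
    by_contra! h6
    rw [h2, h3] at h1
    nlinarith [mul_pos h4 h6]
  exact norm_eq_zero.1 (pow_eq_zero_iff two_ne_zero |>.1 (le_antisymm h5 (sq_nonneg _)))

/-- A convex function with second differences bounded above has a Lipschitz gradient. -/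
theorem exists_gradient_of_second_difference_le {C : E → ℝ} (hC : ConvexOn ℝ univ C) {D : ℝ}
    (hD : 0 < D) (h2 : ∀ x h, C (x + h) + C (x - h) - 2 * C x ≤ D * ‖h‖ ^ 2) :
    ∃ p : E → E, (∀ x h, C x + ⟪p x, h⟫ ≤ C (x + h)) ∧
      (∀ x h, C (x + h) ≤ C x + ⟪p x, h⟫ + D * ‖h‖ ^ 2) ∧
      (∀ x, HasFDerivAt C (innerSL ℝ (p x)) x) ∧ ∀ x y, ‖p x - p y‖ ≤ 2 * D * ‖x - y‖ := by
  choose p hp using fun x => exists_subgradient hC x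
  have hup : ∀ x h, C (x + h) ≤ C x + ⟪p x, h⟫ + D * ‖h‖ ^ 2 := fun x h => by
    have h3 := hp x (-h)
    rw [inner_neg_right, ← sub_eq_add_neg x h] at h3
    linarith [h2 x h]
  refine ⟨p, hp, hup, fun x => ?_, fun x y => ?_⟩
  · rw [hasFDerivAt_iff_isLittleO_nhds_zero]
    refine Asymptotics.IsBigO.trans_isLittleO (g := fun h : E => ‖h‖ ^ 2) ?_ ?_
    · refine Asymptotics.IsBigO.of_bound D (Filter.Eventually.of_forall fun h => ?_)
      rw [innerSL_apply_apply, Real.norm_eq_abs, Real.norm_of_nonneg (by positivity), abs_le]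
      constructor
      · nlinarith [hp x h, mul_nonneg hD.le (sq_nonneg ‖h‖)]
      · linarith [hup x h]
    · exact Asymptotics.isLittleO_norm_pow_id one_lt_two
  · obtain ⟨k, hk⟩ : ∃ k, k = (1 / (2 * D)) • (p x - p y) := ⟨_, rfl⟩
    have h3 := hup y k
    have h4 := hp x (y + k - x)
    have h5 := hup x (y - x)
    rw [add_sub_cancel] at h4 h5
    have h6 : ⟪p x - p y, k⟫ ≤ D * ‖k‖ ^ 2 + D * ‖x - y‖ ^ 2 := by
      have : ⟪p x, y + k - x⟫ = ⟪p x, y - x⟫ + ⟪p x, k⟫ := by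
        rw [← inner_add_right]; congr 1; abel
      rw [inner_sub_left, norm_sub_rev x y]
      linarith
    rw [hk, inner_smul_right, real_inner_self_eq_norm_sq, norm_smul, mul_pow, Real.norm_eq_abs,
      sq_abs] at h6
    have h7 : ‖p x - p y‖ ^ 2 ≤ (2 * D * ‖x - y‖) ^ 2 := by
      have e1 : D * ((1 / (2 * D)) ^ 2 * ‖p x - p y‖ ^ 2) = 1 / (4 * D) * ‖p x - p y‖ ^ 2 := by
        field_simp; ring
      have e2 : 1 / (2 * D) * ‖p x - p y‖ ^ 2 = 2 * (1 / (4 * D) * ‖p x - p y‖ ^ 2) := by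
        field_simp; ring
      rw [e1, e2] at h6
      have h8 : 1 / (4 * D) * ‖p x - p y‖ ^ 2 ≤ D * ‖x - y‖ ^ 2 := by linarith
      have h9 := mul_le_mul_of_nonneg_left h8 (by positivity : 0 ≤ 4 * D)
      calc ‖p x - p y‖ ^ 2 = 4 * D * (1 / (4 * D) * ‖p x - p y‖ ^ 2) := by field_simp
        _ ≤ _ := h9
        _ = _ := by ring
    exact (pow_le_pow_iff_left₀ (norm_nonneg _) (by positivity) two_ne_zero).1 h7

omit [FiniteDimensional ℝ E] in
theorem convexOn_sSup_minorants {Q : E → ℝ} {𝓜 : Set (E → ℝ)} (hne : 𝓜.Nonempty)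
    (hconv : ∀ φ ∈ 𝓜, ConvexOn ℝ univ φ) (hle : ∀ φ ∈ 𝓜, ∀ x, φ x ≤ Q x) :
    ConvexOn ℝ univ (fun x => sSup ((fun φ : E → ℝ => φ x) '' 𝓜)) ∧
      ∀ φ ∈ 𝓜, ∀ x, φ x ≤ sSup ((fun φ : E → ℝ => φ x) '' 𝓜) := by
  have hb : ∀ φ ∈ 𝓜, ∀ x, φ x ≤ sSup ((fun φ : E → ℝ => φ x) '' 𝓜) := fun φ hφ x =>
    le_csSup ⟨Q x, by rintro _ ⟨ψ, hψ, rfl⟩; exact hle ψ hψ x⟩ ⟨φ, hφ, rfl⟩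
  refine ⟨⟨convex_univ, fun x _ y _ a b ha hb' hab => ?_⟩, hb⟩
  refine csSup_le (hne.image _) ?_
  rintro _ ⟨φ, hφ, rfl⟩
  refine ((hconv φ hφ).2 (mem_univ x) (mem_univ y) ha hb' hab).trans ?_
  simp only [smul_eq_mul]
  gcongr
  · exact hb φ hφ x
  · exact hb φ hφ y

/-- The Whitney extension theorem for functions with Lipschitz gradient. -/
theorem exists_lipschitz_gradient_extension {ι : Type*} [Nonempty ι] (y : ι → E) (f : ι → ℝ)
    (d : ι → E) {A : ℝ} (hA : 0 < A)
    (hf : ∀ i j, |f j - f i - ⟪d i, y j - y i⟫| ≤ A * ‖y j - y i‖ ^ 2)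
    (hd : ∀ i j, ‖d i - d j‖ ≤ A * ‖y i - y j‖) :
    ∃ (u : E → ℝ) (u' : E → E), (∀ x, HasFDerivAt u (innerSL ℝ (u' x)) x) ∧
      (∀ x z, ‖u' x - u' z‖ ≤ 40 * A * ‖x - z‖) ∧ ∀ i, u (y i) = f i ∧ u' (y i) = d i := by
  obtain ⟨Q, hQ⟩ : ∃ Q : ι → E → ℝ, ∀ j x, Q j x =
      f j + ⟪d j, x - y j⟫ + 4 * A * ‖x - y j‖ ^ 2 + 4 * A * ‖x‖ ^ 2 := ⟨_, fun _ _ => rfl⟩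
  obtain ⟨m, hm⟩ : ∃ m : ι → E → ℝ, ∀ j x, m j x =
      f j + ⟪d j, x - y j⟫ - 4 * A * ‖x - y j‖ ^ 2 + 4 * A * ‖x‖ ^ 2 := ⟨_, fun _ _ => rfl⟩
  have hmaff : ∀ i x h, m i (x + h) = m i x + ⟪d i + (8 * A) • y i, h⟫ := fun i x h => by
    rw [hm, hm, show x + h - y i = (x - y i) + h by abel, norm_add_sq_real, norm_add_sq_real]
    simp only [inner_add_left, inner_add_right, inner_sub_left, real_inner_smul_left]
    ring
  have hmQ : ∀ i j x, m i x ≤ Q j x := fun i j x => by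
    obtain ⟨a, ha⟩ : ∃ a, a = x - y j := ⟨_, rfl⟩
    obtain ⟨b, hb⟩ : ∃ b, b = x - y i := ⟨_, rfl⟩
    have e : y j - y i = b - a := by rw [ha, hb]; abel
    have h1 := (abs_le.1 (hf i j)).1
    have h2 := hd i j
    rw [norm_sub_rev (y i), e] at h2
    rw [e] at h1
    rw [hm, hQ, ← ha, ← hb]
    have h3 : ⟪d i, b - a⟫ = ⟪d i, b⟫ - ⟪d i, a⟫ := inner_sub_right _ _ _
    have h4 : ⟪d i, a⟫ - ⟪d j, a⟫ ≤ A * ‖b - a‖ * ‖a‖ := by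
      rw [← inner_sub_left]
      exact (real_inner_le_norm _ _).trans (mul_le_mul_of_nonneg_right h2 (norm_nonneg _))
    have h5 : ‖b - a‖ ≤ ‖b‖ + ‖a‖ := norm_sub_le _ _
    have h6 : ‖b - a‖ ^ 2 ≤ 2 * (‖a‖ ^ 2 + ‖b‖ ^ 2) := by
      nlinarith [sq_nonneg (‖b‖ - ‖a‖), norm_nonneg (b - a), norm_nonneg a, norm_nonneg b]
    have h7 : ‖b - a‖ * ‖a‖ ≤ 2 * (‖a‖ ^ 2 + ‖b‖ ^ 2) := by
      nlinarith [sq_nonneg (‖b‖ - ‖a‖), mul_le_mul_of_nonneg_right h5 (norm_nonneg a)]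
    nlinarith [mul_le_mul_of_nonneg_left h6 hA.le, mul_le_mul_of_nonneg_left h7 hA.le]
  obtain ⟨𝓜, h𝓜⟩ : ∃ 𝓜 : Set (E → ℝ), 𝓜 = {φ | ConvexOn ℝ univ φ ∧ ∀ j x, φ x ≤ Q j x} :=
    ⟨_, rfl⟩
  have hmM : ∀ i, m i ∈ 𝓜 := fun i => by
    rw [h𝓜]
    refine ⟨?_, fun j x => hmQ i j x⟩
    have e : m i = fun x => innerSL ℝ (d i + (8 * A) • y i) x + m i 0 := by
      ext x
      have := hmaff i 0 x
      rw [zero_add] at this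
      rw [this, innerSL_apply_apply, add_comm]
    rw [e]
    exact ((innerSL ℝ (d i + (8 * A) • y i)).toLinearMap.convexOn convex_univ).add_const _
  obtain ⟨i₀⟩ := ‹Nonempty ι›
  obtain ⟨hC, hle⟩ := convexOn_sSup_minorants (Q := Q i₀) (𝓜 := 𝓜) ⟨_, hmM i₀⟩
    (fun φ hφ => by rw [h𝓜] at hφ; exact hφ.1) (fun φ hφ => by rw [h𝓜] at hφ; exact hφ.2 i₀)
  obtain ⟨C, hCd⟩ : ∃ C, C = (fun x => sSup ((fun φ : E → ℝ => φ x) '' 𝓜)) := ⟨_, rfl⟩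
  have hCQ : ∀ j x, C x ≤ Q j x := fun j x => by
    rw [hCd]
    refine csSup_le (Set.Nonempty.image _ ⟨_, hmM i₀⟩) ?_
    rintro _ ⟨φ, hφ, rfl⟩
    rw [h𝓜] at hφ
    exact hφ.2 j x
  have hle' : ∀ φ ∈ 𝓜, ∀ x, φ x ≤ C x := fun φ hφ x => by rw [hCd]; exact hle φ hφ x
  rw [← hCd] at hC
  have h2 : ∀ x h, C (x + h) + C (x - h) - 2 * C x ≤ 16 * A * ‖h‖ ^ 2 := by
    intro x h
    have hmem : (fun z => ((1 / 2 : ℝ) • C (z + h) + (1 / 2 : ℝ) • C (z - h))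
        + -(8 * A * ‖h‖ ^ 2)) ∈ 𝓜 := by
      rw [h𝓜]
      refine ⟨ConvexOn.add_const (((?_ : ConvexOn ℝ univ fun z => C (z + h)).smul
        (by norm_num)).add ((?_ : ConvexOn ℝ univ fun z => C (z - h)).smul (by norm_num))) _,
        fun j z => ?_⟩
      · simpa [Function.comp_def] using hC.translate_left h
      · simpa [sub_eq_add_neg, Function.comp_def] using hC.translate_left (-h)
      · have h3 := hCQ j (z + h)
        have h4 := hCQ j (z - h)
        rw [hQ] at h3 h4
        rw [hQ]
        have e1 : z + h - y j = (z - y j) + h := by abel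
        have e2 : z - h - y j = (z - y j) - h := by abel
        rw [e1, norm_add_sq_real, norm_add_sq_real, inner_add_right] at h3
        rw [e2, norm_sub_sq_real (z - y j) h, norm_sub_sq_real z h, inner_sub_right] at h4
        simp only [smul_eq_mul]
        nlinarith
    have := hle' _ hmem x
    simp only [smul_eq_mul] at this
    linarith
  obtain ⟨p, hp1, hp2, hp3, hp4⟩ := exists_gradient_of_second_difference_le hC
    (by positivity : 0 < 16 * A) h2
  have hCy : ∀ i, C (y i) = f i + 4 * A * ‖y i‖ ^ 2 := fun i => by
    refine le_antisymm ((hCQ i (y i)).trans (le_of_eq ?_))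
      (le_trans (le_of_eq ?_) (hle' _ (hmM i) (y i)))
    · simp [hQ]
    · simp [hm]
  refine ⟨fun x => C x - 4 * A * ‖x‖ ^ 2, fun x => p x - (8 * A) • x, fun x => ?_, fun x z => ?_,
    fun i => ⟨by simp [hCy], ?_⟩⟩
  · have h3 := (hp3 x).sub ((hasStrictFDerivAt_norm_sq x).hasFDerivAt.const_mul (4 * A))
    refine h3.congr_fderiv ?_
    ext v
    simp
    ring
  · have e : p x - (8 * A) • x - (p z - (8 * A) • z) = (p x - p z) - (8 * A) • (x - z) := by
      module
    rw [e]
    refine (norm_sub_le _ _).trans ?_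
    rw [norm_smul, Real.norm_of_nonneg (by positivity)]
    linarith [hp4 x z]
  · have h3 : d i + (8 * A) • y i - p (y i) = 0 := by
      refine eq_zero_of_inner_le_sq (by positivity : 0 < 16 * A) fun k => ?_
      have h4 := hp2 (y i) k
      have h5 := hle' _ (hmM i) (y i + k)
      rw [hmaff] at h5
      have h6 : m i (y i) = C (y i) := by rw [hCy]; simp [hm]
      rw [inner_sub_left]
      linarith
    rw [sub_eq_zero] at h3
    simp [← h3]

end extension

/-- First and second order bounds for a function on a set. -/
structure EstOn {E F : Type*} [NormedAddCommGroup E] [NormedSpace ℝ E] [NormedAddCommGroup F]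
    [NormedSpace ℝ F] (f : E → F) (K : Set E) (A : ℝ) : Prop where
  diff : ∀ x ∈ K, DifferentiableAt ℝ f x
  bound : ∀ x ∈ K, ‖f x‖ ≤ A
  lip : ∀ x ∈ K, ∀ y ∈ K, ‖f x - f y‖ ≤ A * ‖x - y‖
  bound' : ∀ x ∈ K, ‖fderiv ℝ f x‖ ≤ A
  lip' : ∀ x ∈ K, ∀ y ∈ K, ‖fderiv ℝ f x - fderiv ℝ f y‖ ≤ A * ‖x - y‖

section

variable {E F : Type*} [NormedAddCommGroup E] [NormedSpace ℝ E] [NormedAddCommGroup F]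
    [NormedSpace ℝ F] {f : E → F} {K : Set E} {A B : ℝ}

theorem EstOn.mono (h : EstOn f K A) (hAB : A ≤ B) : EstOn f K B :=
  ⟨h.diff, fun x hx => (h.bound x hx).trans hAB,
    fun x hx y hy => (h.lip x hx y hy).trans (mul_le_mul_of_nonneg_right hAB (norm_nonneg _)),
    fun x hx => (h.bound' x hx).trans hAB,
    fun x hx y hy => (h.lip' x hx y hy).trans (mul_le_mul_of_nonneg_right hAB (norm_nonneg _))⟩

theorem exists_bound_lip {f : E → F} (hf : ContDiff ℝ 1 f) (hK : IsCompact K)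
    (hc : Convex ℝ K) : ∃ A > 0, (∀ x ∈ K, ‖f x‖ ≤ A) ∧ (∀ x ∈ K, ‖fderiv ℝ f x‖ ≤ A) ∧
      ∀ x ∈ K, ∀ y ∈ K, ‖f x - f y‖ ≤ A * ‖x - y‖ := by
  obtain ⟨A, hA⟩ := hK.exists_bound_of_continuousOn hf.continuous.continuousOn
  obtain ⟨B, hB⟩ := hK.exists_bound_of_continuousOn
    (hf.continuous_fderiv one_ne_zero).continuousOn
  have h1 : A ≤ |A| + |B| + 1 := by linarith [le_abs_self A, abs_nonneg B]
  have h2 : B ≤ |A| + |B| + 1 := by linarith [le_abs_self B, abs_nonneg A]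
  refine ⟨|A| + |B| + 1, by positivity, fun x hx => (hA x hx).trans h1,
    fun x hx => (hB x hx).trans h2, fun x hx y hy => ?_⟩
  exact Convex.norm_image_sub_le_of_norm_fderiv_le
    (fun z _ => (hf.differentiable one_ne_zero) z) (fun z hz => (hB z hz).trans h2) hc hy hx

theorem exists_estOn (hf : ContDiff ℝ 2 f) (hK : IsCompact K) (hc : Convex ℝ K) :
    ∃ A > 0, EstOn f K A := by
  obtain ⟨A, hA, h1, -, h3⟩ := exists_bound_lip (hf.of_le one_le_two) hK hc
  obtain ⟨B, hB, h4, -, h5⟩ := exists_bound_lip (hf.fderiv_right (m := 1) le_rfl) hK hc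
  refine ⟨max A B, lt_max_of_lt_left hA, fun x _ => (hf.differentiable two_ne_zero) x,
    fun x hx => (h1 x hx).trans (le_max_left _ _), fun x hx y hy => (h3 x hx y hy).trans ?_,
    fun x hx => (h4 x hx).trans (le_max_right _ _), fun x hx y hy => (h5 x hx y hy).trans ?_⟩
  · gcongr; exact le_max_left _ _
  · gcongr; exact le_max_right _ _

theorem exists_c11_of_hasCompactSupport (hf : ContDiff ℝ 2 f) (hs : HasCompactSupport f) :
    ∃ A, C11 f A := by
  have h1 : ContDiff ℝ 1 (fderiv ℝ f) := hf.fderiv_right le_rfl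
  obtain ⟨B, hB⟩ := (hs.fderiv ℝ).exists_bound_of_continuous h1.continuous
  obtain ⟨C, hC⟩ := ContDiff.lipschitzWith_of_hasCompactSupport (hs.fderiv ℝ) h1 one_ne_zero
  refine ⟨max B C, hf.differentiable two_ne_zero, fun x => (hB x).trans (le_max_left _ _),
    fun x y => ?_⟩
  have := hC.dist_le_mul x y
  rw [dist_eq_norm, dist_eq_norm] at this
  refine this.trans ?_
  gcongr
  exact le_max_right _ _

end

section extension

variable {V : Type*} [NormedAddCommGroup V] [InnerProductSpace ℝ V] [FiniteDimensional ℝ V]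

/-- The linear functional on `V × V` given by the inner product with a pair. -/
def pairL (d : V × V) : V × V →L[ℝ] ℝ :=
  (innerSL ℝ d.1).comp (ContinuousLinearMap.fst ℝ V V)
    + (innerSL ℝ d.2).comp (ContinuousLinearMap.snd ℝ V V)

omit [FiniteDimensional ℝ V] in
@[simp] theorem pairL_apply (d v : V × V) : pairL d v = ⟪d.1, v.1⟫ + ⟪d.2, v.2⟫ := by
  simp [pairL]

omit [FiniteDimensional ℝ V] in
theorem norm_pairL_le (d : V × V) : ‖pairL d‖ ≤ 2 * ‖d‖ := by
  refine ContinuousLinearMap.opNorm_le_bound _ (by positivity) fun v => ?_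
  rw [pairL_apply]
  have h1 := abs_real_inner_le_norm d.1 v.1
  have h2 := abs_real_inner_le_norm d.2 v.2
  have h3 := mul_le_mul (norm_fst_le d) (norm_fst_le v) (norm_nonneg _) (norm_nonneg _)
  have h4 := mul_le_mul (norm_snd_le d) (norm_snd_le v) (norm_nonneg _) (norm_nonneg _)
  rw [Real.norm_eq_abs]
  refine (abs_add_le _ _).trans ?_
  linarith

theorem exists_lipschitz_gradient_extension_prod {ι : Type*} [Nonempty ι] (y : ι → V × V)
    (f : ι → ℝ) (d : ι → V × V) {A : ℝ} (hA : 0 < A)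
    (hf : ∀ i j, |f j - f i - pairL (d i) (y j - y i)| ≤ A * ‖y j - y i‖ ^ 2)
    (hd : ∀ i j, ‖d i - d j‖ ≤ A * ‖y i - y j‖) :
    ∃ u : V × V → ℝ, Differentiable ℝ u ∧
      (∀ x z, ‖fderiv ℝ u x - fderiv ℝ u z‖ ≤ 320 * A * ‖x - z‖) ∧
      ∀ i, u (y i) = f i ∧ fderiv ℝ u (y i) = pairL (d i) := by
  let e := (WithLp.prodContinuousLinearEquiv 2 ℝ V V).symm
  have he1 : ∀ z, ‖z‖ ≤ ‖e z‖ := fun z => by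
    have h : ‖e z‖ ^ 2 = ‖z.1‖ ^ 2 + ‖z.2‖ ^ 2 := WithLp.prod_norm_sq_eq_of_L2 _
    refine max_le ?_ ?_
    · exact le_of_sq_le_sq (by rw [h]; nlinarith [sq_nonneg ‖z.2‖]) (norm_nonneg _)
    · exact le_of_sq_le_sq (by rw [h]; nlinarith [sq_nonneg ‖z.1‖]) (norm_nonneg _)
  have he2 : ∀ z, ‖e z‖ ≤ 2 * ‖z‖ := fun z => by
    have h : ‖e z‖ ^ 2 = ‖z.1‖ ^ 2 + ‖z.2‖ ^ 2 := WithLp.prod_norm_sq_eq_of_L2 _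
    have h1 := pow_le_pow_left₀ (norm_nonneg _) (norm_fst_le z) 2
    have h2 := pow_le_pow_left₀ (norm_nonneg _) (norm_snd_le z) 2
    exact le_of_sq_le_sq (by rw [h]; nlinarith [sq_nonneg ‖z‖]) (by positivity)
  have hein : ∀ z w, ⟪e z, e w⟫ = pairL z w := fun z w => by
    rw [pairL_apply]; exact WithLp.prod_inner_apply _ _
  obtain ⟨u, u', h1, h2, h3⟩ := exists_lipschitz_gradient_extension (fun i => e (y i)) f
    (fun i => e (d i)) (A := 2 * A) (by positivity) (fun i j => by
      rw [← map_sub, hein]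
      refine (hf i j).trans ?_
      have := pow_le_pow_left₀ (norm_nonneg _) (he1 (y j - y i)) 2
      nlinarith [mul_nonneg hA.le (sq_nonneg ‖e (y j - y i)‖)])
    (fun i j => by
      rw [← map_sub, ← map_sub]
      have := he1 (y i - y j)
      have h4 := he2 (d i - d j)
      nlinarith [hd i j])
  have hu : ∀ z, HasFDerivAt (fun z => u (e z)) ((innerSL ℝ (u' (e z))).comp
      (e : V × V →L[ℝ] WithLp 2 (V × V))) z := fun z => (h1 (e z)).comp z e.hasFDerivAt
  refine ⟨fun z => u (e z), fun z => (hu z).differentiableAt, fun x z => ?_, fun i => ⟨(h3 i).1, ?_⟩⟩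
  · rw [(hu x).fderiv, (hu z).fderiv]
    refine ContinuousLinearMap.opNorm_le_bound _ (by positivity) fun v => ?_
    have h4 := h2 (e x) (e z)
    rw [← map_sub] at h4
    have h5 : ‖u' (e x) - u' (e z)‖ ≤ 160 * A * ‖x - z‖ := by nlinarith [he2 (x - z)]
    have h6 := norm_inner_le_norm (𝕜 := ℝ) (u' (e x) - u' (e z)) (e v)
    have h7 : ((innerSL ℝ (u' (e x))).comp (e : V × V →L[ℝ] WithLp 2 (V × V))
      - (innerSL ℝ (u' (e z))).comp (e : V × V →L[ℝ] WithLp 2 (V × V))) v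
      = ⟪u' (e x) - u' (e z), e v⟫ := by simp [inner_sub_left]
    rw [h7]
    refine h6.trans ?_
    have h8 := mul_le_mul h5 (he2 v) (norm_nonneg _) (by positivity)
    linarith
  · rw [(hu (y i)).fderiv, (h3 i).2]
    ext v
    · simp [hein]
    · simp [hein]

theorem exists_cutoff_prod (ρ : ℝ) (hρ : 0 < ρ) : ∃ (τ : V × V → V × V) (A : ℝ), C11 τ A ∧
    (∀ z, τ z ∈ closedBall 0 (ρ + 2)) ∧ ∀ z, ‖z‖ < ρ + 1 → τ z = z := by
  let χ : ContDiffBump (0 : V × V) := ⟨ρ + 1, ρ + 2, by linarith, by linarith⟩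
  have hs : HasCompactSupport fun z => χ z • z := χ.hasCompactSupport.smul_right
  obtain ⟨A, hA⟩ := exists_c11_of_hasCompactSupport (f := fun z => χ z • z)
    (χ.contDiff.smul contDiff_id) hs
  refine ⟨fun z => χ z • z, A, hA, fun z => ?_, fun z hz => ?_⟩
  · show χ z • z ∈ _
    rw [mem_closedBall_zero_iff, norm_smul, Real.norm_of_nonneg χ.nonneg]
    by_cases h : z ∈ ball (0 : V × V) (ρ + 2)
    · rw [mem_ball_zero_iff] at h
      nlinarith [χ.le_one (x := z), χ.nonneg (x := z), norm_nonneg z]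
    · have : χ z = 0 := by
        by_contra h0
        exact h (χ.support_eq ▸ (Function.mem_support.2 h0))
      rw [this]; linarith
  · have : χ z = 1 := χ.one_of_mem_closedBall (mem_closedBall_zero_iff.2 hz.le)
    simp [this]

theorem exists_nonneg_extension {A ρ c₀ : ℝ} (hA : 0 < A) (hρ : 0 < ρ) (hc₀ : 0 < c₀) :
    ∃ A' > 0, ∀ {ι : Type _} [Nonempty ι] (y : ι → V × V) (f : ι → ℝ) (d : ι → V × V),
      (∀ i j, |f j - f i - pairL (d i) (y j - y i)| ≤ A * ‖y j - y i‖ ^ 2) →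
      (∀ i j, ‖d i - d j‖ ≤ A * ‖y i - y j‖) →
      (∀ i, ‖y i‖ ≤ ρ) → (∀ i, ‖d i‖ ≤ ρ) → (∀ i, c₀ ≤ f i) → (∀ i, f i ≤ ρ) →
      ∃ h : V × V → ℝ, C11 h A' ∧ (∀ z, 0 ≤ h z) ∧ (∀ z, h z ≤ A') ∧
        ∀ i, h (y i) = f i ∧ fderiv ℝ h (y i) = pairL (d i) := by
  obtain ⟨τ, T, hT, hT1, hT2⟩ := exists_cutoff_prod (V := V) ρ hρ
  obtain ⟨B₁, hB₁⟩ : ∃ B₁, B₁ = 2 * ρ + 320 * A * (ρ + 2 + ρ) := ⟨_, rfl⟩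
  obtain ⟨B₂, hB₂⟩ : ∃ B₂, B₂ = ρ + B₁ * (ρ + 2 + ρ) := ⟨_, rfl⟩
  have hB₁0 : 0 < B₁ := by rw [hB₁]; positivity
  have hB₂0 : 0 < B₂ := by rw [hB₂]; positivity
  obtain ⟨Θ, hΘ⟩ : ∃ Θ : ℝ → ℝ, Θ = fun v => v * Real.smoothTransition (2 / c₀ * v) := ⟨_, rfl⟩
  have hΘs : ContDiff ℝ 2 Θ := by
    rw [hΘ]
    exact contDiff_id.mul (Real.smoothTransition.contDiff.comp (contDiff_const.mul contDiff_id))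
  have hΘ0 : ∀ v, 0 ≤ Θ v := fun v => by
    rw [hΘ]
    rcases le_total 0 v with hv | hv
    · exact mul_nonneg hv (Real.smoothTransition.nonneg _)
    · have : 2 / c₀ * v ≤ 0 := mul_nonpos_of_nonneg_of_nonpos (by positivity) hv
      simp [Real.smoothTransition.zero_of_nonpos this]
  have hΘ1 : ∀ v, c₀ / 2 < v → Θ v = v := fun v hv => by
    rw [hΘ]
    have : 1 ≤ 2 / c₀ * v := by
      rw [div_mul_eq_mul_div, le_div_iff₀ hc₀]; linarith
    simp [Real.smoothTransition.one_of_one_le this]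
  obtain ⟨D, hD, hΘe⟩ := exists_estOn hΘs (isCompact_closedBall (0 : ℝ) B₂) (convex_closedBall _ _)
  have hT0 := hT.nonneg
  refine ⟨D * (max B₁ (320 * A) * T * (1 + T)) * (1 + (max B₁ (320 * A) * T * (1 + T))) + D,
    by positivity, fun {ι} _ y f d hf hd hy hdρ hfc hfρ => ?_⟩
  obtain ⟨u, hu1, hu2, hu3⟩ := exists_lipschitz_gradient_extension_prod y f d hA hf hd
  obtain ⟨i₀⟩ := ‹Nonempty ι›
  have hyb : ∀ i, y i ∈ closedBall (0 : V × V) (ρ + 2) := fun i =>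
    mem_closedBall_zero_iff.2 ((hy i).trans (by linarith))
  have hdist : ∀ z ∈ closedBall (0 : V × V) (ρ + 2), ‖z - y i₀‖ ≤ ρ + 2 + ρ := fun z hz =>
    (norm_sub_le _ _).trans (add_le_add (mem_closedBall_zero_iff.1 hz) (hy i₀))
  have hu4 : ∀ z ∈ closedBall (0 : V × V) (ρ + 2), ‖fderiv ℝ u z‖ ≤ B₁ := fun z hz => by
    have h1 := hu2 z (y i₀)
    have h2 : ‖fderiv ℝ u (y i₀)‖ ≤ 2 * ρ := by
      rw [(hu3 i₀).2]
      exact (norm_pairL_le _).trans (by linarith [hdρ i₀])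
    have h3 := norm_le_norm_add_norm_sub (fderiv ℝ u (y i₀)) (fderiv ℝ u z)
    rw [norm_sub_rev] at h3
    have h4 := mul_le_mul_of_nonneg_left (hdist z hz) (by positivity : 0 ≤ 320 * A)
    rw [hB₁]
    linarith
  have hu5 : ∀ z ∈ closedBall (0 : V × V) (ρ + 2), ‖u z‖ ≤ B₂ := fun z hz => by
    have h1 := Convex.norm_image_sub_le_of_norm_fderiv_le (fun z _ => hu1 z) hu4
      (convex_closedBall _ _) (hyb i₀) hz
    have h2 : ‖u (y i₀)‖ ≤ ρ := by
      rw [(hu3 i₀).1, Real.norm_of_nonneg (hc₀.le.trans (hfc i₀))]; exact hfρ i₀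
    have h3 := norm_le_norm_add_norm_sub (u (y i₀)) (u z)
    rw [norm_sub_rev] at h3
    have h4 := mul_le_mul_of_nonneg_left (hdist z hz) hB₁0.le
    rw [hB₂]
    linarith
  have hc1 : C11 (fun z => u (τ z)) (max B₁ (320 * A) * T * (1 + T)) :=
    hT.comp_of_range hT1 (fun z _ => hu1 z) (fun z hz => (hu4 z hz).trans (le_max_left _ _))
      (fun z _ w _ => (hu2 z w).trans (by gcongr; exact le_max_right _ _))
  have hur : ∀ z, u (τ z) ∈ closedBall (0 : ℝ) B₂ := fun z =>
    mem_closedBall_zero_iff.2 (hu5 _ (hT1 z))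
  have hc2 : C11 (fun z => Θ (u (τ z))) _ :=
    hc1.comp_of_range hur hΘe.diff hΘe.bound' hΘe.lip'
  refine ⟨_, hc2.mono (by linarith), fun z => hΘ0 _, fun z => ?_, fun i => ?_⟩
  · have := (le_abs_self _).trans (hΘe.bound _ (hur z))
    have h2 : 0 ≤ D * (max B₁ (320 * A) * T * (1 + T)) *
      (1 + (max B₁ (320 * A) * T * (1 + T))) := by positivity
    linarith
  · have hi : u (y i) = f i := (hu3 i).1
    have hev : (fun z => Θ (u (τ z))) =ᶠ[nhds (y i)] u := by
      have h1 : ∀ᶠ z in nhds (y i), ‖z‖ < ρ + 1 :=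
        continuous_norm.continuousAt.eventually_lt continuousAt_const
          (by have := hy i; linarith)
      have h2 : ∀ᶠ z in nhds (y i), c₀ / 2 < u z :=
        continuousAt_const.eventually_lt hu1.continuous.continuousAt
          (by rw [hi]; have := hfc i; linarith)
      filter_upwards [h1, h2] with z hz1 hz2
      rw [hT2 z hz1, hΘ1 _ hz2]
    exact ⟨hev.self_of_nhds.trans hi, hev.fderiv_eq.trans (hu3 i).2⟩

end extension

section legPath

variable {V : Type*} [NormedAddCommGroup V] [InnerProductSpace ℝ V]

/-- A Legendrian isotopy of the unit sphere, extended to a neighbourhood of it. -/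
structure LegPath (X Q : V × ℝ → V) : Prop where
  smoothX : ContDiff ℝ 2 X
  smoothQ : ContDiff ℝ 2 Q
  unit : ∀ z : V, 1 / 2 < ‖z‖ → ∀ t ∈ Icc (0 : ℝ) 1, ‖Q (z, t)‖ = 1
  leg : ∀ z : V, 1 / 2 < ‖z‖ → ∀ t ∈ Icc (0 : ℝ) 1, ∀ v, ⟪fderiv ℝ X (z, t) (v, 0), Q (z, t)⟫ = 0
  lower : ∃ c : ℝ, 0 < c ∧ ∀ s ∈ sphere (0 : V) 1, ∀ s' ∈ sphere (0 : V) 1, ∀ t ∈ Icc (0 : ℝ) 1,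
    c * ‖s - s'‖ ≤ ‖(X (s, t), Q (s, t)) - (X (s', t), Q (s', t))‖

/-- The convex set on which a Legendrian path is estimated. -/
def estSet (V : Type*) [NormedAddCommGroup V] : Set (V × ℝ) := closedBall 0 1 ×ˢ Icc 0 1

omit [InnerProductSpace ℝ V] in
theorem mk_mem_estSet {z : V} {t : ℝ} : (z, t) ∈ estSet V ↔ ‖z‖ ≤ 1 ∧ t ∈ Icc (0 : ℝ) 1 := by
  simp [estSet]

theorem isCompact_estSet [FiniteDimensional ℝ V] : IsCompact (estSet V) := by
  have : ProperSpace V := FiniteDimensional.proper ℝ V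
  exact (isCompact_closedBall _ _).prod isCompact_Icc

theorem convex_estSet : Convex ℝ (estSet V) := (convex_closedBall _ _).prod (convex_Icc _ _)

theorem hasFDerivAt_slice {G : V × ℝ → V} {z : V} {t : ℝ} (h : DifferentiableAt ℝ G (z, t)) :
    HasFDerivAt (fun z => G (z, t)) ((fderiv ℝ G (z, t)).comp (ContinuousLinearMap.inl ℝ V ℝ)) z :=
  h.hasFDerivAt.comp z (hasFDerivAt_prodMk_left z t)

theorem hasDerivAt_slice {G : V × ℝ → V} {z : V} {t : ℝ} (h : DifferentiableAt ℝ G (z, t)) :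
    HasDerivAt (fun t => G (z, t)) (fderiv ℝ G (z, t) (0, 1)) t := by
  have := (h.hasFDerivAt.comp t (hasFDerivAt_prodMk_right z t)).hasDerivAt
  simpa [Function.comp_def] using this

theorem hasDerivAt_line {G : V × ℝ → V} {z e : V} {t r : ℝ}
    (h : DifferentiableAt ℝ G (z + r • e, t)) :
    HasDerivAt (fun r : ℝ => G (z + r • e, t)) (fderiv ℝ G (z + r • e, t) (e, 0)) r := by
  have h1 : HasDerivAt (fun r : ℝ => z + r • e) e r := by
    simpa using ((hasDerivAt_id r).smul_const e).const_add z
  have := (hasFDerivAt_slice h).comp_hasDerivAt r h1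
  simpa [Function.comp_def] using this

theorem norm_line_le {s s' : V} (hs : ‖s‖ ≤ 1) (hs' : ‖s'‖ ≤ 1) {r : ℝ} (hr : r ∈ Icc (0 : ℝ) 1) :
    ‖s + r • (s' - s)‖ ≤ 1 := by
  have := (convex_closedBall (0 : V) 1).add_smul_sub_mem (mem_closedBall_zero_iff.2 hs)
    (mem_closedBall_zero_iff.2 hs') hr
  simpa using this

section est

variable {A : ℝ}

theorem EstOn.time_fderiv {G : V × ℝ → V} (hG : EstOn G (estSet V) A) {z : V} (hz : ‖z‖ ≤ 1)
    {t t' : ℝ} (ht : t ∈ Icc (0 : ℝ) 1) (ht' : t' ∈ Icc (0 : ℝ) 1) (u : V × ℝ) :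
    ‖fderiv ℝ G (z, t') u - fderiv ℝ G (z, t) u‖ ≤ A * |t' - t| * ‖u‖ := by
  rw [← sub_apply]
  refine (ContinuousLinearMap.le_opNorm _ _).trans ?_
  refine mul_le_mul_of_nonneg_right ((hG.lip' _ (mk_mem_estSet.2 ⟨hz, ht'⟩) _
    (mk_mem_estSet.2 ⟨hz, ht⟩)).trans (le_of_eq ?_)) (norm_nonneg _)
  simp [Prod.norm_def]

theorem EstOn.time {G : V × ℝ → V} (hG : EstOn G (estSet V) A) {z : V} (hz : ‖z‖ ≤ 1)
    {t t' : ℝ} (ht : t ∈ Icc (0 : ℝ) 1) (ht' : t' ∈ Icc (0 : ℝ) 1) :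
    ‖G (z, t') - G (z, t)‖ ≤ A * |t' - t| := by
  refine (hG.lip _ (mk_mem_estSet.2 ⟨hz, ht'⟩) _ (mk_mem_estSet.2 ⟨hz, ht⟩)).trans (le_of_eq ?_)
  simp [Prod.norm_def]

theorem EstOn.space {G : V × ℝ → V} (hG : EstOn G (estSet V) A) {z z' : V} (hz : ‖z‖ ≤ 1)
    (hz' : ‖z'‖ ≤ 1) {t : ℝ} (ht : t ∈ Icc (0 : ℝ) 1) :
    ‖G (z, t) - G (z', t)‖ ≤ A * ‖z - z'‖ := by
  refine (hG.lip _ (mk_mem_estSet.2 ⟨hz, ht⟩) _ (mk_mem_estSet.2 ⟨hz', ht⟩)).trans (le_of_eq ?_)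
  simp [Prod.norm_def]

theorem EstOn.mixed {G : V × ℝ → V} (hG : EstOn G (estSet V) A) {z z' : V} (hz : ‖z‖ ≤ 1)
    (hz' : ‖z'‖ ≤ 1) {t t' : ℝ} (ht : t ∈ Icc (0 : ℝ) 1) (ht' : t' ∈ Icc (0 : ℝ) 1) :
    ‖(G (z', t') - G (z', t)) - (G (z, t') - G (z, t))‖ ≤ A * |t' - t| * ‖z' - z‖ := by
  have hd : ∀ r ∈ Icc (0 : ℝ) 1, ∀ τ ∈ Icc (0 : ℝ) 1,
      DifferentiableAt ℝ G (z + r • (z' - z), τ) := fun r hr τ hτ =>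
    hG.diff _ (mk_mem_estSet.2 ⟨norm_line_le hz hz' hr, hτ⟩)
  have h := norm_image_sub_le_of_norm_deriv_le_segment_01'
    (f := fun r : ℝ => G (z + r • (z' - z), t') - G (z + r • (z' - z), t))
    (C := A * |t' - t| * ‖z' - z‖)
    (fun r hr => ((hasDerivAt_line (hd r hr t' ht')).sub
      (hasDerivAt_line (hd r hr t ht))).hasDerivWithinAt)
    (fun r hr => by
      refine (hG.time_fderiv (norm_line_le hz hz' (Ico_subset_Icc_self hr)) ht ht' _).trans
        (le_of_eq ?_)
      simp [Prod.norm_def])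
  simpa using h

end est

theorem LegPath.inner_fderiv_Q {X Q : V × ℝ → V} (h : LegPath X Q) {z : V} (hz : 1 / 2 < ‖z‖)
    {t : ℝ} (ht : t ∈ Icc (0 : ℝ) 1) (v : V) : ⟪fderiv ℝ Q (z, t) (v, 0), Q (z, t)⟫ = 0 := by
  have h1 := (hasFDerivAt_slice (h.smoothQ.differentiable two_ne_zero (z, t))).norm_sq
  have h2 : (fun z => ‖Q (z, t)‖ ^ 2) =ᶠ[nhds z] fun _ => (1 : ℝ) := by
    filter_upwards [continuous_norm.continuousAt.eventually_const_lt hz] with w hw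
    simp [h.unit w hw t ht]
  have h3 := h1.unique ((hasFDerivAt_const (1 : ℝ) z).congr_of_eventuallyEq h2)
  have h4 := congrArg (fun L => L v) h3
  simp only [smul_apply, ContinuousLinearMap.comp_apply, zero_apply] at h4
  rw [real_inner_comm]
  simpa using h4

theorem half_lt_norm_line {s s' : V} (hs : ‖s‖ = 1) (h : ‖s' - s‖ < 1 / 2) {r : ℝ}
    (hr : r ∈ Icc (0 : ℝ) 1) : 1 / 2 < ‖s + r • (s' - s)‖ := by
  have h1 := norm_sub_norm_le s (-(r • (s' - s)))
  rw [sub_neg_eq_add, norm_neg, norm_smul, Real.norm_of_nonneg hr.1, hs] at h1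
  nlinarith [hr.2, hr.1, norm_nonneg (s' - s)]

theorem LegPath.jet_near {X Q : V × ℝ → V} (h : LegPath X Q) {A : ℝ} (hX : EstOn X (estSet V) A)
    (hQ : EstOn Q (estSet V) A) {s s' : V} (hs : ‖s‖ = 1) (hs' : ‖s'‖ = 1)
    (hss : ‖s' - s‖ < 1 / 2) {t t' : ℝ} (ht : t ∈ Icc (0 : ℝ) 1) (ht' : t' ∈ Icc (0 : ℝ) 1) :
    |⟪Q (s', t'), X (s', t') - X (s, t')⟫ - ⟪Q (s', t), X (s', t) - X (s, t)⟫|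
      ≤ 2 * A ^ 2 * |t' - t| * ‖s' - s‖ ^ 2 := by
  obtain ⟨e, he⟩ : ∃ e, e = s' - s := ⟨_, rfl⟩
  rw [← he] at hss ⊢
  have hl : ∀ r ∈ Icc (0 : ℝ) 1, ‖s + r • e‖ ≤ 1 := fun r hr => by
    rw [he]; exact norm_line_le hs.le hs'.le hr
  have hl2 : ∀ r ∈ Icc (0 : ℝ) 1, 1 / 2 < ‖s + r • e‖ := fun r hr => by
    rw [he] at hss ⊢; exact half_lt_norm_line hs hss hr
  have hl3 : ∀ r ∈ Icc (0 : ℝ) 1, ‖s' - (s + r • e)‖ ≤ ‖e‖ := fun r hr => by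
    have : s' - (s + r • e) = (1 - r) • e := by rw [he]; module
    rw [this, norm_smul, Real.norm_of_nonneg (by linarith [hr.2])]
    nlinarith [hr.1, norm_nonneg e]
  have hA : 0 ≤ A := (norm_nonneg _).trans (hX.bound (s, t) (mk_mem_estSet.2 ⟨hs.le, ht⟩))
  have hd : ∀ r ∈ Icc (0 : ℝ) 1, ∀ τ ∈ Icc (0 : ℝ) 1,
      HasDerivAt (fun r : ℝ => ⟪Q (s', τ), X (s + r • e, τ)⟫)
        ⟪Q (s', τ), fderiv ℝ X (s + r • e, τ) (e, 0)⟫ r := fun r hr τ hτ => by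
    have := (innerSL ℝ (Q (s', τ))).hasFDerivAt.comp_hasDerivAt r
      (hasDerivAt_line (hX.diff _ (mk_mem_estSet.2 ⟨hl r hr, hτ⟩)))
    simpa [Function.comp_def] using this
  have key := norm_image_sub_le_of_norm_deriv_le_segment_01'
    (f := fun r : ℝ => ⟪Q (s', t'), X (s + r • e, t')⟫ - ⟪Q (s', t), X (s + r • e, t)⟫)
    (C := 2 * A ^ 2 * |t' - t| * ‖e‖ ^ 2)
    (fun r hr => ((hd r hr t' ht').sub (hd r hr t ht)).hasDerivWithinAt)
    (fun r hr => by
      replace hr := Ico_subset_Icc_self hr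
      have e1 := h.leg _ (hl2 r hr) t' ht' e
      have e2 := h.leg _ (hl2 r hr) t ht e
      rw [real_inner_comm] at e1 e2
      have e3 : ⟪Q (s', t'), fderiv ℝ X (s + r • e, t') (e, 0)⟫
          - ⟪Q (s', t), fderiv ℝ X (s + r • e, t) (e, 0)⟫
          = ⟪(Q (s', t') - Q (s', t)) - (Q (s + r • e, t') - Q (s + r • e, t)),
              fderiv ℝ X (s + r • e, t') (e, 0)⟫
            + ⟪Q (s', t) - Q (s + r • e, t),
              fderiv ℝ X (s + r • e, t') (e, 0) - fderiv ℝ X (s + r • e, t) (e, 0)⟫ := by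
        simp only [inner_sub_left, inner_sub_right, e1, e2]
        ring
      rw [e3]
      refine (norm_add_le _ _).trans ?_
      have n0 : ‖(e, (0 : ℝ))‖ = ‖e‖ := by simp [Prod.norm_def]
      have n1 := (hQ.mixed (hl r hr) hs'.le ht ht').trans
        (mul_le_mul_of_nonneg_left (hl3 r hr) (by positivity))
      have n2 : ‖fderiv ℝ X (s + r • e, t') (e, 0)‖ ≤ A * ‖e‖ := by
        rw [← n0]
        exact ContinuousLinearMap.le_of_opNorm_le _
          (hX.bound' _ (mk_mem_estSet.2 ⟨hl r hr, ht'⟩)) _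
      have n3 := (hQ.space hs'.le (hl r hr) ht).trans
        (mul_le_mul_of_nonneg_left (hl3 r hr) hA)
      have n4 := hX.time_fderiv (hl r hr) ht ht' (e, 0)
      rw [n0] at n4
      have m1 := (norm_inner_le_norm (𝕜 := ℝ) _ _).trans
        (mul_le_mul n1 n2 (norm_nonneg _) (by positivity))
      have m2 := (norm_inner_le_norm (𝕜 := ℝ) _ _).trans
        (mul_le_mul n3 n4 (norm_nonneg _) (by positivity))
      refine (add_le_add m1 m2).trans (le_of_eq ?_)
      ring)
  have e4 : s + (1 : ℝ) • e = s' := by rw [he]; module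
  simp only [e4, zero_smul, add_zero] at key
  rw [Real.norm_eq_abs] at key
  convert key using 2
  simp only [inner_sub_right]
  ring

theorem LegPath.jet {X Q : V × ℝ → V} (h : LegPath X Q) {A : ℝ} (hX : EstOn X (estSet V) A)
    (hQ : EstOn Q (estSet V) A) {s s' : V} (hs : ‖s‖ = 1) (hs' : ‖s'‖ = 1)
    {t t' : ℝ} (ht : t ∈ Icc (0 : ℝ) 1) (ht' : t' ∈ Icc (0 : ℝ) 1) :
    |⟪Q (s', t'), X (s', t') - X (s, t')⟫ - ⟪Q (s', t), X (s', t) - X (s, t)⟫|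
      ≤ (2 * A ^ 2 + 2 * A + 2 * A ^ 2) * |t' - t| * ‖s' - s‖ ^ 2 := by
  have hA : 0 ≤ A := (norm_nonneg _).trans (hX.bound (s, t) (mk_mem_estSet.2 ⟨hs.le, ht⟩))
  have ha := abs_nonneg (t' - t)
  rcases lt_or_ge ‖s' - s‖ (1 / 2) with hss | hss
  · refine (h.jet_near hX hQ hs hs' hss ht ht').trans ?_
    gcongr
    linarith [sq_nonneg A]
  · have e3 : ⟪Q (s', t'), X (s', t') - X (s, t')⟫ - ⟪Q (s', t), X (s', t) - X (s, t)⟫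
        = ⟪Q (s', t'), (X (s', t') - X (s', t)) - (X (s, t') - X (s, t))⟫
          + ⟪Q (s', t') - Q (s', t), X (s', t) - X (s, t)⟫ := by
      simp only [inner_sub_left, inner_sub_right]
      ring
    rw [e3, ← Real.norm_eq_abs]
    refine (norm_add_le _ _).trans ?_
    have n1 := hX.mixed hs.le hs'.le ht ht'
    have n2 := h.unit s' (by rw [hs']; norm_num) t' ht'
    have n3 := hQ.time hs'.le ht ht'
    have n4 := hX.space hs'.le hs.le ht
    have m1 := (norm_inner_le_norm (𝕜 := ℝ) (Q (s', t')) _).trans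
      (mul_le_mul n2.le n1 (norm_nonneg _) (by positivity))
    have m2 := (norm_inner_le_norm (𝕜 := ℝ) _ _).trans
      (mul_le_mul n3 n4 (norm_nonneg _) (by positivity))
    refine (add_le_add m1 m2).trans ?_
    have h1 : ‖s' - s‖ ≤ 2 * ‖s' - s‖ ^ 2 := by nlinarith
    have h2 : 0 ≤ (A + A ^ 2) * |t' - t| := by positivity
    nlinarith [mul_le_mul_of_nonneg_left h1 h2, mul_nonneg (mul_nonneg (sq_nonneg A) ha)
      (sq_nonneg ‖s' - s‖)]

end legPath

section radial

theorem C11.prodMk {E F H : Type*} [NormedAddCommGroup E] [NormedSpace ℝ E] [NormedAddCommGroup F]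
    [NormedSpace ℝ F] [NormedAddCommGroup H] [NormedSpace ℝ H] {f : E → F} {g : E → H} {A B : ℝ}
    (hf : C11 f A) (hg : C11 g B) : C11 (fun x => (f x, g x)) (max A B) := by
  refine C11.of_hasFDerivAt (fun x => (hf.diff x).hasFDerivAt.prodMk (hg.diff x).hasFDerivAt)
    (fun x => ?_) fun x y => ?_
  · rw [ContinuousLinearMap.opNorm_prod]
    exact max_le_max (hf.bdd x) (hg.bdd x)
  · have : (fderiv ℝ f x).prod (fderiv ℝ g x) - (fderiv ℝ f y).prod (fderiv ℝ g y)
        = (fderiv ℝ f x - fderiv ℝ f y).prod (fderiv ℝ g x - fderiv ℝ g y) := by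
      ext v <;> simp
    rw [this, ContinuousLinearMap.opNorm_prod]
    refine max_le ((hf.lip x y).trans ?_) ((hg.lip x y).trans ?_)
    · gcongr; exact le_max_left _ _
    · gcongr; exact le_max_right _ _

variable {V : Type*} [NormedAddCommGroup V] [InnerProductSpace ℝ V]

theorem eq_of_radial_eq {G : V → V →L[ℝ] ℝ} {A δ : ℝ} (hδ : 0 ≤ δ) (hAδ : 3 * A * δ < 1)
    (hb : ∀ u, ‖G u‖ ≤ A) (hl : ∀ u u', ‖G u - G u'‖ ≤ A * ‖u - u'‖) {P P' : V} (hP : P ≠ 0)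
    (hP' : P' ≠ 0) (h : ∀ v, ⟪P, v⟫ + δ * (‖P‖ * G (‖P‖⁻¹ • P) v)
      = ⟪P', v⟫ + δ * (‖P'‖ * G (‖P'‖⁻¹ • P') v)) : P = P' := by
  have hA : 0 ≤ A := (norm_nonneg _).trans (hb 0)
  have n0 : 0 < ‖P‖ := norm_pos_iff.2 hP
  have n0' : 0 < ‖P'‖ := norm_pos_iff.2 hP'
  have n1 : |‖P'‖ - ‖P‖| ≤ ‖P' - P‖ := abs_norm_sub_norm_le _ _
  have n2 : ‖P'‖ * ‖‖P'‖⁻¹ • P' - ‖P‖⁻¹ • P‖ ≤ 2 * ‖P' - P‖ := by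
    have e : ‖P'‖ • (‖P'‖⁻¹ • P' - ‖P‖⁻¹ • P) = (P' - P) - (‖P'‖ - ‖P‖) • (‖P‖⁻¹ • P) := by
      have e1 : ‖P'‖ • ‖P'‖⁻¹ • P' = P' := by rw [smul_smul, mul_inv_cancel₀ n0'.ne', one_smul]
      have e2 : ‖P‖ • ‖P‖⁻¹ • P = P := by rw [smul_smul, mul_inv_cancel₀ n0.ne', one_smul]
      rw [smul_sub, e1, sub_smul, e2]
      module
    have h1 : ‖P'‖ * ‖‖P'‖⁻¹ • P' - ‖P‖⁻¹ • P‖ = ‖‖P'‖ • (‖P'‖⁻¹ • P' - ‖P‖⁻¹ • P)‖ := by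
      rw [norm_smul, norm_norm]
    rw [h1, e]
    refine (norm_sub_le _ _).trans ?_
    rw [norm_smul (‖P'‖ - ‖P‖), norm_smul ‖P‖⁻¹, norm_inv, norm_norm, inv_mul_cancel₀ n0.ne',
      mul_one, Real.norm_eq_abs]
    linarith
  have h2 := h (P - P')
  have h3 : ⟪P, P - P'⟫ - ⟪P', P - P'⟫ = ‖P - P'‖ ^ 2 := by
    rw [← inner_sub_left, real_inner_self_eq_norm_sq]
  have h4 : ‖P'‖ * G (‖P'‖⁻¹ • P') (P - P') - ‖P‖ * G (‖P‖⁻¹ • P) (P - P')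
      ≤ 3 * A * ‖P - P'‖ ^ 2 := by
    have e : ‖P'‖ * G (‖P'‖⁻¹ • P') (P - P') - ‖P‖ * G (‖P‖⁻¹ • P) (P - P')
        = ‖P'‖ * (G (‖P'‖⁻¹ • P') - G (‖P‖⁻¹ • P)) (P - P')
          + (‖P'‖ - ‖P‖) * G (‖P‖⁻¹ • P) (P - P') := by
      rw [sub_apply]; ring
    rw [e]
    have h5 : (G (‖P'‖⁻¹ • P') - G (‖P‖⁻¹ • P)) (P - P')
        ≤ A * ‖‖P'‖⁻¹ • P' - ‖P‖⁻¹ • P‖ * ‖P - P'‖ :=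
      (le_abs_self _).trans (ContinuousLinearMap.le_of_opNorm_le _ (hl _ _) _)
    have h6 : |G (‖P‖⁻¹ • P) (P - P')| ≤ A * ‖P - P'‖ :=
      ContinuousLinearMap.le_of_opNorm_le _ (hb _) _
    have h7 : (‖P'‖ - ‖P‖) * G (‖P‖⁻¹ • P) (P - P') ≤ ‖P' - P‖ * (A * ‖P - P'‖) := by
      refine (le_abs_self _).trans ?_
      rw [abs_mul]
      exact mul_le_mul n1 h6 (abs_nonneg _) (norm_nonneg _)
    rw [norm_sub_rev P' P] at h7 n2
    have h8 := mul_le_mul_of_nonneg_left h5 n0'.le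
    have h9 := mul_le_mul_of_nonneg_right n2 (by positivity : 0 ≤ A * ‖P - P'‖)
    nlinarith
  have h5 : ‖P - P'‖ ^ 2 ≤ δ * (3 * A * ‖P - P'‖ ^ 2) := by
    rw [← h3]
    nlinarith [mul_le_mul_of_nonneg_left h4 hδ]
  have h6 : ‖P - P'‖ ^ 2 ≤ 0 := by nlinarith [sq_nonneg ‖P - P'‖]
  have h7 : ‖P - P'‖ = 0 := by nlinarith [norm_nonneg (P - P')]
  exact sub_eq_zero.1 (norm_eq_zero.1 h7)

variable [FiniteDimensional ℝ V]

theorem exists_radial {r R : ℝ} (hr : 0 < r) (hR : 0 < R) : ∃ (θ : V → ℝ) (σ : V → V) (B : ℝ),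
    C11 θ B ∧ C11 σ B ∧ (∀ P, 0 ≤ θ P) ∧ (∀ P, θ P ≤ ‖P‖) ∧ (∀ P, θ P ≤ B) ∧
      ∀ P, r < ‖P‖ → ‖P‖ < R → θ P = ‖P‖ ∧ σ P = ‖P‖⁻¹ • P := by
  have : ProperSpace V := FiniteDimensional.proper ℝ V
  let χ : ContDiffBump (0 : V) := ⟨R, R + 1, hR, by linarith⟩
  let η : ContDiffBump (0 : V) := ⟨r / 2, r, by linarith, by linarith⟩
  obtain ⟨a, ha⟩ : ∃ a : V → ℝ, a = fun P => χ P * (1 - η P) := ⟨_, rfl⟩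
  have has : ContDiff ℝ 2 a := by
    rw [ha]; exact χ.contDiff.mul (contDiff_const.sub η.contDiff)
  have hac : HasCompactSupport a := by
    rw [ha]; exact χ.hasCompactSupport.mul_right
  have ha0 : ∀ P, 0 ≤ a P := fun P => by
    rw [ha]; exact mul_nonneg χ.nonneg (by linarith [η.le_one (x := P)])
  have ha1 : ∀ P, a P ≤ 1 := fun P => by
    rw [ha]
    exact mul_le_one₀ χ.le_one (by linarith [η.le_one (x := P)]) (by linarith [η.nonneg (x := P)])
  have hae : ∀ᶠ P in nhds (0 : V), a P = 0 := by
    filter_upwards [closedBall_mem_nhds (0 : V) (half_pos hr)] with P hP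
    rw [ha]
    simp [η.one_of_mem_closedBall hP]
  have haR : ∀ P, R + 1 ≤ ‖P‖ → a P = 0 := fun P hP => by
    rw [ha]
    simp [χ.zero_of_le_dist (x := P) (by simpa using hP)]
  have har : ∀ P, r < ‖P‖ → ‖P‖ < R → a P = 1 := fun P h1 h2 => by
    rw [ha]
    simp [χ.one_of_mem_closedBall (mem_closedBall_zero_iff.2 h2.le),
      η.zero_of_le_dist (x := P) (by simpa using h1.le)]
  have hθ : ContDiff ℝ 2 fun P => a P * ‖P‖ := by
    rw [contDiff_iff_contDiffAt]
    intro P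
    by_cases hP : P = 0
    · subst hP
      refine (contDiffAt_const (c := (0 : ℝ))).congr_of_eventuallyEq ?_
      filter_upwards [hae] with w hw
      rw [hw, zero_mul]
    · exact has.contDiffAt.mul (contDiffAt_norm ℝ hP)
  have hσ : ContDiff ℝ 2 fun P => a P • (‖P‖⁻¹ • P) := by
    rw [contDiff_iff_contDiffAt]
    intro P
    by_cases hP : P = 0
    · subst hP
      refine (contDiffAt_const (c := (0 : V))).congr_of_eventuallyEq ?_
      filter_upwards [hae] with w hw
      rw [hw, zero_smul]
    · exact has.contDiffAt.smul (((contDiffAt_norm ℝ hP).inv (norm_ne_zero_iff.2 hP)).smul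
        contDiffAt_id)
  obtain ⟨B₁, h1⟩ := exists_c11_of_hasCompactSupport hθ hac.mul_right
  obtain ⟨B₂, h2⟩ := exists_c11_of_hasCompactSupport hσ hac.smul_right
  refine ⟨_, _, max (max B₁ B₂) (R + 1), h1.mono ((le_max_left _ _).trans (le_max_left _ _)),
    h2.mono ((le_max_right _ _).trans (le_max_left _ _)),
    fun P => mul_nonneg (ha0 P) (norm_nonneg _),
    fun P => mul_le_of_le_one_left (norm_nonneg _) (ha1 P), fun P => ?_, fun P hP1 hP2 => ?_⟩
  · refine le_trans ?_ (le_max_right _ _)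
    rcases le_total ‖P‖ (R + 1) with h | h
    · exact (mul_le_of_le_one_left (norm_nonneg _) (ha1 P)).trans h
    · rw [haR P h]; linarith
  · simp only [har P hP1 hP2, one_mul, one_smul, and_self]

/-- The generating function, homogeneous of degree one in an annulus of momenta, of a short-time
Legendrian map. -/
theorem exists_step {g : V × V → ℝ} {A δ r R : ℝ} (hg : C11 g A) (hg0 : ∀ z, 0 ≤ g z)
    (hgA : ∀ z, g z ≤ A) (hδ : 0 < δ) (hAδ : 3 * A * δ < 1) (hr : 0 < r) (hR : 0 < R) :
    ∃ w : V × V → ℝ, (∃ B, C11 w B) ∧ (∀ z, 0 ≤ w z) ∧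
      (∀ P x v, |fderiv ℝ w (P, x) (0, v)| ≤ δ * A * ‖P‖ * ‖v‖) ∧
      ∀ x₀ x₁ q₀ q₁ : V, ‖q₁‖ = 1 → δ * g (q₁, x₀) = ⟪q₁, x₁ - x₀⟫ →
        (∀ v, δ * fderiv ℝ g (q₁, x₀) v = ⟪x₁ - x₀, v.1⟫ + ⟪q₀ - q₁, v.2⟫) →
        ∀ P, r < ‖P‖ → ‖P‖ < R → ∀ l : ℝ, 0 < l →
          (∀ v, l * ⟪q₀, v⟫ = ⟪P, v⟫ + fderiv ℝ w (P, x₀) (0, v)) →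
          P = l • q₁ ∧ (∀ v, fderiv ℝ w (P, x₀) (v, 0) = ⟪x₁ - x₀, v⟫) ∧
            w (P, x₀) = ⟪P, x₁ - x₀⟫ := by
  obtain ⟨θ, σ, B, hθ, hσ, hθ0, hθ1, hθB, hθσ⟩ := exists_radial (V := V) hr hR
  have hA := hg.nonneg
  have hB := hθ.nonneg
  have hτ := (hσ.comp (C11.of_continuousLinearMap (ContinuousLinearMap.fst ℝ V V))).prodMk
    (C11.of_continuousLinearMap (ContinuousLinearMap.snd ℝ V V))
  have hτ2 := (hθ.comp (C11.of_continuousLinearMap (ContinuousLinearMap.fst ℝ V V))).prodMk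
    (hg.comp hτ)
  obtain ⟨D, -, hD⟩ := exists_estOn (f := fun u : ℝ × ℝ => δ * (u.1 * u.2))
    (contDiff_const.mul (contDiff_fst.mul contDiff_snd))
    ((isCompact_Icc (a := (0 : ℝ)) (b := B)).prod (isCompact_Icc (a := (0 : ℝ)) (b := A)))
    ((convex_Icc _ _).prod (convex_Icc _ _))
  have hw := hτ2.comp_of_range (S := Icc 0 B ×ˢ Icc 0 A)
    (fun z => ⟨⟨hθ0 _, hθB _⟩, hg0 _, hgA _⟩) hD.diff hD.bound' hD.lip'
  have hder : ∀ P x, HasFDerivAt (fun z : V × V => δ * (θ z.1 * g (σ z.1, z.2)))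
      (δ • (θ P • (fderiv ℝ g (σ P, x)).comp (((fderiv ℝ σ P).comp
        (ContinuousLinearMap.fst ℝ V V)).prod (ContinuousLinearMap.snd ℝ V V))
        + g (σ P, x) • (fderiv ℝ θ P).comp (ContinuousLinearMap.fst ℝ V V))) (P, x) := fun P x => by
    have h1 : HasFDerivAt (fun z : V × V => θ z.1)
        ((fderiv ℝ θ P).comp (ContinuousLinearMap.fst ℝ V V)) (P, x) :=
      (hθ.diff P).hasFDerivAt.comp (P, x) hasFDerivAt_fst
    have h2 : HasFDerivAt (fun z : V × V => σ z.1)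
        ((fderiv ℝ σ P).comp (ContinuousLinearMap.fst ℝ V V)) (P, x) :=
      (hσ.diff P).hasFDerivAt.comp (P, x) hasFDerivAt_fst
    have h3 : HasFDerivAt (fun z : V × V => g (σ z.1, z.2))
        ((fderiv ℝ g (σ P, x)).comp (((fderiv ℝ σ P).comp
        (ContinuousLinearMap.fst ℝ V V)).prod (ContinuousLinearMap.snd ℝ V V))) (P, x) :=
      (hg.diff (σ P, x)).hasFDerivAt.comp (P, x) (h2.prodMk hasFDerivAt_snd)
    exact (h1.mul h3).const_mul δ
  have hder2 : ∀ P x v, fderiv ℝ (fun z : V × V => δ * (θ z.1 * g (σ z.1, z.2))) (P, x) v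
      = δ * (θ P * fderiv ℝ g (σ P, x) (fderiv ℝ σ P v.1, v.2)
        + g (σ P, x) * fderiv ℝ θ P v.1) := fun P x v => by
    rw [(hder P x).fderiv]; simp [mul_add]
  refine ⟨_, ⟨_, hw⟩, fun z => by have := hg0 (σ z.1, z.2); have := hθ0 z.1; positivity,
    fun P x v => ?_, fun x₀ x₁ q₀ q₁ hq₁ h1 h2 P hPr hPR l hl hP => ?_⟩
  · erw [hder2]
    simp only [map_zero, mul_zero, add_zero]
    have h1 : |fderiv ℝ g (σ P, x) (0, v)| ≤ A * ‖v‖ := by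
      have := ContinuousLinearMap.le_of_opNorm_le _ (hg.bdd (σ P, x)) (0, v)
      simpa [Prod.norm_def] using this
    rw [abs_mul, abs_mul, abs_of_pos hδ, abs_of_nonneg (hθ0 P)]
    have := mul_le_mul (hθ1 P) h1 (abs_nonneg _) (norm_nonneg _)
    nlinarith
  · have hP0 : P ≠ 0 := norm_pos_iff.1 (hr.trans hPr)
    obtain ⟨hθP, hσP⟩ := hθσ P hPr hPR
    have hP1 : ∀ v, l * ⟪q₀, v⟫ = ⟪P, v⟫ + fderiv ℝ (fun z : V × V =>
      δ * (θ z.1 * g (σ z.1, z.2))) (P, x₀) (0, v) := hP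
    have hln : ‖l • q₁‖ = l := by rw [norm_smul, hq₁, mul_one, Real.norm_of_nonneg hl.le]
    have hPl : P = l • q₁ := by
      refine eq_of_radial_eq (G := fun u => (fderiv ℝ g (u, x₀)).comp
        (ContinuousLinearMap.inr ℝ V V)) hδ.le hAδ (fun u => ?_) (fun u u' => ?_) hP0
        (norm_pos_iff.1 (by rw [hln]; exact hl)) (fun v => ?_)
      · refine ContinuousLinearMap.opNorm_le_bound _ hA fun v => ?_
        have := ContinuousLinearMap.le_of_opNorm_le _ (hg.bdd (u, x₀)) (0, v)
        simpa [Prod.norm_def] using this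
      · refine ContinuousLinearMap.opNorm_le_bound _ (by positivity) fun v => ?_
        have := ContinuousLinearMap.le_of_opNorm_le _ (hg.lip (u, x₀) (u', x₀)) (0, v)
        simpa [Prod.norm_def] using this
      · have h3 := hP1 v
        rw [hder2] at h3
        have h4 := h2 (0, v)
        have h5 : l⁻¹ • l • q₁ = q₁ := by rw [smul_smul, inv_mul_cancel₀ hl.ne', one_smul]
        simp only [map_zero, mul_zero, add_zero, inner_zero_right, zero_add, inner_sub_left] at h3 h4
        simp only [hln, h5, ContinuousLinearMap.comp_apply, ContinuousLinearMap.inr_apply,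
          inner_smul_left, conj_trivial, ← hσP]
        rw [hθP] at h3
        linear_combination (-1 : ℝ) * h3 - l * h4
    have hσq : σ P = q₁ := by
      have : ‖P‖ = l := by rw [hPl, hln]
      rw [hσP, this, hPl, smul_smul, inv_mul_cancel₀ hl.ne', one_smul]
    have hnear : ∀ᶠ w in nhds P, θ w = ‖w‖ ∧ σ w = ‖w‖⁻¹ • w := by
      filter_upwards [continuous_norm.continuousAt.eventually_const_lt hPr,
        continuous_norm.continuousAt.eventually_lt continuousAt_const hPR] with w hw1 hw2
      exact hθσ w hw1 hw2
    have hrne : ∀ᶠ w in nhds P, w ≠ (0 : V) := continuousAt_id.eventually_ne hP0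
    have d1 : ∀ v, fderiv ℝ θ P v = ⟪q₁, v⟫ := fun v => by
      have e1 := ((hθ.diff P).hasFDerivAt.mul (hθ.diff P).hasFDerivAt)
      have e2 : (fun w => θ w * θ w) =ᶠ[nhds P] fun w => ‖w‖ ^ 2 := by
        filter_upwards [hnear] with w hw
        rw [hw.1, sq]
      have e3 := e1.unique ((hasStrictFDerivAt_norm_sq P).hasFDerivAt.congr_of_eventuallyEq e2)
      have e4 := congrArg (fun L => L v) e3
      simp only [add_apply, smul_apply, innerSL_apply_apply, smul_eq_mul] at e4
      have e5 : ⟪P, v⟫ = θ P * ⟪q₁, v⟫ := by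
        rw [hθP, ← real_inner_smul_left, ← hσq, hσP, smul_smul,
          mul_inv_cancel₀ (norm_ne_zero_iff.2 hP0), one_smul]
      rw [e5] at e4
      have e6 : θ P ≠ 0 := by rw [hθP]; exact norm_ne_zero_iff.2 hP0
      apply mul_left_cancel₀ e6
      simp at e4
      linarith
    have d2 : ∀ v, θ P • fderiv ℝ σ P v = v - ⟪q₁, v⟫ • q₁ := fun v => by
      have e1 := (hθ.diff P).hasFDerivAt.smul (hσ.diff P).hasFDerivAt
      have e2 : (fun w => θ w • σ w) =ᶠ[nhds P] fun w => w := by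
        filter_upwards [hnear, hrne] with w hw hw0
        rw [hw.1, hw.2, smul_smul, mul_inv_cancel₀ (norm_ne_zero_iff.2 hw0), one_smul]
      have e3 := e1.unique ((hasFDerivAt_id P).congr_of_eventuallyEq e2)
      have e4 := congrArg (fun L => L v) e3
      simp only [add_apply, smul_apply, ContinuousLinearMap.smulRight_apply, d1, hσq,
        ContinuousLinearMap.id_apply] at e4
      exact eq_sub_iff_add_eq.2 e4
    refine ⟨hPl, fun v => ?_, ?_⟩
    · erw [hder2]
      have h3 := h2 (θ P • fderiv ℝ σ P v, 0)
      have h4 : (θ P • fderiv ℝ σ P v, (0 : V)) = θ P • (fderiv ℝ σ P v, (0 : V)) := by simp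
      have h5 : fderiv ℝ g (q₁, x₀) (θ P • fderiv ℝ σ P v, 0)
          = θ P * fderiv ℝ g (q₁, x₀) (fderiv ℝ σ P v, 0) := by rw [h4, map_smul]; rfl
      rw [h5] at h3
      simp only [d2, inner_zero_right, add_zero, inner_sub_right, inner_smul_right] at h3
      simp only [d1, hσq]
      rw [real_inner_comm] at h1
      linear_combination h3 + ⟪q₁, v⟫ * h1
    · have : δ * (θ P * g (σ P, x₀)) = ⟪P, x₁ - x₀⟫ := by
        have : ‖P‖ = l := by rw [hPl, hln]
        rw [hσq, hθP, this, hPl, inner_smul_left, conj_trivial, ← h1]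
        ring
      exact this

end radial

section stepFun

variable {V : Type*} [NormedAddCommGroup V] [InnerProductSpace ℝ V]

theorem jet_identity (x0 x1 x0' x1' q0 q1 q0' q1' : V) :
    ⟪q1', x1' - x0'⟫ - ⟪q1, x1 - x0⟫ - (⟪x1 - x0, q1' - q1⟫ + ⟪q0 - q1, x0' - x0⟫)
      = (⟪q1', x1' - x1⟫ - ⟪q0', x0' - x0⟫) + ⟪(q0' - q0) - (q1' - q1), x0' - x0⟫ := by
  rw [real_inner_comm (q1' - q1) (x1 - x0)]
  simp only [inner_sub_left, inner_sub_right]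
  ring

theorem EstOn.time_taylor {A : ℝ} {G : V × ℝ → V} (hG : EstOn G (estSet V) A) {z : V}
    (hz : ‖z‖ ≤ 1) {t δ : ℝ} (hδ : 0 ≤ δ) (ht : t ∈ Icc (0 : ℝ) 1) (ht' : t + δ ∈ Icc (0 : ℝ) 1) :
    ‖G (z, t + δ) - G (z, t) - δ • fderiv ℝ G (z, t + δ) (0, 1)‖ ≤ A * δ * δ := by
  have hA : 0 ≤ A := (norm_nonneg _).trans (hG.bound (z, t) (mk_mem_estSet.2 ⟨hz, ht⟩))
  have hm : ∀ τ ∈ Icc t (t + δ), τ ∈ Icc (0 : ℝ) 1 := fun τ hτ =>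
    ⟨ht.1.trans hτ.1, hτ.2.trans ht'.2⟩
  have h := norm_image_sub_le_of_norm_deriv_le_segment'
    (f := fun τ : ℝ => G (z, τ) - τ • fderiv ℝ G (z, t + δ) (0, 1)) (C := A * δ)
    (a := t) (b := t + δ)
    (fun τ hτ => ((hasDerivAt_slice (hG.diff _ (mk_mem_estSet.2 ⟨hz, hm τ hτ⟩))).sub
      ((hasDerivAt_id τ).smul_const _)).hasDerivWithinAt)
    (fun τ hτ => by
      rw [one_smul]
      refine (hG.time_fderiv hz ht' (hm τ (Ico_subset_Icc_self hτ)) _).trans ?_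
      have h1 : |τ - (t + δ)| ≤ δ := by
        rw [abs_le]; constructor <;> linarith [hτ.1, hτ.2]
      have h2 : ‖((0 : V), (1 : ℝ))‖ = 1 := by simp [Prod.norm_def]
      rw [h2, mul_one]
      gcongr)
    (t + δ) (right_mem_Icc.2 (by linarith))
  simp only [add_sub_cancel_left] at h
  convert h using 2
  module

variable [FiniteDimensional ℝ V]

theorem LegPath.exists_estOn {X Q : V × ℝ → V} (h : LegPath X Q) :
    ∃ A : ℝ, 1 ≤ A ∧ EstOn X (estSet V) A ∧ EstOn Q (estSet V) A := by
  obtain ⟨A, -, hA⟩ := _root_.exists_estOn h.smoothX isCompact_estSet convex_estSet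
  obtain ⟨B, -, hB⟩ := _root_.exists_estOn h.smoothQ isCompact_estSet convex_estSet
  exact ⟨max (max A B) 1, le_max_right _ _,
    hA.mono ((le_max_left _ _).trans (le_max_left _ _)),
    hB.mono ((le_max_right _ _).trans (le_max_left _ _))⟩

/-- A generating function of the short-time map along a positive Legendrian path. -/
theorem LegPath.exists_step_fun {X Q : V × ℝ → V} (h : LegPath X Q)
    (hne : (sphere (0 : V) 1).Nonempty) {c₀ : ℝ} (hc₀ : 0 < c₀)
    (hspeed : ∀ s ∈ sphere (0 : V) 1, ∀ t ∈ Icc (0 : ℝ) 1,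
      c₀ ≤ ⟪fderiv ℝ X (s, t) (0, 1), Q (s, t)⟫) :
    ∃ A : ℝ, 0 < A ∧ ∃ δ₀ : ℝ, 0 < δ₀ ∧ ∀ δ, 0 < δ → δ ≤ δ₀ → ∀ t ∈ Icc (0 : ℝ) 1,
      t + δ ∈ Icc (0 : ℝ) 1 → ∃ g : V × V → ℝ, C11 g A ∧ (∀ z, 0 ≤ g z) ∧ (∀ z, g z ≤ A) ∧
        ∀ s ∈ sphere (0 : V) 1,
          δ * g (Q (s, t + δ), X (s, t)) = ⟪Q (s, t + δ), X (s, t + δ) - X (s, t)⟫ ∧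
          ∀ v, δ * fderiv ℝ g (Q (s, t + δ), X (s, t)) v
            = ⟪X (s, t + δ) - X (s, t), v.1⟫ + ⟪Q (s, t) - Q (s, t + δ), v.2⟫ := by
  obtain ⟨A, hA1, hX, hQ⟩ := h.exists_estOn
  obtain ⟨c, hc, hlow⟩ := h.lower
  have hA : 0 < A := by linarith
  obtain ⟨C, hC⟩ : ∃ C, C = (2 * A ^ 2 + 2 * A + 2 * A ^ 2 + A ^ 2) * (2 / c) ^ 2 + A * (2 / c) :=
    ⟨_, rfl⟩
  have hC0 : 0 < C := by rw [hC]; positivity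
  obtain ⟨A', hA', hext⟩ := exists_nonneg_extension (V := V) hC0 hA (half_pos hc₀)
  refine ⟨A', hA', min (c / (2 * A)) (c₀ / (2 * A)), by positivity,
    fun δ hδ hδ0 t ht ht' => ?_⟩
  have hδc : A * δ ≤ c / 2 := by
    have := hδ0.trans (min_le_left _ _)
    rw [le_div_iff₀ (by positivity)] at this
    linarith
  have hδc₀ : A * δ ≤ c₀ / 2 := by
    have := hδ0.trans (min_le_right _ _)
    rw [le_div_iff₀ (by positivity)] at this
    linarith
  have hab : |t + δ - t| = δ := by rw [add_sub_cancel_left, abs_of_pos hδ]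
  have hn : ∀ s : sphere (0 : V) 1, ‖(s : V)‖ = 1 := fun s => mem_sphere_zero_iff_norm.1 s.2
  have hh : ∀ s : sphere (0 : V) 1, 1 / 2 < ‖(s : V)‖ := fun s => by rw [hn s]; norm_num
  have hu : ∀ s : sphere (0 : V) 1, ‖Q (s, t + δ)‖ = 1 := fun s => h.unit _ (hh s) _ ht'
  have hX1 : ∀ s : sphere (0 : V) 1, ‖δ⁻¹ • (X (s, t + δ) - X (s, t))‖ ≤ A := fun s => by
    have := hX.time (hn s).le ht ht'
    rw [norm_smul, norm_inv, Real.norm_of_nonneg hδ.le, inv_mul_le_iff₀ hδ]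
    rw [hab] at this
    linarith
  have hQ1 : ∀ s : sphere (0 : V) 1, ‖δ⁻¹ • (Q (s, t) - Q (s, t + δ))‖ ≤ A := fun s => by
    have := hQ.time (hn s).le ht ht'
    rw [norm_smul, norm_inv, Real.norm_of_nonneg hδ.le, inv_mul_le_iff₀ hδ, norm_sub_rev]
    rw [hab] at this
    linarith
  have : Nonempty (sphere (0 : V) 1) := hne.to_subtype
  have hys : ∀ i j : sphere (0 : V) 1, ‖(i : V) - j‖
      ≤ (2 / c) * ‖(Q (i, t + δ), X (i, t)) - (Q (j, t + δ), X (j, t))‖ := fun i j => by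
    have h1 := hlow i i.2 j j.2 t ht
    have h2 := hQ.mixed (hn j).le (hn i).le ht ht'
    rw [hab] at h2
    have h3 : ‖Q (i, t) - Q (j, t)‖ ≤ ‖Q (i, t + δ) - Q (j, t + δ)‖ + A * δ * ‖(i : V) - j‖ := by
      have : Q (i, t) - Q (j, t) = (Q (i, t + δ) - Q (j, t + δ))
          - ((Q (i, t + δ) - Q (i, t)) - (Q (j, t + δ) - Q (j, t))) := by module
      rw [this]
      exact (norm_sub_le _ _).trans (add_le_add le_rfl h2)
    have h4 : c * ‖(i : V) - j‖ ≤ ‖(Q (i, t + δ), X (i, t)) - (Q (j, t + δ), X (j, t))‖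
        + A * δ * ‖(i : V) - j‖ := by
      have h5 := norm_fst_le ((Q (i, t + δ), X (i, t)) - (Q (j, t + δ), X (j, t)))
      have h6 := norm_snd_le ((Q (i, t + δ), X (i, t)) - (Q (j, t + δ), X (j, t)))
      have h7 : 0 ≤ A * δ * ‖(i : V) - j‖ := by positivity
      refine h1.trans (max_le ?_ ?_)
      · simp only [Prod.fst_sub, Prod.snd_sub] at h6 ⊢
        linarith
      · simp only [Prod.fst_sub, Prod.snd_sub] at h5 ⊢
        linarith
    rw [div_mul_eq_mul_div, le_div_iff₀ hc]
    nlinarith [mul_le_mul_of_nonneg_right hδc (norm_nonneg ((i : V) - j))]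
  obtain ⟨g, hg1, hg2, hg3, hg4⟩ := hext (fun s : sphere (0 : V) 1 => (Q (s, t + δ), X (s, t)))
    (fun s => ⟪Q (s, t + δ), δ⁻¹ • (X (s, t + δ) - X (s, t))⟫)
    (fun s => (δ⁻¹ • (X (s, t + δ) - X (s, t)), δ⁻¹ • (Q (s, t) - Q (s, t + δ))))
    (fun i j => by
      have h1 := jet_identity (X (i, t)) (X (i, t + δ)) (X (j, t)) (X (j, t + δ))
        (Q (i, t)) (Q (i, t + δ)) (Q (j, t)) (Q (j, t + δ))
      have h2 := h.jet hX hQ (hn i) (hn j) ht ht'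
      have h3 := hQ.mixed (hn i).le (hn j).le ht' ht
      rw [abs_sub_comm t, hab] at h3
      have h3' : ‖Q (j, t) - Q (i, t) - (Q (j, t + δ) - Q (i, t + δ))‖
          ≤ A * δ * ‖(j : V) - i‖ := by
        convert h3 using 2
        module
      have h4 := (norm_inner_le_norm (𝕜 := ℝ) _ _).trans
        (mul_le_mul h3' (hX.space (hn j).le (hn i).le ht) (norm_nonneg _) (by positivity))
      rw [hab] at h2
      rw [Real.norm_eq_abs] at h4
      have h5 := (abs_add_le _ _).trans (add_le_add h2 h4)
      rw [← h1] at h5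
      have h6 : |⟪Q (j, t + δ), δ⁻¹ • (X (j, t + δ) - X (j, t))⟫
          - ⟪Q (i, t + δ), δ⁻¹ • (X (i, t + δ) - X (i, t))⟫
          - pairL (δ⁻¹ • (X (i, t + δ) - X (i, t)), δ⁻¹ • (Q (i, t) - Q (i, t + δ)))
            ((Q (j, t + δ), X (j, t)) - (Q (i, t + δ), X (i, t)))|
          ≤ (2 * A ^ 2 + 2 * A + 2 * A ^ 2 + A ^ 2) * ‖(j : V) - i‖ ^ 2 := by
        rw [← mul_le_mul_iff_right₀ hδ]
        refine le_trans (le_of_eq ?_) (h5.trans (le_of_eq (by ring)))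
        rw [← abs_of_pos hδ, ← abs_mul, abs_of_pos hδ]
        congr 1
        simp only [pairL_apply, inner_smul_left, inner_smul_right, Prod.fst_sub, Prod.snd_sub,
          conj_trivial]
        field_simp
      refine h6.trans ?_
      have h7 := pow_le_pow_left₀ (norm_nonneg _) (hys j i) 2
      rw [mul_pow] at h7
      have h8 : 0 ≤ 2 * A ^ 2 + 2 * A + 2 * A ^ 2 + A ^ 2 := by positivity
      have h9 := mul_le_mul_of_nonneg_left h7 h8
      refine h9.trans ?_
      rw [hC, ← mul_assoc]
      gcongr
      have : 0 < A * (2 / c) := by positivity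
      linarith)
    (fun i j => by
      have h1 : ‖δ⁻¹ • (X (i, t + δ) - X (i, t)) - δ⁻¹ • (X (j, t + δ) - X (j, t))‖
          ≤ A * ‖(i : V) - j‖ := by
        have := hX.mixed (hn j).le (hn i).le ht ht'
        rw [← smul_sub, norm_smul, norm_inv, Real.norm_of_nonneg hδ.le, inv_mul_le_iff₀ hδ]
        rw [hab] at this
        linarith
      have h2 : ‖δ⁻¹ • (Q (i, t) - Q (i, t + δ)) - δ⁻¹ • (Q (j, t) - Q (j, t + δ))‖
          ≤ A * ‖(i : V) - j‖ := by
        have := hQ.mixed (hn j).le (hn i).le ht' ht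
        rw [← smul_sub, norm_smul, norm_inv, Real.norm_of_nonneg hδ.le, inv_mul_le_iff₀ hδ]
        rw [abs_sub_comm t, hab] at this
        linarith
      refine (max_le h1 h2).trans ?_
      refine (mul_le_mul_of_nonneg_left (hys i j) hA.le).trans ?_
      rw [hC, ← mul_assoc]
      gcongr
      have : 0 ≤ (2 * A ^ 2 + 2 * A + 2 * A ^ 2 + A ^ 2) * (2 / c) ^ 2 := by positivity
      linarith)
    (fun i => max_le ((hu i).le.trans hA1) (hX.bound _ (mk_mem_estSet.2 ⟨(hn i).le, ht⟩)))
    (fun i => max_le (hX1 i) (hQ1 i))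
    (fun i => by
      have h1 := hX.time_taylor (hn i).le hδ.le ht ht'
      have h2 := norm_inner_le_norm (𝕜 := ℝ) (Q (i, t + δ))
        (X (i, t + δ) - X (i, t) - δ • fderiv ℝ X (i, t + δ) (0, 1))
      rw [hu i, one_mul, Real.norm_eq_abs, abs_le, inner_sub_right, inner_smul_right] at h2
      have h3 := hspeed i i.2 _ ht'
      rw [real_inner_comm] at h3
      rw [inner_smul_right, ← div_eq_inv_mul, le_div_iff₀ hδ]
      nlinarith [h2.1, mul_le_mul_of_nonneg_left h3 hδ.le,
        mul_le_mul_of_nonneg_right hδc₀ hδ.le])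
    (fun i => by
      have := (le_abs_self _).trans (abs_real_inner_le_norm (Q (i, t + δ))
        (δ⁻¹ • (X (i, t + δ) - X (i, t))))
      rw [hu i, one_mul] at this
      exact this.trans (hX1 i))
  refine ⟨g, hg1, hg2, hg3, fun s hs => ?_⟩
  obtain ⟨h1, h2⟩ := hg4 ⟨s, hs⟩
  simp only at h1 h2
  rw [h1, h2]
  refine ⟨?_, fun v => ?_⟩
  · rw [inner_smul_right, mul_inv_cancel_left₀ hδ.ne']
  · rw [pairL_apply, inner_smul_left, inner_smul_left]
    simp only [conj_trivial]
    field_simp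

end stepFun

section keyLemma

variable {V : Type*} [NormedAddCommGroup V] [InnerProductSpace ℝ V]

/-- The generating function `w` maps the ray over the Legendrian point `(x, q)` to the ray over
`(x', q')`, among momenta in the annulus of radii `r` and `R`. -/
def MovesRay (w : V × V → ℝ) (r R : ℝ) (x q x' q' : V) : Prop :=
  ∀ P, r < ‖P‖ → ‖P‖ < R → ∀ l : ℝ, 0 < l →
    (∀ v, l * ⟪q, v⟫ = ⟪P, v⟫ + fderiv ℝ w (P, x) (0, v)) →
      P = l • q' ∧ (∀ v, fderiv ℝ w (P, x) (v, 0) = ⟪x' - x, v⟫) ∧ w (P, x) = ⟪P, x' - x⟫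

theorem IsTraj.norm_bounds {M : ℕ} {w : ℕ → V × V → ℝ} {x₀ q₀ : V} {x p : ℕ → V}
    (h : IsTraj M w x₀ q₀ x p)
    (hw : ∀ i < M, ∀ P x v, |fderiv ℝ (w i) (P, x) (0, v)| ≤ 1 / 2 * ‖P‖ * ‖v‖)
    (hq : ‖q₀‖ = 1) : ∀ i ≤ M, (1 / 2) ^ M ≤ ‖p i‖ ∧ ‖p i‖ ≤ 2 ^ M := by
  have key : ∀ j ≤ M, (1 / 2) ^ j ≤ ‖p (M - j)‖ ∧ ‖p (M - j)‖ ≤ 2 ^ j := by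
    intro j
    induction j with
    | zero => intro _; simp [h.final, hq]
    | succ j ih =>
      intro hj
      obtain ⟨h1, h2⟩ := ih (by omega)
      obtain ⟨i, hi⟩ : ∃ i, i = M - (j + 1) := ⟨_, rfl⟩
      have hi1 : M - j = i + 1 := by omega
      have hiM : i < M := by omega
      rw [hi1] at h1 h2
      rw [← hi]
      have h3 := h.mom i hiM (p i - p (i + 1))
      have h4 := hw i hiM (p (i + 1)) (x i) (p i - p (i + 1))
      have h5 : ‖p i - p (i + 1)‖ ^ 2 ≤ 1 / 2 * ‖p (i + 1)‖ * ‖p i - p (i + 1)‖ := by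
        rw [← real_inner_self_eq_norm_sq, inner_sub_left, h3]
        linarith [le_abs_self (fderiv ℝ (w i) (p (i + 1), x i) (0, p i - p (i + 1)))]
      have h6 : ‖p i - p (i + 1)‖ ≤ 1 / 2 * ‖p (i + 1)‖ := by
        by_contra! hc
        nlinarith [norm_nonneg (p (i + 1)), norm_nonneg (p i - p (i + 1))]
      have h7 := norm_le_norm_add_norm_sub (p (i + 1)) (p i)
      have h8 := norm_le_norm_add_norm_sub (p i) (p (i + 1))
      rw [norm_sub_rev] at h7
      rw [pow_succ, pow_succ]
      constructor
      · rw [norm_sub_rev] at h8 h7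
        linarith [norm_sub_rev (p i) (p (i + 1))]
      · linarith [norm_sub_rev (p i) (p (i + 1)), norm_nonneg (p (i + 1))]
  intro i hi
  obtain ⟨h1, h2⟩ := key (M - i) (by omega)
  have : M - (M - i) = i := by omega
  rw [this] at h1 h2
  exact ⟨(pow_le_pow_of_le_one (by norm_num) (by norm_num) (Nat.sub_le _ _)).trans h1,
    h2.trans (pow_le_pow_right₀ (by norm_num) (Nat.sub_le _ _))⟩

theorem IsTraj.exists_follow {M : ℕ} {w : ℕ → V × V → ℝ} {x₀ q₀ : V} {x p : ℕ → V} {r R : ℝ}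
    (h : IsTraj M w x₀ q₀ x p) (hr : 0 < r) (hp : ∀ i ≤ M, r < ‖p i‖ ∧ ‖p i‖ < R)
    {X Q : ℕ → V → V} (hX0 : ∀ s ∈ sphere (0 : V) 1, X 0 s = x₀)
    (hQ0 : ∀ s ∈ sphere (0 : V) 1, Q 0 s = s)
    (hm : ∀ i < M, ∀ s ∈ sphere (0 : V) 1,
      MovesRay (w i) r R (X i s) (Q i s) (X (i + 1) s) (Q (i + 1) s)) :
    ∃ s ∈ sphere (0 : V) 1, ∃ l : ℝ, 0 < l ∧ q₀ = l • Q M s ∧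
      trajValue M w q₀ x p = ⟪q₀, X M s⟫ := by
  have n0 : 0 < ‖p 0‖ := hr.trans (hp 0 (Nat.zero_le _)).1
  have hs : ‖p 0‖⁻¹ • p 0 ∈ sphere (0 : V) 1 := by
    rw [mem_sphere_zero_iff_norm, norm_smul, norm_inv, norm_norm, inv_mul_cancel₀ n0.ne']
  obtain ⟨s, hse⟩ : ∃ s, s = ‖p 0‖⁻¹ • p 0 := ⟨_, rfl⟩
  rw [← hse] at hs
  have hstep : ∀ i < M, x i = X i s → p i = ‖p 0‖ • Q i s → p (i + 1) = ‖p 0‖ • Q (i + 1) s ∧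
      x (i + 1) = X (i + 1) s ∧ ⟪p (i + 1), x i - x (i + 1)⟫ + w i (p (i + 1), x i) = 0 := by
    intro i hi hx hpi
    obtain ⟨h1, h2, h3⟩ := hm i hi s hs (p (i + 1)) (hp _ hi).1 (hp _ hi).2 ‖p 0‖ n0
      (fun v => by rw [← hx, ← h.mom i hi v, hpi, real_inner_smul_left])
    have h4 : x (i + 1) = X (i + 1) s := by
      refine ext_inner_right ℝ fun v => ?_
      rw [h.pos i hi v, hx, h2 v, inner_sub_left]
      ring
    refine ⟨h1, h4, ?_⟩
    rw [hx, h3, h4, ← inner_add_right]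
    simp
  have hall : ∀ i ≤ M, x i = X i s ∧ p i = ‖p 0‖ • Q i s := by
    intro i
    induction i with
    | zero =>
      intro _
      rw [h.init, hX0 s hs, hQ0 s hs, hse, smul_smul, mul_inv_cancel₀ n0.ne', one_smul]
      exact ⟨rfl, rfl⟩
    | succ i ih =>
      intro hi
      obtain ⟨h1, h2⟩ := ih (by omega)
      obtain ⟨h3, h4, -⟩ := hstep i hi h1 h2
      exact ⟨h4, h3⟩
  refine ⟨s, hs, ‖p 0‖, n0, by rw [← (hall M le_rfl).2, h.final], ?_⟩
  rw [trajValue, Finset.sum_eq_zero, zero_add, (hall M le_rfl).1]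
  intro i hi
  rw [Finset.mem_range] at hi
  exact (hstep i hi (hall i hi.le).1 (hall i hi.le).2).2.2

theorem IsTraj.trajValue_single {M k : ℕ} (hk : k < M) {ψ : V × V → ℝ} {x₀ q₀ : V} {x p : ℕ → V}
    (h : IsTraj M (fun i => if i = k then ψ else 0) x₀ q₀ x p) :
    trajValue M (fun i => if i = k then ψ else 0) q₀ x p = ⟪q₀, x₀⟫ + ψ (q₀, x₀) := by
  have hx : ∀ i < M, i ≠ k → x (i + 1) = x i := fun i hi hik => by
    refine ext_inner_right ℝ fun v => ?_
    rw [h.pos i hi v]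
    simp [hik]
  have hp : ∀ i < M, i ≠ k → p i = p (i + 1) := fun i hi hik => by
    refine ext_inner_right ℝ fun v => ?_
    rw [h.mom i hi v]
    simp [hik]
  have h1 : ∀ i ≤ k, x i = x₀ := by
    intro i
    induction i with
    | zero => intro _; exact h.init
    | succ i ih => intro hi; rw [hx i (by omega) (by omega), ih (by omega)]
  have h2 : ∀ i ≤ M, k + 1 ≤ i → x i = x (k + 1) := by
    intro i
    induction i with
    | zero => intro _ h; omega
    | succ i ih =>
      intro hi hik
      rcases Nat.eq_or_lt_of_le hik with h | h
      · rw [h]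
      · rw [hx i (by omega) (by omega), ih (by omega) (by omega)]
  have h3 : ∀ j, k + 1 + j ≤ M → p (k + 1 + j) = p (k + 1) := by
    intro j
    induction j with
    | zero => intro _; rfl
    | succ j ih =>
      intro hj
      rw [← ih (by omega), ← add_assoc, ← hp (k + 1 + j) (by omega) (by omega)]
  have h4 : p (k + 1) = q₀ := by
    rw [← h.final, ← h3 (M - (k + 1)) (by omega)]
    congr 1
    omega
  rw [trajValue, Finset.sum_eq_single_of_mem k (Finset.mem_range.2 hk)]
  · rw [h4, h1 k le_rfl, h2 M le_rfl hk, if_pos rfl, inner_sub_right]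
    ring
  · intro i hi hik
    rw [hx i (Finset.mem_range.1 hi) hik]
    simp [hik]

variable [FiniteDimensional ℝ V]

theorem chain_compare {M k : ℕ} (hk : k < M) {w : ℕ → V × V → ℝ} {x₀ q₀ : V} {a : ℝ}
    (hq₀ : ‖q₀‖ = 1) (hwC : ∀ i < M, ∃ B, C11 (w i) B) (hw0 : ∀ i < M, ∀ z, 0 ≤ w i z)
    (hw : ∀ i < M, ∀ P x v, |fderiv ℝ (w i) (P, x) (0, v)| ≤ 1 / 2 * ‖P‖ * ‖v‖)
    {X Q : ℕ → V → V} (hX0 : ∀ s ∈ sphere (0 : V) 1, X 0 s = x₀)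
    (hQ0 : ∀ s ∈ sphere (0 : V) 1, Q 0 s = s) (hQM : ∀ s ∈ sphere (0 : V) 1, ‖Q M s‖ = 1)
    (hm : ∀ i < M, ∀ s ∈ sphere (0 : V) 1, MovesRay (w i) ((1 / 2) ^ (M + 1)) (2 ^ (M + 1))
      (X i s) (Q i s) (X (i + 1) s) (Q (i + 1) s))
    (ha : ∀ s ∈ sphere (0 : V) 1, Q M s = q₀ → ⟪q₀, X M s⟫ ≤ a) :
    ⟪q₀, x₀⟫ + w k (q₀, x₀) ≤ a := by
  refine chain_le (N := M) (wA := w) (wB := fun i => if i = k then w k else 0) (x₀ := x₀)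
    (q₀ := q₀) hwC (fun i _ => ?_) (fun i hi z => ?_) (fun x p h => ?_) (fun x p h => ?_)
  · split_ifs
    · exact hwC k hk
    · exact ⟨0, C11.const 0⟩
  · split_ifs with hik
    · rw [hik]
    · exact hw0 i hi z
  · obtain ⟨s, hs, l, hl, h1, h2⟩ := h.exists_follow (by positivity) (fun i hi => by
      obtain ⟨h1, h2⟩ := h.norm_bounds hw hq₀ i hi
      have h3 : ((1 : ℝ) / 2) ^ (M + 1) < (1 / 2) ^ M :=
        pow_lt_pow_right_of_lt_one₀ (by norm_num) (by norm_num) (Nat.lt_succ_self _)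
      have h4 : (2 : ℝ) ^ M < 2 ^ (M + 1) := pow_lt_pow_right₀ (by norm_num) (Nat.lt_succ_self _)
      exact ⟨h3.trans_le h1, h2.trans_lt h4⟩) hX0 hQ0 hm
    rw [h2]
    refine ha s hs ?_
    have : l = 1 := by
      have := congrArg norm h1
      rw [hq₀, norm_smul, hQM s hs, mul_one, Real.norm_of_nonneg hl.le] at this
      exact this.symm
    rw [h1, this, one_smul]
  · rw [h.trajValue_single hk]

/-- Comparison of the values of a positive Legendrian path, perturbed at time `t`, with those of
the constant path. -/
theorem LegPath.value_le {X Q : V × ℝ → V} (h : LegPath X Q) {c₀ : ℝ} (hc₀ : 0 < c₀)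
    (hspeed : ∀ s ∈ sphere (0 : V) 1, ∀ t ∈ Icc (0 : ℝ) 1,
      c₀ ≤ ⟪fderiv ℝ X (s, t) (0, 1), Q (s, t)⟫)
    {x₀ q₀ : V} (hX0 : ∀ s ∈ sphere (0 : V) 1, X (s, 0) = x₀)
    (hQ0 : ∀ s ∈ sphere (0 : V) 1, Q (s, 0) = s) (hq₀ : ‖q₀‖ = 1)
    {t : ℝ} (ht0 : 0 < t) (ht1 : t < 1) {ψ : V × V → ℝ} (hψ : ∃ B, C11 ψ B)
    (hψ0 : ∀ z, 0 ≤ ψ z) (hψd : ∀ P x v, |fderiv ℝ ψ (P, x) (0, v)| ≤ 1 / 2 * ‖P‖ * ‖v‖)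
    (hψm : ∀ r R : ℝ, 0 < r → ∀ s ∈ sphere (0 : V) 1,
      MovesRay ψ r R (X (s, t)) (Q (s, t)) (X (s, t)) (Q (s, t)))
    {a : ℝ} (ha : ∀ s ∈ sphere (0 : V) 1, Q (s, 1) = q₀ → ⟪q₀, X (s, 1)⟫ ≤ a) :
    ⟪q₀, x₀⟫ + ψ (q₀, x₀) ≤ a := by
  obtain ⟨A, hA, δ₀, hδ₀, hstep⟩ := h.exists_step_fun
    ⟨q₀, mem_sphere_zero_iff_norm.2 hq₀⟩ hc₀ hspeed
  obtain ⟨N, hN⟩ := exists_nat_gt (max (1 / δ₀) (4 * A))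
  have hNδ := (le_max_left _ _).trans_lt hN
  have hNA := (le_max_right _ _).trans_lt hN
  have hN0 : (0 : ℝ) < N := lt_trans (by positivity) hNδ
  obtain ⟨T, hT⟩ : ∃ T : ℕ → ℝ, T = fun i => if i ≤ N then t * (i / N)
    else t + (1 - t) * ((i - N - 1) / N) := ⟨_, rfl⟩
  have hdata : ∀ i < 2 * N + 1, ∃ w : V × V → ℝ, (i = N → w = ψ) ∧ (∃ B, C11 w B) ∧
      (∀ z, 0 ≤ w z) ∧ (∀ P x v, |fderiv ℝ w (P, x) (0, v)| ≤ 1 / 2 * ‖P‖ * ‖v‖) ∧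
      ∀ s ∈ sphere (0 : V) 1, MovesRay w ((1 / 2) ^ (2 * N + 1 + 1)) (2 ^ (2 * N + 1 + 1))
        (X (s, T i)) (Q (s, T i)) (X (s, T (i + 1))) (Q (s, T (i + 1))) := by
    intro i hi
    by_cases hiN : i = N
    · have e1 : T i = t := by
        rw [hT]; simp [hiN, hN0.ne']
      have e2 : T (i + 1) = t := by
        rw [hT]; simp [hiN]
      rw [e1, e2]
      exact ⟨ψ, fun _ => rfl, hψ, hψ0, hψd, fun s hs => hψm _ _ (by positivity) s hs⟩
    · obtain ⟨δ, hδ0, hδN, hδT, hTi, hTi'⟩ : ∃ δ : ℝ, 0 < δ ∧ δ ≤ 1 / N ∧ T (i + 1) = T i + δ ∧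
          T i ∈ Icc (0 : ℝ) 1 ∧ T i + δ ∈ Icc (0 : ℝ) 1 := by
        rcases lt_or_gt_of_ne hiN with hlt | hgt
        · have e1 : T i = t * (i / N) := by rw [hT]; simp [hlt.le]
          have e2 : T (i + 1) = t * ((i + 1) / N) := by
            rw [hT]; simp [Nat.succ_le_of_lt hlt]
          have hiN' : (i : ℝ) + 1 ≤ N := by exact_mod_cast hlt
          have hi0 : (0 : ℝ) ≤ i := Nat.cast_nonneg i
          have b1 : (i + 1 : ℝ) / N ≤ 1 := (div_le_one hN0).2 hiN'
          have b0 : (0 : ℝ) ≤ i / N := by positivity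
          have b2 : (0 : ℝ) < 1 / N := by positivity
          have e3 : (i + 1 : ℝ) / N = i / N + 1 / N := by ring
          refine ⟨t * (1 / N), by positivity, by nlinarith, by rw [e1, e2]; ring, ?_, ?_⟩
          · rw [e1]; exact ⟨by positivity, by nlinarith⟩
          · rw [e1]; exact ⟨by positivity, by nlinarith⟩
        · have e1 : T i = t + (1 - t) * ((i - N - 1) / N) := by rw [hT]; simp [hgt]
          have e2 : T (i + 1) = t + (1 - t) * ((i + 1 - N - 1) / N) := by
            have hn : ¬ i + 1 ≤ N := by omega
            rw [hT]
            simp only [if_neg hn, Nat.cast_add, Nat.cast_one]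
          have hiN' : (i : ℝ) ≤ 2 * N := by exact_mod_cast Nat.lt_succ_iff.1 hi
          have hi0 : (N : ℝ) + 1 ≤ i := by exact_mod_cast hgt
          have b1 : (i - N : ℝ) / N ≤ 1 := (div_le_one hN0).2 (by linarith)
          have b0 : (0 : ℝ) ≤ (i - N - 1) / N := div_nonneg (by linarith) hN0.le
          have b2 : (0 : ℝ) < 1 / N := by positivity
          have e3 : (i - N : ℝ) / N = (i - N - 1) / N + 1 / N := by ring
          have h1t : 0 < 1 - t := by linarith
          have c1 : 0 ≤ (1 - t) * ((i - N - 1 : ℝ) / N) := mul_nonneg h1t.le b0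
          have c2 : 0 < (1 - t) * (1 / N : ℝ) := mul_pos h1t b2
          have c3 := mul_le_mul_of_nonneg_left b1 h1t.le
          rw [e3, mul_add] at c3
          refine ⟨(1 - t) * (1 / N), c2, by nlinarith, by rw [e1, e2]; ring, ?_, ?_⟩
          · rw [e1]; exact ⟨by linarith, by linarith⟩
          · rw [e1]; exact ⟨by linarith, by linarith⟩
      have hNδ' : 1 / (N : ℝ) ≤ δ₀ := by
        rw [div_le_iff₀ hN0]
        rw [div_lt_iff₀ hδ₀] at hNδ
        linarith
      have hδA : A * δ * 4 ≤ 1 := by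
        have h1 : A * δ ≤ A * (1 / N) := mul_le_mul_of_nonneg_left hδN hA.le
        have h2 : A * (1 / N) * 4 ≤ 1 := by
          rw [mul_one_div, div_mul_eq_mul_div, div_le_one hN0]; linarith
        linarith
      obtain ⟨g, hg1, hg2, hg3, hg4⟩ := hstep δ hδ0 (hδN.trans hNδ') (T i) hTi hTi'
      obtain ⟨w, hw1, hw2, hw3, hw4⟩ := exists_step (r := (1 / 2) ^ (2 * N + 1 + 1))
        (R := 2 ^ (2 * N + 1 + 1)) hg1 hg2 hg3 hδ0 (by nlinarith) (by positivity) (by positivity)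
      refine ⟨w, fun h => absurd h hiN, hw1, hw2, fun P x v => (hw3 P x v).trans ?_,
        fun s hs => ?_⟩
      · gcongr
        linarith
      · obtain ⟨g1, g2⟩ := hg4 s hs
        rw [hδT]
        have hs1 := mem_sphere_zero_iff_norm.1 hs
        exact hw4 (X (s, T i)) (X (s, T i + δ)) (Q (s, T i)) (Q (s, T i + δ))
          (h.unit s (by rw [hs1]; norm_num) _ hTi') g1 g2
  choose! w hw1 hw2 hw3 hw4 hw5 using hdata
  have hk : N < 2 * N + 1 := by omega
  have hT0 : T 0 = 0 := by rw [hT]; simp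
  have hT1 : T (2 * N + 1) = 1 := by
    have hn : ¬ 2 * N + 1 ≤ N := by omega
    rw [hT]
    simp only [if_neg hn]
    push_cast
    have : (2 * (N : ℝ) + 1 - N - 1) / N = 1 := by
      rw [div_eq_one_iff_eq hN0.ne']; ring
    rw [this]; ring
  have := chain_compare hk (w := w) (X := fun i s => X (s, T i)) (Q := fun i s => Q (s, T i))
    (x₀ := x₀) (q₀ := q₀) (a := a) hq₀ hw2 hw3 hw4 (by simpa only [hT0] using hX0)
    (by simpa only [hT0] using hQ0) (fun s hs => by
      have hs1 := mem_sphere_zero_iff_norm.1 hs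
      simp only [hT1]
      exact h.unit s (by rw [hs1]; norm_num) 1 ⟨zero_le_one, le_rfl⟩) hw5
    (by simpa only [hT1] using ha)
  rwa [hw1 N hk rfl] at this

end keyLemma

section shift

variable {V : Type*} [NormedAddCommGroup V] [InnerProductSpace ℝ V]

theorem LegPath.inner_fderiv_Q_time {X Q : V × ℝ → V} (h : LegPath X Q) {z : V}
    (hz : 1 / 2 < ‖z‖) {t : ℝ} (ht : t ∈ Icc (0 : ℝ) 1) :
    ⟪fderiv ℝ Q (z, t) (0, 1), Q (z, t)⟫ = 0 := by
  have h1 := (hasDerivAt_slice (h.smoothQ.differentiable two_ne_zero (z, t))).norm_sq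
  have h2 : HasDerivWithinAt (fun τ => ‖Q (z, τ)‖ ^ 2) 0 (Icc 0 1) t :=
    (hasDerivWithinAt_const t (Icc (0 : ℝ) 1) (1 : ℝ)).congr
      (fun τ hτ => by simp [h.unit z hz τ hτ]) (by simp [h.unit z hz t ht])
  have h3 := (uniqueDiffOn_Icc (zero_lt_one (α := ℝ)) t ht).eq_deriv _ h1.hasDerivWithinAt h2
  rw [real_inner_comm]
  linarith

theorem LegPath.hasFDerivAt_shift {X Q : V × ℝ → V} (h : LegPath X Q) (κ : ℝ) (u : V × ℝ) :
    HasFDerivAt (fun u : V × ℝ => X u + (κ * u.2) • Q u)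
      (fderiv ℝ X u + ((κ * u.2) • fderiv ℝ Q u
        + (κ • ContinuousLinearMap.snd ℝ V ℝ).smulRight (Q u))) u :=
  (h.smoothX.differentiable two_ne_zero u).hasFDerivAt.add
    ((hasFDerivAt_snd.const_mul κ).smul (h.smoothQ.differentiable two_ne_zero u).hasFDerivAt)

theorem LegPath.shift {X Q : V × ℝ → V} (h : LegPath X Q) {κ : ℝ} (hκ : 0 ≤ κ) :
    LegPath (fun u => X u + (κ * u.2) • Q u) Q where
  smoothX := h.smoothX.add ((contDiff_const.mul contDiff_snd).smul h.smoothQ)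
  smoothQ := h.smoothQ
  unit := h.unit
  leg z hz t ht v := by
    rw [(h.hasFDerivAt_shift κ (z, t)).fderiv]
    simp [inner_add_left, inner_smul_left, h.leg z hz t ht v, h.inner_fderiv_Q hz ht v]
  lower := by
    obtain ⟨c, hc, hl⟩ := h.lower
    refine ⟨c / (1 + κ), by positivity, fun s hs s' hs' t ht => ?_⟩
    rw [div_mul_eq_mul_div, div_le_iff₀ (by positivity)]
    refine (hl s hs s' hs' t ht).trans ?_
    obtain ⟨d, hd⟩ : ∃ d, d = (X (s, t) + (κ * t) • Q (s, t), Q (s, t))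
      - (X (s', t) + (κ * t) • Q (s', t), Q (s', t)) := ⟨_, rfl⟩
    have e : (X (s, t), Q (s, t)) - (X (s', t), Q (s', t)) = (d.1 - (κ * t) • d.2, d.2) := by
      rw [hd]
      ext1
      · simp only [Prod.fst_sub, Prod.snd_sub]; module
      · simp
    simp only
    rw [← hd, e]
    have h1 := norm_fst_le d
    have h2 := norm_snd_le d
    refine max_le ?_ ?_
    · refine (norm_sub_le _ _).trans ?_
      simp only [norm_smul, Real.norm_of_nonneg (mul_nonneg hκ ht.1)]
      nlinarith [mul_le_mul_of_nonneg_left ht.2 hκ, norm_nonneg d.2, norm_nonneg d,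
        mul_le_mul_of_nonneg_left h2 hκ, mul_nonneg hκ ht.1,
        mul_le_mul_of_nonneg_right (mul_le_mul_of_nonneg_left ht.2 hκ) (norm_nonneg d.2)]
    · simp only
      nlinarith [norm_nonneg d]

theorem LegPath.speed_shift {X Q : V × ℝ → V} (h : LegPath X Q) {κ : ℝ}
    (hnn : ∀ s ∈ sphere (0 : V) 1, ∀ t ∈ Icc (0 : ℝ) 1,
      0 ≤ ⟪fderiv ℝ X (s, t) (0, 1), Q (s, t)⟫) :
    ∀ s ∈ sphere (0 : V) 1, ∀ t ∈ Icc (0 : ℝ) 1,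
      κ ≤ ⟪fderiv ℝ (fun u => X u + (κ * u.2) • Q u) (s, t) (0, 1), Q (s, t)⟫ := by
  intro s hs t ht
  have hz : 1 / 2 < ‖s‖ := by rw [mem_sphere_zero_iff_norm.1 hs]; norm_num
  rw [(h.hasFDerivAt_shift κ (s, t)).fderiv]
  simp [inner_add_left, inner_smul_left, h.inner_fderiv_Q_time hz ht, h.unit s hz t ht,
    hnn s hs t ht]

end shift

section compactness

theorem exists_lower_bound_of_strict {E G : Type*} [NormedAddCommGroup E] [NormedSpace ℝ E]
    [FiniteDimensional ℝ E] [NormedAddCommGroup G] [NormedSpace ℝ G] {Φ : E → G}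
    {L : E →L[ℝ] G} {p₀ : E} (h : HasStrictFDerivAt Φ L p₀) (hL : ∀ v, L v = 0 → v = 0) :
    ∃ c : ℝ, 0 < c ∧ ∀ᶠ p : E × E in nhds (p₀, p₀), c * ‖p.1 - p.2‖ ≤ ‖Φ p.1 - Φ p.2‖ := by
  obtain ⟨K, hK, hKL⟩ := (L : E →ₗ[ℝ] G).exists_antilipschitzWith (LinearMap.ker_eq_bot'.2 hL)
  have hK' : (0 : ℝ) < K := hK
  have h1 := hKL.le_mul_dist
  generalize (K : ℝ) = k at hK' h1
  refine ⟨(2 * k)⁻¹, by positivity, ?_⟩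
  filter_upwards [h.isLittleO.bound (show (0 : ℝ) < (2 * k)⁻¹ by positivity)] with p hp
  specialize h1 p.1 p.2
  rw [dist_eq_norm, dist_eq_norm, ContinuousLinearMap.coe_coe, ← map_sub] at h1
  have h2 := norm_sub_norm_le (L (p.1 - p.2)) (Φ p.1 - Φ p.2)
  rw [norm_sub_rev (L (p.1 - p.2)) (Φ p.1 - Φ p.2)] at h2
  have h3 : k⁻¹ * ‖p.1 - p.2‖ ≤ ‖L (p.1 - p.2)‖ := by
    rwa [inv_mul_le_iff₀ hK']
  have h4 : k⁻¹ = 2 * (2 * k)⁻¹ := by field_simp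
  rw [h4] at h3
  linarith

variable {m : ℕ}

theorem IsLegIsotopyST.exists_lower_bound {F : EuclideanSpace ℝ (Fin m) × ℝ → STSp m}
    (hF : IsLegIsotopyST m F) : ∃ c : ℝ, 0 < c ∧ ∀ s ∈ sph m, ∀ s' ∈ sph m,
      ∀ t ∈ Icc (0 : ℝ) 1, c * ‖s - s'‖ ≤ ‖F (s, t) - F (s', t)‖ := by
  have hcomp : IsCompact ((sph m ×ˢ sph m) ×ˢ Icc (0 : ℝ) 1) :=
    ((isCompact_sphere _ _).prod (isCompact_sphere _ _)).prod isCompact_Icc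
  have hFc := hF.smooth.continuous
  suffices H : ∃ c : ℝ, 0 < c ∧ ∀ z ∈ (sph m ×ˢ sph m) ×ˢ Icc (0 : ℝ) 1,
      c * ‖z.1.1 - z.1.2‖ ≤ ‖F (z.1.1, z.2) - F (z.1.2, z.2)‖ by
    obtain ⟨c, hc, h⟩ := H
    exact ⟨c, hc, fun s hs s' hs' t ht => h ((s, s'), t) ⟨⟨hs, hs'⟩, ht⟩⟩
  refine hcomp.induction_on (p := fun A => ∃ c : ℝ, 0 < c ∧ ∀ z ∈ A,
      c * ‖z.1.1 - z.1.2‖ ≤ ‖F (z.1.1, z.2) - F (z.1.2, z.2)‖) ⟨1, one_pos, by simp⟩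
    (fun A B hAB ⟨c, hc, h⟩ => ⟨c, hc, fun z hz => h z (hAB hz)⟩)
    (fun A B ⟨c, hc, h⟩ ⟨c', hc', h'⟩ => ⟨min c c', lt_min hc hc', fun z hz => ?_⟩)
    (fun z₀ hz₀ => ?_)
  · rcases hz with hz | hz
    · refine le_trans ?_ (h z hz)
      gcongr
      exact min_le_left _ _
    · refine le_trans ?_ (h' z hz)
      gcongr
      exact min_le_right _ _
  obtain ⟨⟨s₀, s₁⟩, t₀⟩ := z₀
  obtain ⟨⟨hs₀, hs₁⟩, ht₀⟩ := hz₀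
  simp only at hs₀ hs₁ ht₀
  by_cases hss : s₀ = s₁
  · subst hss
    have hst := (hF.smooth.contDiffAt (x := (s₀, t₀))).hasStrictFDerivAt (by simp)
    have hsq : HasStrictFDerivAt (fun u : EuclideanSpace ℝ (Fin m) × ℝ => ‖u.1‖ ^ 2)
        ((2 • innerSL ℝ s₀).comp (ContinuousLinearMap.fst ℝ (EuclideanSpace ℝ (Fin m)) ℝ))
        (s₀, t₀) :=
      HasStrictFDerivAt.comp (f := Prod.fst) (g := fun x : EuclideanSpace ℝ (Fin m) => ‖x‖ ^ 2)
        (s₀, t₀) (hasStrictFDerivAt_norm_sq s₀) hasStrictFDerivAt_fst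
    obtain ⟨c, hc, hev⟩ := exists_lower_bound_of_strict
      ((hst.prodMk hsq).prodMk (hasStrictFDerivAt_snd (p := (s₀, t₀)))) (fun v hv => by
        obtain ⟨v, τ⟩ := v
        simp only [ContinuousLinearMap.prod_apply, Prod.mk_eq_zero,
          ContinuousLinearMap.comp_apply, ContinuousLinearMap.coe_fst',
          ContinuousLinearMap.coe_snd', smul_apply, innerSL_apply_apply] at hv
        obtain ⟨⟨h1, h2⟩, rfl⟩ := hv
        have h3 : ⟪v, s₀⟫ = 0 := by
          rw [real_inner_comm]
          simpa using h2
        by_contra hne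
        have hv0 : v ≠ 0 := fun h => hne (by rw [h]; rfl)
        refine hF.imm t₀ ht₀ s₀ hs₀ v h3 hv0 ?_
        have hd : HasFDerivAt (fun s' => F (s', t₀)) ((fderiv ℝ F (s₀, t₀)).comp
          (ContinuousLinearMap.inl ℝ _ ℝ)) s₀ :=
          hst.hasFDerivAt.comp s₀ (hasFDerivAt_prodMk_left s₀ t₀)
        rw [hd.fderiv]
        simpa using h1)
    have hcont : Filter.Tendsto (fun z : (EuclideanSpace ℝ (Fin m) × EuclideanSpace ℝ (Fin m)) × ℝ =>
        ((z.1.1, z.2), (z.1.2, z.2))) (nhds ((s₀, s₀), t₀)) (nhds ((s₀, t₀), (s₀, t₀))) :=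
      Continuous.tendsto (by fun_prop) ((s₀, s₀), t₀)
    refine ⟨_, Filter.inter_mem self_mem_nhdsWithin
      (mem_nhdsWithin_of_mem_nhds (hcont.eventually hev)), c, hc, fun z hz => ?_⟩
    obtain ⟨⟨⟨hz1, hz2⟩, hz3⟩, hz4⟩ := hz
    have n1 : ‖z.1.1‖ = 1 := mem_sphere_zero_iff_norm.1 hz1
    have n2 : ‖z.1.2‖ = 1 := mem_sphere_zero_iff_norm.1 hz2
    have hz5 : c * ‖z.1.1 - z.1.2‖ ≤ ‖F (z.1.1, z.2) - F (z.1.2, z.2)‖ ∨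
        c * ‖z.1.1 - z.1.2‖ ≤ 0 := by
      simpa [Prod.norm_def, n1, n2] using hz4
    exact hz5.elim id fun h => h.trans (norm_nonneg _)
  · have hpos : 0 < ‖F (s₀, t₀) - F (s₁, t₀)‖ :=
      norm_pos_iff.2 (sub_ne_zero.2 fun h => hss (hF.inj t₀ ht₀ hs₀ hs₁ h))
    obtain ⟨a, ha⟩ : ∃ a, a = ‖F (s₀, t₀) - F (s₁, t₀)‖ := ⟨_, rfl⟩
    rw [← ha] at hpos
    have hn : ‖s₀ - s₁‖ ≤ 2 := by
      have n1 : ‖s₀‖ = 1 := mem_sphere_zero_iff_norm.1 hs₀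
      have n2 : ‖s₁‖ = 1 := mem_sphere_zero_iff_norm.1 hs₁
      linarith [norm_sub_le s₀ s₁]
    have hev : ∀ᶠ z : (EuclideanSpace ℝ (Fin m) × EuclideanSpace ℝ (Fin m)) × ℝ in
        nhds ((s₀, s₁), t₀), a / 4 * ‖z.1.1 - z.1.2‖ < ‖F (z.1.1, z.2) - F (z.1.2, z.2)‖ := by
      refine ContinuousAt.eventually_lt (Continuous.continuousAt (by fun_prop))
        (Continuous.continuousAt (by fun_prop)) ?_
      simp only
      rw [← ha]
      nlinarith
    exact ⟨_, mem_nhdsWithin_of_mem_nhds hev, a / 4, by positivity, fun z hz => le_of_lt hz⟩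

end compactness

section extract

variable {m : ℕ}

theorem exists_normalize (V : Type*) [NormedAddCommGroup V] [InnerProductSpace ℝ V]
    [FiniteDimensional ℝ V] :
    ∃ n : V → V, ContDiff ℝ 2 n ∧ ∀ z, 1 / 2 < ‖z‖ → n z = ‖z‖⁻¹ • z := by
  let η : ContDiffBump (0 : V) := ⟨1 / 4, 1 / 2, by norm_num, by norm_num⟩
  refine ⟨fun z => (1 - η z) • (‖z‖⁻¹ • z), ?_, fun z hz => ?_⟩
  · rw [contDiff_iff_contDiffAt]
    intro z
    by_cases hz : z = 0
    · subst hz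
      refine (contDiffAt_const (c := (0 : V))).congr_of_eventuallyEq ?_
      filter_upwards [closedBall_mem_nhds (0 : V) (show (0 : ℝ) < 1 / 4 by norm_num)] with w hw
      rw [η.one_of_mem_closedBall hw, sub_self, zero_smul]
    · exact (contDiffAt_const.sub η.contDiffAt).smul (((contDiffAt_norm ℝ hz).inv
        (norm_ne_zero_iff.2 hz)).smul contDiffAt_id)
  · have h0 : η z = 0 := η.zero_of_le_dist (by rw [dist_zero_right]; exact hz.le)
    simp only [h0, sub_zero, one_smul]

theorem IsLegIsotopyST.exists_legPath {F : EuclideanSpace ℝ (Fin m) × ℝ → STSp m}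
    (hF : IsLegIsotopyST m F) : ∃ X Q : EuclideanSpace ℝ (Fin m) × ℝ → EuclideanSpace ℝ (Fin m),
      LegPath X Q ∧ ∀ s ∈ sph m, ∀ t, (X (s, t), Q (s, t)) = F (s, t) := by
  obtain ⟨n, hn, hnz⟩ := exists_normalize (EuclideanSpace ℝ (Fin m))
  have hns : ∀ z, 1 / 2 < ‖z‖ → n z ∈ sph m := fun z hz => by
    have h0 : ‖z‖ ≠ 0 := by linarith
    rw [hnz z hz, sph, mem_sphere_zero_iff_norm, norm_smul, norm_inv, norm_norm,
      inv_mul_cancel₀ h0]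
  have hnn : ∀ s ∈ sph m, n s = s := fun s hs => by
    have h1 : ‖s‖ = 1 := mem_sphere_zero_iff_norm.1 hs
    rw [hnz s (by rw [h1]; norm_num), h1, inv_one, one_smul]
  have hG : ContDiff ℝ 2 fun u : EuclideanSpace ℝ (Fin m) × ℝ => F (n u.1, u.2) :=
    (contDiff_infty.1 hF.smooth 2).comp ((hn.comp contDiff_fst).prodMk contDiff_snd)
  have hperp : ∀ z, 1 / 2 < ‖z‖ → ∀ v, ⟪fderiv ℝ n z v, n z⟫ = 0 := fun z hz v => by
    have h1 := (hn.differentiable two_ne_zero z).hasFDerivAt.norm_sq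
    have h2 : (fun z => ‖n z‖ ^ 2) =ᶠ[nhds z] fun _ => (1 : ℝ) := by
      filter_upwards [continuous_norm.continuousAt.eventually_const_lt hz] with w hw
      rw [mem_sphere_zero_iff_norm.1 (hns w hw), one_pow]
    have h3 := h1.unique ((hasFDerivAt_const (1 : ℝ) z).congr_of_eventuallyEq h2)
    have h4 := congrArg (fun L => L v) h3
    simp only [smul_apply, ContinuousLinearMap.comp_apply, zero_apply] at h4
    rw [real_inner_comm]
    simpa using h4
  refine ⟨fun u => (F (n u.1, u.2)).1, fun u => (F (n u.1, u.2)).2,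
    ⟨contDiff_fst.comp hG, contDiff_snd.comp hG, fun z hz t ht =>
      mem_sphere_zero_iff_norm.1 (hF.mem_sphere _ (hns z hz) t ht), fun z hz t ht v => ?_, ?_⟩,
    fun s hs t => by simp only [hnn s hs]⟩
  · have h1 := hasFDerivAt_slice (G := fun u => (F (n u.1, u.2)).1) (z := z) (t := t)
      ((contDiff_fst.comp hG).differentiable two_ne_zero _)
    have h2 : HasFDerivAt (fun s' => F (s', t)) (fderiv ℝ (fun s' => F (s', t)) (n z)) (n z) :=
      (((hF.smooth.comp (contDiff_id.prodMk contDiff_const)).differentiable (by simp)) _).hasFDerivAt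
    have h3 := (h2.comp z (hn.differentiable two_ne_zero z).hasFDerivAt).fst
    have h4 := congrArg (fun L => L v) (h1.unique h3)
    simp only [ContinuousLinearMap.comp_apply, ContinuousLinearMap.inl_apply,
      ContinuousLinearMap.coe_fst'] at h4
    rw [h4]
    exact hF.leg t ht (n z) (hns z hz) _ (hperp z hz v)
  · obtain ⟨c, hc, h⟩ := hF.exists_lower_bound
    refine ⟨c, hc, fun s hs s' hs' t ht => ?_⟩
    simp only [hnn s hs, hnn s' hs']
    exact h s hs s' hs' t ht

end extract

section rigidity

variable {V : Type*} [NormedAddCommGroup V] [InnerProductSpace ℝ V]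

theorem movesRay_zero {r R : ℝ} (x q : V) : MovesRay (fun _ : V × V => (0 : ℝ)) r R x q x q := by
  intro P _ _ l _ hP
  have hPq : P = l • q := ext_inner_right ℝ fun v => by
    have := hP v
    simp only [fderiv_fun_const, Pi.zero_apply, zero_apply, add_zero] at this
    rw [← this, real_inner_smul_left]
  exact ⟨hPq, by simp, by simp⟩

variable [FiniteDimensional ℝ V]

/-- A small bump function near `(q₀, x₀)` whose associated deformation fixes all other rays. -/
theorem exists_bump_movesRay {x₀ q₀ : V} (hq₀ : ‖q₀‖ = 1) {ρ : ℝ} (hρ : 0 < ρ) (hρ' : ρ ≤ 1 / 4) :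
    ∃ ψ : V × V → ℝ, ∃ ε : ℝ, 0 < ε ∧ (∃ B, C11 ψ B) ∧ (∀ z, 0 ≤ ψ z) ∧
      (∀ P x v, |fderiv ℝ ψ (P, x) (0, v)| ≤ 1 / 2 * ‖P‖ * ‖v‖) ∧ ψ (q₀, x₀) = ε ∧
      ∀ x q, ‖q‖ = 1 → 2 * ρ < ‖q - q₀‖ ∨ 2 * ρ < ‖x - x₀‖ → ∀ r R, 0 < r →
        MovesRay ψ r R x q x q := by
  obtain ⟨b, hb⟩ : ∃ b : ContDiffBump (q₀, x₀), b.rOut = ρ :=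
    ⟨⟨ρ / 2, ρ, by positivity, by linarith⟩, rfl⟩
  have hbs : ContDiff ℝ 2 (b : V × V → ℝ) := b.contDiff
  obtain ⟨A, hA⟩ := exists_c11_of_hasCompactSupport hbs b.hasCompactSupport
  have hA0 := hA.nonneg
  obtain ⟨ε, hε⟩ : ∃ ε : ℝ, ε = (4 * (A + 1))⁻¹ := ⟨_, rfl⟩
  have hε0 : 0 < ε := by rw [hε]; positivity
  have hεA : ε * A ≤ 1 / 4 := by
    rw [hε, inv_mul_le_iff₀ (by positivity)]
    linarith
  have hd : ∀ z, fderiv ℝ (fun z => ε * b z) z = ε • fderiv ℝ b z := fun z =>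
    ((hA.diff z).hasFDerivAt.const_mul ε).fderiv
  have hout : ∀ z, ρ < dist z (q₀, x₀) → b z = 0 ∧ fderiv ℝ b z = 0 := fun z hz => by
    have hz' : z ∉ tsupport (b : V × V → ℝ) := by
      rw [b.tsupport_eq, hb, mem_closedBall, not_le]
      exact hz
    exact ⟨image_eq_zero_of_notMem_tsupport hz',
      image_eq_zero_of_notMem_tsupport fun h => hz' (tsupport_fderiv_subset ℝ h)⟩
  have hpair : ∀ v : V, ‖((0 : V), v)‖ = ‖v‖ := fun v => by simp [Prod.norm_def]
  refine ⟨fun z => ε * b z, ε, hε0,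
    exists_c11_of_hasCompactSupport (contDiff_const.mul hbs) b.hasCompactSupport.mul_left,
    fun z => mul_nonneg hε0.le b.nonneg, fun P x v => ?_, ?_, fun x q hq hxq r R hr => ?_⟩
  · rw [hd, smul_apply, smul_eq_mul, abs_mul, abs_of_pos hε0]
    by_cases hP : ‖P‖ < 1 / 2
    · rw [(hout (P, x) ?_).2]
      · simp only [zero_apply, abs_zero, mul_zero]
        positivity
      · refine lt_of_lt_of_le ?_ (le_max_left _ _)
        simp only
        rw [dist_eq_norm, norm_sub_rev]
        linarith [norm_sub_norm_le q₀ P]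
    · have h1 := (fderiv ℝ b (P, x)).le_of_opNorm_le (hA.bdd (P, x)) (0, v)
      rw [hpair, Real.norm_eq_abs] at h1
      have h2 := mul_le_mul_of_nonneg_left h1 hε0.le
      have h3 := mul_le_mul_of_nonneg_right hεA (norm_nonneg v)
      nlinarith [norm_nonneg v]
  · simp [b.one_of_mem_closedBall (mem_closedBall_self b.rIn_pos.le)]
  · have hfar : ∀ l : ℝ, 0 < l → b (l • q, x) = 0 ∧ fderiv ℝ b (l • q, x) = 0 := fun l hl => by
      refine hout _ ?_
      by_contra hle
      rw [not_lt, Prod.dist_eq, max_le_iff, dist_eq_norm, dist_eq_norm] at hle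
      obtain ⟨h1, h2⟩ := hle
      rcases hxq with h3 | h3
      · have h4 : ‖q - q₀‖ ≤ ‖q - l • q‖ + ‖l • q - q₀‖ := norm_sub_le_norm_sub_add_norm_sub _ _ _
        have h5 : ‖q - l • q‖ = |1 - l| := by
          rw [show q - l • q = (1 - l) • q by module, norm_smul, hq, mul_one, Real.norm_eq_abs]
        have h6 := abs_norm_sub_norm_le q₀ (l • q)
        rw [hq₀, norm_smul, hq, mul_one, Real.norm_of_nonneg hl.le, norm_sub_rev] at h6
        linarith
      · linarith
    intro P _ _ l hl hP
    have hPq : P = l • q := by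
      have h1 := hP (P - l • q)
      simp only [hd, smul_apply, smul_eq_mul] at h1
      have h2 := (fderiv ℝ b (P, x) - fderiv ℝ b (l • q, x)).le_of_opNorm_le
        (hA.lip (P, x) (l • q, x)) (0, P - l • q)
      rw [(hfar l hl).2, sub_zero, hpair, Real.norm_eq_abs] at h2
      have h3 : ‖(P, x) - (l • q, x)‖ = ‖P - l • q‖ := by simp [Prod.norm_def]
      rw [h3] at h2
      have h4 : ‖P - l • q‖ ^ 2 = -(ε * fderiv ℝ b (P, x) (0, P - l • q)) := by
        rw [← real_inner_self_eq_norm_sq]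
        nth_rewrite 1 [inner_sub_left]
        rw [real_inner_smul_left]
        linarith
      have h5 := mul_le_mul_of_nonneg_left ((neg_le_abs _).trans h2) hε0.le
      have h6 : ‖P - l • q‖ ^ 2 ≤ 0 := by
        nlinarith [mul_le_mul_of_nonneg_right hεA (sq_nonneg ‖P - l • q‖)]
      rw [← sub_eq_zero, ← norm_eq_zero]
      exact pow_eq_zero_iff two_ne_zero |>.1 (le_antisymm h6 (sq_nonneg _))
    subst hPq
    refine ⟨rfl, fun v => ?_, ?_⟩
    · rw [hd, (hfar l hl).2]
      simp
    · simp [(hfar l hl).1]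

variable {X Q : V × ℝ → V} {x₀ x₁ : V}

theorem LegPath.fibre_value_le (h : LegPath X Q)
    (hnn : ∀ s ∈ sphere (0 : V) 1, ∀ t ∈ Icc (0 : ℝ) 1,
      0 ≤ ⟪fderiv ℝ X (s, t) (0, 1), Q (s, t)⟫)
    (hX0 : ∀ s ∈ sphere (0 : V) 1, X (s, 0) = x₀) (hQ0 : ∀ s ∈ sphere (0 : V) 1, Q (s, 0) = s)
    (hX1 : ∀ s ∈ sphere (0 : V) 1, X (s, 1) = x₁) {q₀ : V} (hq₀ : ‖q₀‖ = 1) {t κ : ℝ}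
    (ht0 : 0 < t) (ht1 : t < 1) (hκ : 0 < κ) {ψ : V × V → ℝ} (hψ : ∃ B, C11 ψ B)
    (hψ0 : ∀ z, 0 ≤ ψ z) (hψd : ∀ P x v, |fderiv ℝ ψ (P, x) (0, v)| ≤ 1 / 2 * ‖P‖ * ‖v‖)
    (hψm : ∀ r R, 0 < r → ∀ s ∈ sphere (0 : V) 1, MovesRay ψ r R
      (X (s, t) + (κ * t) • Q (s, t)) (Q (s, t)) (X (s, t) + (κ * t) • Q (s, t)) (Q (s, t))) :
    ⟪q₀, x₀⟫ + ψ (q₀, x₀) ≤ ⟪q₀, x₁⟫ + κ := by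
  refine (h.shift hκ.le).value_le hκ (h.speed_shift hnn) (fun s hs => by simp [hX0 s hs]) hQ0 hq₀
    ht0 ht1 hψ hψ0 hψd hψm fun s hs hs1 => ?_
  simp [inner_add_right, inner_smul_right, hX1 s hs, hs1, hq₀]

theorem LegPath.endpoint_eq (h : LegPath X Q)
    (hnn : ∀ s ∈ sphere (0 : V) 1, ∀ t ∈ Icc (0 : ℝ) 1,
      0 ≤ ⟪fderiv ℝ X (s, t) (0, 1), Q (s, t)⟫)
    (hX0 : ∀ s ∈ sphere (0 : V) 1, X (s, 0) = x₀) (hQ0 : ∀ s ∈ sphere (0 : V) 1, Q (s, 0) = s)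
    (hX1 : ∀ s ∈ sphere (0 : V) 1, X (s, 1) = x₁) : x₀ = x₁ := by
  by_contra hne
  have hpos : 0 < ‖x₀ - x₁‖ := norm_pos_iff.2 (sub_ne_zero.2 hne)
  have hq : ‖‖x₀ - x₁‖⁻¹ • (x₀ - x₁)‖ = 1 := by
    rw [norm_smul, norm_inv, norm_norm, inv_mul_cancel₀ hpos.ne']
  have := h.fibre_value_le hnn hX0 hQ0 hX1 hq one_half_pos one_half_lt_one (half_pos hpos)
    (ψ := fun _ => 0) ⟨0, C11.const 0⟩ (fun _ => le_rfl)
    (fun P x v => by simp only [fderiv_fun_const, Pi.zero_apply, zero_apply, abs_zero]; positivity)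
    (fun r R _ s _ => movesRay_zero _ _)
  have h2 : ⟪‖x₀ - x₁‖⁻¹ • (x₀ - x₁), x₀ - x₁⟫ = ‖x₀ - x₁‖ := by
    rw [real_inner_smul_left, real_inner_self_eq_norm_sq]
    field_simp
  rw [inner_sub_right] at h2
  linarith

theorem LegPath.exists_eq (h : LegPath X Q)
    (hnn : ∀ s ∈ sphere (0 : V) 1, ∀ t ∈ Icc (0 : ℝ) 1,
      0 ≤ ⟪fderiv ℝ X (s, t) (0, 1), Q (s, t)⟫)
    (hX0 : ∀ s ∈ sphere (0 : V) 1, X (s, 0) = x₀) (hQ0 : ∀ s ∈ sphere (0 : V) 1, Q (s, 0) = s)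
    (hX1 : ∀ s ∈ sphere (0 : V) 1, X (s, 1) = x₀) {q₀ : V} (hq₀ : ‖q₀‖ = 1) {t : ℝ}
    (ht0 : 0 < t) (ht1 : t < 1) : ∃ s ∈ sphere (0 : V) 1, X (s, t) = x₀ ∧ Q (s, t) = q₀ := by
  by_contra! hno
  have hclosed : IsClosed ((fun s => (X (s, t), Q (s, t))) '' sphere (0 : V) 1) := by
    have hX := h.smoothX.continuous
    have hQ := h.smoothQ.continuous
    exact ((isCompact_sphere (0 : V) 1).image (by fun_prop)).isClosed
  have hnot : (x₀, q₀) ∈ ((fun s => (X (s, t), Q (s, t))) '' sphere (0 : V) 1)ᶜ := by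
    rintro ⟨s, hs, he⟩
    exact hno s hs (congrArg Prod.fst he) (congrArg Prod.snd he)
  obtain ⟨δ, hδ, hball⟩ := Metric.isOpen_iff.1 hclosed.isOpen_compl _ hnot
  have hfar : ∀ s ∈ sphere (0 : V) 1, δ ≤ ‖X (s, t) - x₀‖ ∨ δ ≤ ‖Q (s, t) - q₀‖ := by
    intro s hs
    have h1 : (X (s, t), Q (s, t)) ∉ ball (x₀, q₀) δ := fun h2 => hball h2 ⟨s, hs, rfl⟩
    rwa [mem_ball, not_lt, Prod.dist_eq, le_max_iff, dist_eq_norm, dist_eq_norm] at h1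
  obtain ⟨ρ, hρ⟩ : ∃ ρ, ρ = min (δ / 4) (1 / 4) := ⟨_, rfl⟩
  have hρ0 : 0 < ρ := by rw [hρ]; positivity
  have hρδ : ρ ≤ δ / 4 := hρ ▸ min_le_left _ _
  obtain ⟨ψ, ε, hε, hψ, hψ0, hψd, hψε, hψm⟩ :=
    exists_bump_movesRay (x₀ := x₀) hq₀ hρ0 (hρ ▸ min_le_right _ _)
  obtain ⟨κ, hκ⟩ : ∃ κ, κ = min (ε / 2) (δ / 4) := ⟨_, rfl⟩
  have hκ0 : 0 < κ := by rw [hκ]; positivity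
  have hκδ : κ ≤ δ / 4 := hκ ▸ min_le_right _ _
  have hκε : κ ≤ ε / 2 := hκ ▸ min_le_left _ _
  have := h.fibre_value_le hnn hX0 hQ0 hX1 hq₀ ht0 ht1 hκ0 hψ hψ0 hψd
    (fun r R hr s hs => by
      have hs1 : ‖s‖ = 1 := mem_sphere_zero_iff_norm.1 hs
      have hQ1 : ‖Q (s, t)‖ = 1 := h.unit s (by rw [hs1]; norm_num) t ⟨ht0.le, ht1.le⟩
      refine hψm _ _ hQ1 ?_ r R hr
      rcases hfar s hs with h1 | h1
      · right
        have h2 := norm_sub_le_norm_sub_add_norm_sub (X (s, t))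
          (X (s, t) + (κ * t) • Q (s, t)) x₀
        have h3 : ‖X (s, t) - (X (s, t) + (κ * t) • Q (s, t))‖ = κ * t := by
          rw [sub_add_cancel_left, norm_neg, norm_smul, hQ1, mul_one,
            Real.norm_of_nonneg (by positivity)]
        nlinarith
      · left
        linarith)
  linarith

theorem LegPath.eq_const (h : LegPath X Q)
    (hnn : ∀ s ∈ sphere (0 : V) 1, ∀ t ∈ Icc (0 : ℝ) 1,
      0 ≤ ⟪fderiv ℝ X (s, t) (0, 1), Q (s, t)⟫)
    (hX0 : ∀ s ∈ sphere (0 : V) 1, X (s, 0) = x₀) (hQ0 : ∀ s ∈ sphere (0 : V) 1, Q (s, 0) = s)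
    (hX1 : ∀ s ∈ sphere (0 : V) 1, X (s, 1) = x₀) {s : V} (hs : s ∈ sphere (0 : V) 1) {t : ℝ}
    (ht : t ∈ Icc (0 : ℝ) 1) : X (s, t) = x₀ := by
  obtain ⟨A, hA1, -, hQ⟩ := h.exists_estOn
  obtain ⟨c, hc, hlow⟩ := h.lower
  have hA : 0 < A := by linarith
  obtain ⟨δ, hδ⟩ : ∃ δ, δ = c / (2 * A) := ⟨_, rfl⟩
  have hδ0 : 0 < δ := by rw [hδ]; positivity
  have hAδ : A * δ = c / 2 := by rw [hδ]; field_simp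
  have step : ∀ t₀ ∈ Icc (0 : ℝ) 1, (∀ s ∈ sphere (0 : V) 1, X (s, t₀) = x₀) →
      ∀ t ∈ Icc (0 : ℝ) 1, |t - t₀| ≤ δ → ∀ s ∈ sphere (0 : V) 1, X (s, t) = x₀ := by
    intro t₀ ht₀ hX t ht htt s hs
    rcases eq_or_lt_of_le ht.1 with rfl | ht0
    · exact hX0 s hs
    rcases eq_or_lt_of_le ht.2 with rfl | ht1
    · exact hX1 s hs
    have hs1 : ‖s‖ = 1 := mem_sphere_zero_iff_norm.1 hs
    obtain ⟨s', hs', hXs, hQs⟩ := h.exists_eq hnn hX0 hQ0 hX1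
      (h.unit s (by rw [hs1]; norm_num) t ht) ht0 ht1
    have hs1' : ‖s'‖ = 1 := mem_sphere_zero_iff_norm.1 hs'
    have h1 := hlow s hs s' hs' t₀ ht₀
    have h2 := hQ.mixed hs1'.le hs1.le ht₀ ht
    rw [hX s hs, hX s' hs'] at h1
    simp only [Prod.mk_sub_mk, sub_self, Prod.norm_mk, norm_zero] at h1
    rw [max_eq_right (norm_nonneg _)] at h1
    rw [hQs, show (Q (s, t) - Q (s, t₀)) - (Q (s, t) - Q (s', t₀))
      = -(Q (s, t₀) - Q (s', t₀)) by abel, norm_neg] at h2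
    have h3 : A * |t - t₀| * ‖s - s'‖ ≤ A * δ * ‖s - s'‖ := by gcongr
    rw [hAδ] at h3
    have h4 : ‖s - s'‖ ≤ 0 := by nlinarith [norm_nonneg (s - s')]
    rw [sub_eq_zero.1 (norm_le_zero_iff.1 h4)]
    exact hXs
  have ind : ∀ n : ℕ, ∀ t ∈ Icc (0 : ℝ) 1, t ≤ n * δ → ∀ s ∈ sphere (0 : V) 1, X (s, t) = x₀ := by
    intro n
    induction n with
    | zero =>
      intro t ht htn s hs
      rw [le_antisymm (by simpa using htn) ht.1]
      exact hX0 s hs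
    | succ n ih =>
      intro t ht htn s hs
      push_cast at htn
      rcases le_total t (n * δ) with hle | hle
      · exact ih t ht hle s hs
      · have hm : (n * δ : ℝ) ∈ Icc (0 : ℝ) 1 := ⟨by positivity, hle.trans ht.2⟩
        exact step _ hm (ih _ hm le_rfl) t ht (by rw [abs_of_nonneg] <;> linarith) s hs
  obtain ⟨n, hn⟩ := exists_nat_gt (1 / δ)
  exact ind n t ht (ht.2.trans ((div_lt_iff₀ hδ0).1 hn).le) s hs

end rigidity

theorem nonneg_isotopy_fibre_to_fibre (m : ℕ) (hm : 2 ≤ m)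
    (x₀ x₁ : EuclideanSpace ℝ (Fin m))
    (F : EuclideanSpace ℝ (Fin m) × ℝ → STSp m)
    (hF : IsLegIsotopyST m F) (hnn : NonnegST m F)
    (hF0 : ∀ s ∈ sph m, F (s, 0) = (x₀, s))
    (hF1 : stSlice m F 1 = fib m x₁) :
    x₀ = x₁ ∧ ∀ t ∈ Icc (0:ℝ) 1, stSlice m F t = fib m x₀ := by
  obtain ⟨X, Q, h, hXQ⟩ := hF.exists_legPath
  have hX : ∀ s ∈ sph m, ∀ t, X (s, t) = (F (s, t)).1 := fun s hs t => by rw [← hXQ s hs t]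
  have hQ : ∀ s ∈ sph m, ∀ t, Q (s, t) = (F (s, t)).2 := fun s hs t => by rw [← hXQ s hs t]
  have hsp : ∀ s ∈ sphere (0 : EuclideanSpace ℝ (Fin m)) 1, ∀ t ∈ Icc (0 : ℝ) 1,
      0 ≤ ⟪fderiv ℝ X (s, t) (0, 1), Q (s, t)⟫ := fun s hs t ht => by
    have h1 := hnn s hs t ht
    have h2 := (hasDerivAt_slice (h.smoothX.differentiable two_ne_zero (s, t))).deriv
    simp only [hX s hs] at h2
    rwa [h2, ← hQ s hs] at h1
  have hX0 : ∀ s ∈ sphere (0 : EuclideanSpace ℝ (Fin m)) 1, X (s, 0) = x₀ := fun s hs => by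
    rw [hX s hs, hF0 s hs]
  have hQ0 : ∀ s ∈ sphere (0 : EuclideanSpace ℝ (Fin m)) 1, Q (s, 0) = s := fun s hs => by
    rw [hQ s hs, hF0 s hs]
  have hX1 : ∀ s ∈ sphere (0 : EuclideanSpace ℝ (Fin m)) 1, X (s, 1) = x₁ := fun s hs => by
    rw [hX s hs]
    exact (hF1.subset ⟨s, hs, rfl⟩).1
  obtain rfl := h.endpoint_eq hsp hX0 hQ0 hX1
  refine ⟨rfl, fun t ht => subset_antisymm ?_ ?_⟩
  · rintro _ ⟨s, hs, rfl⟩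
    refine ⟨?_, hF.mem_sphere s hs t ht⟩
    rw [mem_singleton_iff, ← hX s hs]
    exact h.eq_const hsp hX0 hQ0 hX1 hs ht
  · rcases eq_or_lt_of_le ht.1 with rfl | ht0
    · rintro ⟨x, q⟩ ⟨hx, hq⟩
      obtain rfl : x = x₀ := hx
      exact ⟨q, hq, hF0 q hq⟩
    rcases eq_or_lt_of_le ht.2 with rfl | ht1
    · exact hF1.symm.subset
    rintro ⟨x, q⟩ ⟨hx, hq⟩
    obtain rfl : x = x₀ := hx
    obtain ⟨s, hs, h1, h2⟩ := h.exists_eq hsp hX0 hQ0 hX1 (mem_sphere_zero_iff_norm.1 hq) ht0 ht1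
    refine ⟨s, hs, ?_⟩
    simp only [← hXQ s hs, h1, h2]
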